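/- Let α ∈ (0, 1/4] and γ = 2α/(1−2α). Suppose ω = Σ_{n=1}^N θ_n χ_{Ω_n(t)} is a patch solution to the g-SQG equation on ℝ² on a time interval [0,T) with T < ∞, and suppose sup_{t∈[0,T)} ‖Ω(t)‖_{C^{1,γ}} < ∞. Then sup_{t∈[0,T)} sup_{(n,ξ)≠(j,η)} (|n−j| + |ξ−η|) / |z_n(ξ,t) − z_j(η,t)| < ∞, where z_n(·,t) is a constant-speed parameterization of ∂Ω_n(t), the pairs (n,ξ),(j,η) range over {1,…,N}×𝕋, and |ξ−η| denotes distance on 𝕋 = ℝ/2πℤ. That is, no splash-like singularity (no touch of boundaries of distinct patches nor of folds of a single patch boundary) can occur at time T. -/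

import Mathlib

open Real Set Filter MeasureTheory

noncomputable section

abbrev R2 : Type := EuclideanSpace ℝ (Fin 2)

def mk2 (a b : ℝ) : R2 := (EuclideanSpace.equiv (Fin 2) ℝ).symm ![a, b]

/-- Counterclockwise rotation by 90°: `(v₁,v₂)^⊥ = (−v₂,v₁)`. -/
def perp (v : R2) : R2 := mk2 (-(v 1)) (v 0)

/-- The g-SQG Biot–Savart kernel `w ↦ w^⊥/|w|^{2+2α}`. -/
def kern (α : ℝ) (w : R2) : R2 := (‖w‖ ^ (2 + 2 * α))⁻¹ • perp w

/-- The g-SQG velocity of `ω = Σ θₙ χ_{Ωₙ}`: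
`u(x) = c_α ∫_{ℝ²} (x−y)^⊥/|x−y|^{2+2α} ω(y) dy`. -/
def gSQGvel (α cα : ℝ) {N : ℕ} (θ : Fin N → ℝ) (Ω : Fin N → Set R2) (x : R2) : R2 :=
  cα • ∑ n, θ n • ∫ y in Ω n, kern α (x - y)

/-- The distance on the torus `𝕋 = ℝ/2πℤ` between (the classes of) two reals. -/
def distT (ξ η : ℝ) : ℝ := ⨅ k : ℤ, |ξ - η + 2 * π * k|

open scoped Topology

lemma perp_0 (v : R2) : perp v 0 = -(v 1) := by simp [perp, mk2]
lemma perp_1 (v : R2) : perp v 1 = v 0 := by simp [perp, mk2]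

lemma inner2 (v w : R2) : inner ℝ v w = v 0 * w 0 + v 1 * w 1 := by
  simp [PiLp.inner_apply, Fin.sum_univ_two]; ring

lemma norm2_sq (v : R2) : ‖v‖ ^ 2 = v 0 ^ 2 + v 1 ^ 2 := by
  rw [EuclideanSpace.norm_sq_eq]; simp [Fin.sum_univ_two]

lemma norm_perp (v : R2) : ‖perp v‖ = ‖v‖ := by
  have : ‖perp v‖ ^ 2 = ‖v‖ ^ 2 := by rw [norm2_sq, norm2_sq, perp_0, perp_1]; ring
  exact (sq_eq_sq₀ (norm_nonneg _) (norm_nonneg _)).1 this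

/-- wedge product -/
def wd (a b : R2) : ℝ := a 0 * b 1 - a 1 * b 0

lemma inner_perp_left (a b : R2) : inner ℝ (perp a) b = wd a b := by
  rw [inner2, perp_0, perp_1, wd]; ring

lemma inner_perp_right (a b : R2) : inner ℝ a (perp b) = - wd a b := by
  rw [inner2, perp_0, perp_1, wd]; ring

def perpL : R2 →L[ℝ] R2 := LinearMap.toContinuousLinearMap
  { toFun := perp
    map_add' := fun a b => by ext i; fin_cases i <;> simp [perp, mk2]; ring
    map_smul' := fun a b => by ext i; fin_cases i <;> simp [perp, mk2] }

lemma perpL_apply (v : R2) : perpL v = perp v := rfl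

lemma wd_le (a b : R2) : |wd a b| ≤ ‖a‖ * ‖b‖ := by
  rw [← inner_perp_left]
  calc _ ≤ ‖perp a‖ * ‖b‖ := abs_real_inner_le_norm _ _
    _ = _ := by rw [norm_perp]

lemma wd_add_left (a b c : R2) : wd (a + b) c = wd a c + wd b c := by simp [wd]; ring
lemma wd_add_right (a b c : R2) : wd a (b + c) = wd a b + wd a c := by simp [wd]; ring
lemma wd_sub_left (a b c : R2) : wd (a - b) c = wd a c - wd b c := by simp [wd]; ring
lemma wd_sub_right (a b c : R2) : wd a (b - c) = wd a b - wd a c := by simp [wd]; ring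
lemma wd_smul_left (r : ℝ) (a c : R2) : wd (r • a) c = r * wd a c := by simp [wd]; ring
lemma wd_smul_right (r : ℝ) (a c : R2) : wd a (r • c) = r * wd a c := by simp [wd]; ring
lemma wd_swap (a c : R2) : wd a c = - wd c a := by simp [wd]; ring

lemma wd_id (e f T : R2) :
    wd e f * ‖T‖ ^ 2 = inner ℝ e T * wd T f + wd e T * inner ℝ T f := by
  rw [norm2_sq, inner2, inner2]; simp only [wd]; ring

/-- if two vectors have the same components along `T` and `perp T`, they agree -/
lemma eq_of_inner_wd {v w T : R2} (hT : T ≠ 0) (h1 : inner ℝ v T = inner ℝ w T)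
    (h2 : wd v T = wd w T) : v = w := by
  have hT' : ‖T‖ ^ 2 ≠ 0 := by positivity
  rw [norm2_sq] at hT'
  rw [inner2, inner2] at h1
  simp only [wd] at h2
  have e0 : (v 0 - w 0) * (T 0 ^ 2 + T 1 ^ 2) = 0 := by linear_combination T 0 * h1 + T 1 * h2
  have e1 : (v 1 - w 1) * (T 0 ^ 2 + T 1 ^ 2) = 0 := by linear_combination T 1 * h1 - T 0 * h2
  have e0 := (mul_eq_zero.1 e0).resolve_right hT'
  have e1 := (mul_eq_zero.1 e1).resolve_right hT'
  ext i; fin_cases i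
  · simpa [sub_eq_zero] using e0
  · simpa [sub_eq_zero] using e1

lemma norm_sq_decomp (v T : R2) : ‖v‖ ^ 2 * ‖T‖ ^ 2 = (inner ℝ v T) ^ 2 + (wd v T) ^ 2 := by
  rw [norm2_sq, norm2_sq, inner2, wd]; ring

lemma continuous_wd : Continuous (fun p : R2 × R2 => wd p.1 p.2) := by
  unfold wd; fun_prop

/-! distT -/

lemma distT_bdd (x y : ℝ) : BddBelow (range fun k : ℤ => |x - y + 2 * π * k|) :=
  ⟨0, by rintro _ ⟨k, rfl⟩; exact abs_nonneg _⟩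

lemma distT_le (x y : ℝ) (k : ℤ) : distT x y ≤ |x - y + 2 * π * k| := ciInf_le (distT_bdd x y) k

lemma distT_le_abs (x y : ℝ) : distT x y ≤ |x - y| := by simpa using distT_le x y 0

lemma distT_nonneg (x y : ℝ) : 0 ≤ distT x y := le_ciInf fun _ => abs_nonneg _

lemma distT_exists (x y : ℝ) : ∃ k : ℤ, distT x y = |x - y + 2 * π * k| ∧ distT x y ≤ π := by
  have hp := Real.pi_pos
  have key : ∀ k : ℤ, |x - y + 2 * π * k| = 2 * π * |(x - y) / (2 * π) - (-k : ℤ)| := by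
    intro k
    rw [← abs_of_pos (show (0:ℝ) < 2 * π by positivity), ← abs_mul, abs_of_pos (show (0:ℝ) < 2 * π by positivity)]
    congr 1; push_cast; field_simp; ring
  refine ⟨-round ((x - y) / (2 * π)), ?_, ?_⟩
  · apply le_antisymm (distT_le _ _ _)
    apply le_ciInf
    intro k
    rw [key, key]
    refine mul_le_mul_of_nonneg_left ?_ (by positivity)
    rw [neg_neg]
    exact round_le ((x - y) / (2 * π)) (-k)
  · refine (distT_le x y (-round ((x - y) / (2 * π)))).trans ?_
    rw [key, neg_neg]
    have := abs_sub_round ((x - y) / (2 * π))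
    nlinarith

lemma distT_le_pi (x y : ℝ) : distT x y ≤ π := (distT_exists x y).choose_spec.2

lemma distT_tri (x y x' y' : ℝ) : distT x y ≤ distT x' y' + |x - x'| + |y - y'| := by
  obtain ⟨k, hk, -⟩ := distT_exists x' y'
  have h1 := distT_le x y k
  rw [hk]
  have h2 : x - y + 2 * π * k = (x' - y' + 2 * π * k) + (x - x') + -(y - y') := by ring
  have h3 := abs_add_three (x' - y' + 2 * π * k) (x - x') (-(y - y'))
  rw [abs_neg, ← h2] at h3
  linarith

lemma distT_shift (x y φ : ℝ) : distT (x + φ) (y + φ) = distT x y := by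
  unfold distT; congr 1; ext k; congr 1; ring

lemma distT_per (x y : ℝ) (k : ℤ) : distT (x + 2 * π * k) y = distT x y := by
  apply le_antisymm
  · obtain ⟨m, hm, -⟩ := distT_exists x y
    rw [hm]; refine (distT_le _ _ (m - k)).trans (le_of_eq ?_); congr 1; push_cast; ring
  · obtain ⟨m, hm, -⟩ := distT_exists (x + 2 * π * k) y
    rw [hm]; refine (distT_le _ _ (m + k)).trans (le_of_eq ?_); congr 1; push_cast; ring

lemma distT_comm (x y : ℝ) : distT x y = distT y x := by
  have h : ∀ x y, distT x y ≤ distT y x := by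
    intro x y
    obtain ⟨m, hm, -⟩ := distT_exists y x
    rw [hm]; refine (distT_le _ _ (-m)).trans (le_of_eq ?_)
    rw [← abs_neg]; congr 1; push_cast; ring
  exact le_antisymm (h _ _) (h _ _)

lemma distT_per' (x y : ℝ) (k : ℤ) : distT x (y + 2 * π * k) = distT x y := by
  rw [distT_comm, distT_per, distT_comm]

lemma distT_zero {x y : ℝ} (h : distT x y = 0) : ∃ k : ℤ, x = y + 2 * π * k := by
  obtain ⟨k, hk, -⟩ := distT_exists x y
  rw [h] at hk
  have := abs_eq_zero.1 hk.symm
  exact ⟨-k, by push_cast; linarith⟩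

lemma distT_eq_abs {x y : ℝ} (h : |x - y| ≤ π) : distT x y = |x - y| := by
  apply le_antisymm (distT_le_abs x y)
  apply le_ciInf
  intro k
  have hp := Real.pi_pos
  rcases eq_or_ne k 0 with rfl | hk
  · simp
  · have h1 : (1:ℝ) ≤ |(k:ℝ)| := by
      rw [← Int.cast_abs]; exact_mod_cast Int.one_le_abs hk
    have h2 : |2 * π * (k:ℝ)| = 2 * π * |(k:ℝ)| := by rw [abs_mul, abs_of_pos (by positivity)]
    have h3 : |2 * π * (k:ℝ)| ≤ |x - y + 2 * π * k| + |x - y| := by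
      have := abs_sub (x - y + 2 * π * k) (x - y)
      simpa using this
    nlinarith

lemma continuous_distT : Continuous (fun p : ℝ × ℝ => distT p.1 p.2) := by
  have : LipschitzWith 2 (fun p : ℝ × ℝ => distT p.1 p.2) := by
    apply LipschitzWith.of_le_add_mul
    rintro ⟨x, y⟩ ⟨x', y'⟩
    have := distT_tri x y x' y'
    have h1 : |x - x'| ≤ dist (x, y) (x', y') := by
      rw [Prod.dist_eq]; exact le_max_left _ _
    have h2 : |y - y'| ≤ dist (x, y) (x', y') := by
      rw [Prod.dist_eq]; exact le_max_right _ _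
    simp only [NNReal.coe_ofNat]
    linarith
  exact this.continuous

lemma exists_rep (x : ℝ) : ∃ k : ℤ, x + 2 * π * k ∈ Ico 0 (2 * π) := by
  have hp := Real.two_pi_pos
  obtain ⟨k, hk, -⟩ := existsUnique_add_zsmul_mem_Ico hp x 0
  refine ⟨k, ?_⟩
  simp only [zsmul_eq_mul, zero_add] at hk
  rwa [mul_comm (2 * π)]

/-! curves -/

structure Cv (M γ c : ℝ) (z : ℝ → R2) : Prop where
  per : ∀ x, z (x + 2 * π) = z x
  inj : ∀ x y, z x = z y → distT x y = 0
  C1 : ContDiff ℝ 1 z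
  spd : ∀ x, ‖deriv z x‖ = c
  cpos : 0 < c
  bd : ∀ x, ‖z x‖ ≤ M
  hol : ∀ x y, ‖deriv z x - deriv z y‖ ≤ M * |x - y| ^ γ
  cM : c ≤ M

namespace Cv
variable {M γ c : ℝ} {z : ℝ → R2}

lemma Mpos (h : Cv M γ c z) : 0 < M := h.cpos.trans_le h.cM

lemma perk (h : Cv M γ c z) (x : ℝ) (k : ℤ) : z (x + 2 * π * k) = z x := by
  have : Function.Periodic z (2 * π) := h.per
  rw [mul_comm]; exact this.int_mul k x

lemma diff (h : Cv M γ c z) : Differentiable ℝ z := h.C1.differentiable (by norm_num)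

lemma hd (h : Cv M γ c z) (x : ℝ) : HasDerivAt z (deriv z x) x := (h.diff x).hasDerivAt

lemma cont (h : Cv M γ c z) : Continuous z := h.C1.continuous

lemma dcont (h : Cv M γ c z) : Continuous (deriv z) := h.C1.continuous_deriv (by norm_num)

lemma dper (h : Cv M γ c z) (x : ℝ) : deriv z (x + 2 * π) = deriv z x := by
  rw [← deriv_comp_add_const]
  congr 1; ext1 y; exact h.per y

lemma dperk (h : Cv M γ c z) (x : ℝ) (k : ℤ) : deriv z (x + 2 * π * k) = deriv z x := by
  have : Function.Periodic (deriv z) (2 * π) := h.dper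
  rw [mul_comm]; exact this.int_mul k x

lemma lip (h : Cv M γ c z) (x y : ℝ) : ‖z x - z y‖ ≤ c * |x - y| := by
  have := Convex.norm_image_sub_le_of_norm_deriv_le (f := z) (s := univ) (C := c) (x := y) (y := x)
    (fun x _ => h.diff x) (fun x _ => (h.spd x).le) convex_univ (mem_univ _) (mem_univ _)
  simpa using this

lemma lipM (h : Cv M γ c z) (x y : ℝ) : ‖z x - z y‖ ≤ M * |x - y| :=
  (h.lip x y).trans (by gcongr; exact h.cM)

lemma taylor (hγ : 0 ≤ γ) (h : Cv M γ c z) (x y : ℝ) :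
    ‖z y - z x - (y - x) • deriv z x‖ ≤ M * |y - x| ^ γ * |y - x| := by
  have := Convex.norm_image_sub_le_of_norm_hasDerivWithin_le (f := fun s => z s - s • deriv z x)
    (f' := fun s => deriv z s - (1:ℝ) • deriv z x) (s := uIcc x y) (C := M * |y - x| ^ γ) (x := x) (y := y)
    (fun s _ => ((h.hd s).sub ((hasDerivAt_id s).smul_const _)).hasDerivWithinAt)
    (fun s hs => by
      rw [one_smul]
      refine (h.hol s x).trans ?_
      have := h.Mpos
      have := abs_sub_left_of_mem_uIcc hs
      gcongr)
    (convex_uIcc x y) left_mem_uIcc right_mem_uIcc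
  have e : z y - z x - (y - x) • deriv z x = z y - y • deriv z x - (z x - x • deriv z x) := by
    rw [sub_smul]; abel
  rw [e]; simpa using this

lemma chord (hγ : 0 ≤ γ) (h : Cv M γ c z) {ρ x y : ℝ} (hρ : M * ρ ^ γ ≤ c / 2) (hxy : |x - y| ≤ ρ) :
    c / 2 * |x - y| ≤ ‖z x - z y‖ := by
  have h1 := h.taylor hγ y x
  have h2 : ‖(x - y) • deriv z y‖ = c * |x - y| := by
    rw [norm_smul, h.spd, Real.norm_eq_abs, mul_comm]
  have h3 : ‖(x - y) • deriv z y‖ ≤ ‖z x - z y‖ + ‖z x - z y - (x - y) • deriv z y‖ := by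
    have := norm_sub_le (z x - z y) (z x - z y - (x - y) • deriv z y)
    simpa using this
  have h4 : M * |x - y| ^ γ * |x - y| ≤ c / 2 * |x - y| := by
    have := h.Mpos
    refine mul_le_mul_of_nonneg_right (le_trans ?_ hρ) (abs_nonneg _)
    gcongr
  linarith

lemma chordT (hγ : 0 ≤ γ) (h : Cv M γ c z) {ρ x y : ℝ} (hρ : M * ρ ^ γ ≤ c / 2) (hxy : distT x y ≤ ρ) :
    c / 2 * distT x y ≤ ‖z x - z y‖ := by
  obtain ⟨k, hk, -⟩ := distT_exists x y
  have e : x - y + 2 * π * k = (x + 2 * π * k) - y := by ring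
  rw [e] at hk
  rw [hk] at hxy ⊢
  have := h.chord hγ hρ hxy
  rwa [h.perk] at this

lemma holT (h : Cv M γ c z) (x y : ℝ) : ‖deriv z x - deriv z y‖ ≤ M * distT x y ^ γ := by
  obtain ⟨k, hk, -⟩ := distT_exists x y
  have e : x - y + 2 * π * k = (x + 2 * π * k) - y := by ring
  rw [hk, e, ← h.dperk x k]
  exact h.hol _ _

lemma shift (h : Cv M γ c z) (φ : ℝ) : Cv M γ c (fun x => z (x + φ)) := by
  have hd : ∀ x, deriv (fun x => z (x + φ)) x = deriv z (x + φ) := fun x => by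
    rw [deriv_comp_add_const]
  refine ⟨fun x => ?_, fun x y hxy => ?_, ?_, fun x => ?_, h.cpos, fun x => h.bd _, fun x y => ?_, h.cM⟩
  · rw [show x + 2 * π + φ = x + φ + 2 * π by ring]; exact h.per _
  · rw [← distT_shift x y φ]; exact h.inj _ _ hxy
  · exact h.C1.comp (contDiff_id.add contDiff_const)
  · rw [hd]; exact h.spd _
  · rw [hd, hd]; have := h.hol (x + φ) (y + φ); simpa using this

/-- uniform injectivity at fixed time -/
lemma unif_inj (h : Cv M γ c z) {δ : ℝ} (hδ : 0 < δ) :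
    ∃ κ > 0, ∀ x y, ‖z x - z y‖ < κ → distT x y < δ := by
  by_contra hcon
  push Not at hcon
  set S : Set (ℝ × ℝ) := (Icc 0 (2 * π) ×ˢ Icc 0 (2 * π)) ∩ {p | δ ≤ distT p.1 p.2} with hS
  have hSc : IsCompact S := (isCompact_Icc.prod isCompact_Icc).inter_right
    (isClosed_le continuous_const continuous_distT)
  have red : ∀ x y, δ ≤ distT x y → ∃ p ∈ S, ‖z p.1 - z p.2‖ = ‖z x - z y‖ := by
    intro x y hxy
    obtain ⟨k, hk⟩ := exists_rep x
    obtain ⟨l, hl⟩ := exists_rep y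
    refine ⟨(x + 2 * π * k, y + 2 * π * l), ⟨⟨Ico_subset_Icc_self hk, Ico_subset_Icc_self hl⟩, ?_⟩, ?_⟩
    · simpa [distT_per, distT_per'] using hxy
    · simp [h.perk]
  obtain ⟨x, y, h1, h2⟩ := hcon 1 one_pos
  obtain ⟨p, hp, -⟩ := red x y h2
  obtain ⟨q, hq, hmin⟩ := hSc.exists_isMinOn ⟨p, hp⟩
    (f := fun p : ℝ × ℝ => ‖z p.1 - z p.2‖) (by have := h.cont; fun_prop)
  have hqpos : 0 < ‖z q.1 - z q.2‖ := by
    rw [norm_pos_iff, sub_ne_zero]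
    intro he
    have := h.inj _ _ he
    have h3 : δ ≤ distT q.1 q.2 := hq.2
    linarith
  obtain ⟨x, y, h1, h2⟩ := hcon _ hqpos
  obtain ⟨p, hp, hpe⟩ := red x y h2
  have : ‖z q.1 - z q.2‖ ≤ ‖z p.1 - z p.2‖ := hmin hp
  linarith

end Cv

lemma zero_cont {S : Set ℝ} {G : ℝ → ℝ → ℝ} (hG : Continuous (fun p : ℝ × ℝ => G p.1 p.2))
    {δ : ℝ} (hδ : 0 < δ) (hmono : ∀ θ ∈ S, StrictMonoOn (G θ) (Icc (-δ) δ))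
    (hneg : ∀ θ ∈ S, G θ (-δ) < 0) (hpos : ∀ θ ∈ S, 0 < G θ δ) :
    ∃ s : ℝ → ℝ, ContinuousOn s S ∧ ∀ θ ∈ S, s θ ∈ Ioo (-δ) δ ∧ G θ (s θ) = 0 ∧
      ∀ x ∈ Icc (-δ) δ, G θ x = 0 → x = s θ := by
  have hGθ : ∀ θ, Continuous (G θ) := fun θ => by
    have := hG.comp (Continuous.prodMk_right θ); exact this
  have hGx : ∀ x, Continuous (fun θ => G θ x) := fun x => by
    have := hG.comp (Continuous.prodMk_left x); exact this
  have hex : ∀ θ, ∃ x, θ ∈ S → x ∈ Ioo (-δ) δ ∧ G θ x = 0 := by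
    intro θ
    by_cases hθ : θ ∈ S
    · obtain ⟨x, hx, hx0⟩ := intermediate_value_Ioo (by linarith : -δ ≤ δ) (hGθ θ).continuousOn
        (show (0:ℝ) ∈ Ioo (G θ (-δ)) (G θ δ) from ⟨hneg θ hθ, hpos θ hθ⟩)
      exact ⟨x, fun _ => ⟨hx, hx0⟩⟩
    · exact ⟨0, fun h => absurd h hθ⟩
  choose s hs using hex
  refine ⟨s, ?_, fun θ hθ => ⟨(hs θ hθ).1, (hs θ hθ).2, fun x hx hx0 => ?_⟩⟩
  · intro θ hθ
    obtain ⟨h1, h2⟩ := hs θ hθ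
    rw [ContinuousWithinAt, tendsto_order]
    constructor
    · intro a ha
      set a' := max a (-δ) with ha'
      have ha'1 : a' < s θ := max_lt ha h1.1
      have h3 : G θ a' < 0 := by
        rw [← h2]
        exact hmono θ hθ ⟨le_max_right _ _, ha'1.le.trans h1.2.le⟩ (Ioo_subset_Icc_self h1) ha'1
      have h4 : ∀ᶠ θ' in 𝓝 θ, G θ' a' < 0 := (hGx a').continuousAt.eventually_lt_const h3
      filter_upwards [nhdsWithin_le_nhds h4, self_mem_nhdsWithin] with θ' h5 h6
      by_contra hle
      obtain ⟨h7, h8⟩ := hs θ' h6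
      have h9 : s θ' ≤ a' := (not_lt.1 hle).trans (le_max_left _ _)
      have := (hmono θ' h6).monotoneOn (Ioo_subset_Icc_self h7)
        ⟨le_max_right _ _, ha'1.le.trans h1.2.le⟩ h9
      linarith
    · intro a ha
      set a' := min a δ with ha'
      have ha'1 : s θ < a' := lt_min ha h1.2
      have h3 : 0 < G θ a' := by
        rw [← h2]
        exact hmono θ hθ (Ioo_subset_Icc_self h1) ⟨h1.1.le.trans ha'1.le, min_le_right _ _⟩ ha'1
      have h4 : ∀ᶠ θ' in 𝓝 θ, 0 < G θ' a' := (hGx a').continuousAt.eventually_const_lt h3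
      filter_upwards [nhdsWithin_le_nhds h4, self_mem_nhdsWithin] with θ' h5 h6
      by_contra hle
      obtain ⟨h7, h8⟩ := hs θ' h6
      have h9 : a' ≤ s θ' := (min_le_left _ _).trans (not_lt.1 hle)
      have := (hmono θ' h6).monotoneOn ⟨h1.1.le.trans ha'1.le, min_le_right _ _⟩
        (Ioo_subset_Icc_self h7) h9
      linarith
  · exact (hmono θ hθ).injOn hx (Ioo_subset_Icc_self (hs θ hθ).1) (hx0.trans (hs θ hθ).2.symm)

lemma eq_zero_of_inner {v T n : R2} (hT : T ≠ 0) (hn : ‖n‖ = 1) (hTn : inner ℝ T n = 0)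
    (h1 : inner ℝ v T = 0) (h2 : inner ℝ v n = 0) : v = 0 := by
  have hT' : ‖T‖ ^ 2 ≠ 0 := by positivity
  have e := norm_sq_decomp T n
  rw [hTn, hn] at e
  have hw : wd T n ≠ 0 := by
    intro h0; rw [h0] at e; apply hT'; linarith
  rw [inner2] at h1 h2
  have e0 : v 0 * wd T n = 0 := by simp only [wd]; linear_combination n 1 * h1 - T 1 * h2
  have e1 : v 1 * wd T n = 0 := by simp only [wd]; linear_combination T 0 * h2 - n 0 * h1
  have e0 := (mul_eq_zero.1 e0).resolve_right hw
  have e1 := (mul_eq_zero.1 e1).resolve_right hw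
  ext i; fin_cases i
  · simpa using e0
  · simpa using e1

lemma inner_abs_le (v w : R2) : |inner ℝ v w| ≤ ‖v‖ * ‖w‖ := abs_real_inner_le_norm v w

set_option maxHeartbeats 1600000 in
lemma crossing_aux {M γ c0 ρ0 x0 Y cp cq : ℝ} {p q : ℝ → R2} (hγ : 0 < γ) (hc0 : 0 < c0)
    (hx0 : 0 < x0) (hMx0 : M * x0 ^ γ ≤ c0 / 2)
    (hp : Cv M γ cp p) (hq : Cv M γ cq q) (hcp : c0 ≤ cp) {ξ s φ : ℝ} {n : R2}
    (hn : ‖n‖ = 1) (hpn : inner ℝ (deriv p ξ) n = 0) (hφ : φ = inner ℝ (deriv q s) n)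
    (hY : 0 < Y) (hφ0 : 0 < φ) (hρ : ‖p ξ - q s‖ = φ * Y / 4)
    (hY1 : Y < c0 * x0 / (4 * M)) (hY2 : Y ≤ c0 * ρ0 / (16 * M)) (hY3 : Y < ρ0 / 2)
    (hYK : (M + M * (4 * M / c0) ^ γ * (4 * M / c0)) * Y ^ γ ≤ φ / 2) :
    ∃ x y, |x - ξ| < ρ0 / 2 ∧ |y - s| < ρ0 / 2 ∧ p x = q y := by
  have hM := hp.Mpos
  have hcp0 := hp.cpos
  set T := deriv p ξ with hT
  have hTn : ‖T‖ = cp := hp.spd ξ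
  have hφM : φ ≤ M := by
    rw [hφ]; refine (le_abs_self _).trans ((inner_abs_le _ _).trans ?_)
    rw [hn, mul_one, hq.spd]; exact hq.cM
  have hρM : ‖p ξ - q s‖ ≤ M * Y / 4 := by rw [hρ]; gcongr
  have hMY : 4 * (M * Y) < c0 * x0 := by
    rw [lt_div_iff₀ (by positivity)] at hY1; linarith
  -- tangential growth
  have htan : ∀ x, |x| ≤ x0 → |inner ℝ (p (ξ + x) - p ξ) T - x * cp ^ 2| ≤ c0 / 2 * |x| * cp := by
    intro x hx
    have h1 := hp.taylor hγ.le ξ (ξ + x)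
    simp only [add_sub_cancel_left] at h1
    have h2 : inner ℝ (p (ξ + x) - p ξ) T - x * cp ^ 2 = inner ℝ (p (ξ + x) - p ξ - x • T) T := by
      rw [inner_sub_left _ (x • T), real_inner_smul_left, real_inner_self_eq_norm_sq, hTn]
    rw [h2]
    refine (inner_abs_le _ _).trans ?_
    rw [hTn]
    refine mul_le_mul_of_nonneg_right (h1.trans ?_) hcp0.le
    refine mul_le_mul_of_nonneg_right (le_trans ?_ hMx0) (abs_nonneg _)
    gcongr
  have hnor : ∀ x, |inner ℝ (p (ξ + x) - p ξ) n| ≤ M * |x| ^ γ * |x| := by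
    intro x
    have h1 := hp.taylor hγ.le ξ (ξ + x)
    simp only [add_sub_cancel_left] at h1
    have h2 : inner ℝ (p (ξ + x) - p ξ) n = inner ℝ (p (ξ + x) - p ξ - x • T) n := by
      rw [inner_sub_left _ (x • T), real_inner_smul_left, hpn]; simp
    rw [h2]
    refine (inner_abs_le _ _).trans ?_
    rw [hn, mul_one]; exact h1
  have hqY : ∀ y, |y| ≤ Y → ‖p ξ - q (s + y)‖ ≤ 5 / 4 * (M * Y) := by
    intro y hy
    have h1 := hq.lipM s (s + y)
    have h2 : ‖p ξ - q (s + y)‖ ≤ ‖p ξ - q s‖ + ‖q s - q (s + y)‖ := by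
      have := norm_add_le (p ξ - q s) (q s - q (s + y)); simpa using this
    have h3 : |s - (s + y)| ≤ Y := by simpa using hy
    have h4 : M * |s - (s + y)| ≤ M * Y := by gcongr
    linarith
  -- implicit function
  obtain ⟨X, hXc, hX⟩ := zero_cont (S := Icc (-Y) Y)
    (G := fun y x => inner ℝ (p (ξ + x) - q (s + y)) T) (δ := x0)
    (by have := hp.cont; have := hq.cont; fun_prop) hx0
    (by
      intro y _
      apply strictMonoOn_of_deriv_pos (convex_Icc _ _)
      · have := hp.cont; fun_prop
      · intro x hx
        rw [interior_Icc] at hx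
        have hx' : |x| ≤ x0 := abs_le.2 ⟨hx.1.le, hx.2.le⟩
        have hd : HasDerivAt (fun x => inner ℝ (p (ξ + x) - q (s + y)) T)
            (inner ℝ (deriv p (ξ + x)) T) x := by
          have h1 : HasDerivAt (fun x => p (ξ + x) - q (s + y)) (deriv p (ξ + x)) x :=
            ((hp.hd (ξ + x)).comp_const_add ξ x).sub_const _
          have := h1.inner ℝ (hasDerivAt_const x T)
          simpa using this
        rw [hd.deriv]
        have h2 : inner ℝ (deriv p (ξ + x)) T = cp ^ 2 + inner ℝ (deriv p (ξ + x) - T) T := by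
          rw [inner_sub_left, real_inner_self_eq_norm_sq, hTn]; ring
        have h3 := inner_abs_le (deriv p (ξ + x) - T) T
        have h4 := hp.hol (ξ + x) ξ
        simp only [add_sub_cancel_left] at h4
        have h5 : M * |x| ^ γ ≤ M * x0 ^ γ := by gcongr
        rw [hTn] at h3
        have h6 : ‖deriv p (ξ + x) - T‖ * cp ≤ c0 / 2 * cp :=
          mul_le_mul_of_nonneg_right (by linarith) hcp0.le
        have := (abs_le.1 h3).1
        rw [h2]
        linarith [mul_le_mul_of_nonneg_right hcp hcp0.le, mul_pos hc0 hcp0, pow_two cp])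
    (by
      intro y hy
      have h1 := hqY y (abs_le.2 hy)
      have h2 := htan (-x0) (by rw [abs_neg, abs_of_pos hx0])
      rw [abs_neg, abs_of_pos hx0] at h2
      have h3 : inner ℝ (p (ξ + -x0) - q (s + y)) T
        = inner ℝ (p (ξ + -x0) - p ξ) T + inner ℝ (p ξ - q (s + y)) T := by
        rw [← inner_add_left]; simp
      have h4 := inner_abs_le (p ξ - q (s + y)) T
      rw [hTn] at h4
      have h5 := (abs_le.1 h2).2
      have h6 := (abs_le.1 h4).2
      have h7 : ‖p ξ - q (s + y)‖ * cp ≤ 5 / 4 * (M * Y) * cp := by gcongr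
      show inner ℝ (p (ξ + -x0) - q (s + y)) T < 0
      rw [h3]
      have h8 : 5 / 4 * (M * Y) * cp < c0 * x0 / 2 * cp := by
        apply mul_lt_mul_of_pos_right _ hcp0; linarith [mul_pos hM hY]
      have h9 : c0 * x0 * cp ≤ x0 * cp ^ 2 := by linarith [mul_le_mul_of_nonneg_left hcp (mul_pos hx0 hcp0).le]
      linarith)
    (by
      intro y hy
      have h1 := hqY y (abs_le.2 hy)
      have h2 := htan x0 (by rw [abs_of_pos hx0])
      rw [abs_of_pos hx0] at h2
      have h3 : inner ℝ (p (ξ + x0) - q (s + y)) T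
        = inner ℝ (p (ξ + x0) - p ξ) T + inner ℝ (p ξ - q (s + y)) T := by
        rw [← inner_add_left]; simp
      have h4 := inner_abs_le (p ξ - q (s + y)) T
      rw [hTn] at h4
      have h5 := (abs_le.1 h2).1
      have h6 := (abs_le.1 h4).1
      have h7 : ‖p ξ - q (s + y)‖ * cp ≤ 5 / 4 * (M * Y) * cp := by gcongr
      show 0 < inner ℝ (p (ξ + x0) - q (s + y)) T
      rw [h3]
      have h8 : 5 / 4 * (M * Y) * cp < c0 * x0 / 2 * cp := by
        apply mul_lt_mul_of_pos_right _ hcp0; linarith [mul_pos hM hY]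
      have h9 : c0 * x0 * cp ≤ x0 * cp ^ 2 := by linarith [mul_le_mul_of_nonneg_left hcp (mul_pos hx0 hcp0).le]
      linarith)
  -- size of X
  have hXsz : ∀ y ∈ Icc (-Y) Y, |X y| ≤ 4 * M / c0 * Y := by
    intro y hy
    obtain ⟨h1, h2, -⟩ := hX y hy
    have h3 := htan (X y) (abs_le.2 ⟨h1.1.le, h1.2.le⟩)
    have h4 : inner ℝ (p (ξ + X y) - p ξ) T = - inner ℝ (p ξ - q (s + y)) T := by
      have : inner ℝ (p (ξ + X y) - q (s + y)) T
        = inner ℝ (p (ξ + X y) - p ξ) T + inner ℝ (p ξ - q (s + y)) T := by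
        rw [← inner_add_left]; simp
      rw [h2] at this; linarith
    have h5 := inner_abs_le (p ξ - q (s + y)) T
    rw [hTn] at h5
    have h6 : ‖p ξ - q (s + y)‖ * cp ≤ 5 / 4 * (M * Y) * cp := by
      have := hqY y (abs_le.2 hy); gcongr
    rw [h4] at h3
    have h7 : |X y * cp ^ 2| ≤ c0 / 2 * |X y| * cp + 5 / 4 * (M * Y) * cp := by
      have : X y * cp ^ 2 = -(- inner ℝ (p ξ - q (s + y)) T - X y * cp ^ 2) + - inner ℝ (p ξ - q (s + y)) T := by ring
      rw [this]
      refine (abs_add_le _ _).trans ?_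
      rw [abs_neg, abs_neg]; linarith
    rw [abs_mul, abs_of_pos (by positivity : 0 < cp ^ 2)] at h7
    have h8 : |X y| * cp ≤ c0 / 2 * |X y| + 5 / 4 * (M * Y) := by
      have : (|X y| * cp) * cp ≤ (c0 / 2 * |X y| + 5 / 4 * (M * Y)) * cp := by linarith [h7, pow_two cp, (by ring : (|X y| * cp) * cp = |X y| * cp ^ 2)]
      exact le_of_mul_le_mul_right this hcp0
    have h9 : |X y| * c0 ≤ |X y| * cp := by gcongr
    rw [div_mul_eq_mul_div, le_div_iff₀ hc0]
    linarith [mul_pos hM hY]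
  set F : ℝ → ℝ := fun y => inner ℝ (q (s + y) - p (ξ + X y)) n with hF
  have hFc : ContinuousOn F (Icc (-Y) Y) := by
    have h1 : ContinuousOn (fun y => p (ξ + X y)) (Icc (-Y) Y) :=
      hp.cont.comp_continuousOn (continuousOn_const.add hXc)
    have h2 : ContinuousOn (fun y => q (s + y)) (Icc (-Y) Y) :=
      (hq.cont.comp (continuous_const.add continuous_id)).continuousOn
    exact (h2.sub h1).inner continuousOn_const
  have hFest : ∀ y ∈ Icc (-Y) Y, |F y - y * φ| ≤ 3 / 4 * (φ * Y) := by
    intro y hy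
    have hy' : |y| ≤ Y := abs_le.2 hy
    have e : F y - y * φ = inner ℝ (q (s + y) - q s - y • deriv q s) n
        - inner ℝ (p ξ - q s) n - inner ℝ (p (ξ + X y) - p ξ) n := by
      simp only [hF, hφ, inner_sub_left, real_inner_smul_left]; ring
    have h1 := hq.taylor hγ.le s (s + y)
    simp only [add_sub_cancel_left] at h1
    have h2 := inner_abs_le (q (s + y) - q s - y • deriv q s) n
    have h3 := inner_abs_le (p ξ - q s) n
    have h4 := hnor (X y)
    rw [hn, mul_one] at h2 h3
    have h5 : M * |y| ^ γ * |y| ≤ M * Y ^ γ * Y := by gcongr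
    have h6 : M * |X y| ^ γ * |X y| ≤ M * (4 * M / c0 * Y) ^ γ * (4 * M / c0 * Y) := by
      have := hXsz y hy; gcongr
    rw [Real.mul_rpow (by positivity) hY.le] at h6
    rw [e]
    have h7 := abs_sub (inner ℝ (q (s + y) - q s - y • deriv q s) n
        - inner ℝ (p ξ - q s) n) (inner ℝ (p (ξ + X y) - p ξ) n)
    have h8 := abs_sub (inner ℝ (q (s + y) - q s - y • deriv q s) n) (inner ℝ (p ξ - q s) n)
    rw [hρ] at h3
    have h9 : (M + M * (4 * M / c0) ^ γ * (4 * M / c0)) * Y ^ γ * Y ≤ φ / 2 * Y := by gcongr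
    linarith
  have hYm : Y ∈ Icc (-Y) Y := ⟨by linarith, le_rfl⟩
  have hYm' : -Y ∈ Icc (-Y) Y := ⟨le_rfl, by linarith⟩
  have hφY := mul_pos hφ0 hY
  have hFpos : 0 < F Y := by have := (abs_le.1 (hFest Y hYm)).1; linarith
  have hFneg : F (-Y) < 0 := by have := (abs_le.1 (hFest (-Y) hYm')).2; linarith
  obtain ⟨y, hy, hy0⟩ := intermediate_value_Icc (by linarith : -Y ≤ Y) hFc ⟨hFneg.le, hFpos.le⟩
  refine ⟨ξ + X y, s + y, ?_, ?_, ?_⟩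
  · rw [add_sub_cancel_left]
    refine (hXsz y hy).trans_lt ?_
    have : 4 * M / c0 * Y ≤ 4 * M / c0 * (c0 * ρ0 / (16 * M)) := by gcongr
    have e : 4 * M / c0 * (c0 * ρ0 / (16 * M)) = ρ0 / 4 := by field_simp; ring
    rw [e] at this
    linarith
  · rw [add_sub_cancel_left]; exact (abs_le.2 hy).trans_lt hY3
  · have hTne : T ≠ 0 := by rw [← norm_pos_iff, hTn]; exact hcp0
    have := eq_zero_of_inner hTne hn hpn (hX y hy).2.1
      (by have : inner ℝ (q (s + y) - p (ξ + X y)) n = 0 := hy0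
          rw [← neg_sub, inner_neg_left, this, neg_zero])
    exact sub_eq_zero.1 this

lemma crossing {M γ c0 ρ0 : ℝ} (hγ : 0 < γ) (hM : 0 < M) (hc0 : 0 < c0) (hρ0 : 0 < ρ0) :
    ∃ C, 0 < C ∧ ∀ (cp cq : ℝ) (p q : ℝ → R2), Cv M γ cp p → Cv M γ cq q → c0 ≤ cp →
      ∀ (ξ s : ℝ) (n : R2), ‖n‖ = 1 → inner ℝ (deriv p ξ) n = 0 →
      (∀ x y, |x - ξ| < ρ0 / 2 → |y - s| < ρ0 / 2 → p x ≠ q y) →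
      |inner ℝ (deriv q s) n| ≤ C * ‖p ξ - q s‖ ^ (γ / (1 + γ)) := by
  set x0 : ℝ := (c0 / (2 * M)) ^ (1 / γ) with hx0d
  have hx0 : 0 < x0 := by positivity
  have hMx0 : M * x0 ^ γ ≤ c0 / 2 := by
    rw [hx0d, ← Real.rpow_mul (by positivity), one_div_mul_cancel hγ.ne', Real.rpow_one]
    apply le_of_eq; field_simp
  set K : ℝ := M + M * (4 * M / c0) ^ γ * (4 * M / c0) with hK
  have hK0 : 0 < K := by positivity
  set Y0 : ℝ := min (min (c0 * x0 / (4 * M)) (c0 * ρ0 / (16 * M))) (ρ0 / 2) with hY0d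
  have hY0 : 0 < Y0 := by positivity
  set L : ℝ := max (2 * K) (M / Y0 ^ γ) with hL
  have hL0 : 0 < L := lt_max_of_lt_left (by positivity)
  refine ⟨((4:ℝ) ^ γ * L) ^ (1 / (1 + γ)), by positivity, ?_⟩
  set C : ℝ := ((4:ℝ) ^ γ * L) ^ (1 / (1 + γ)) with hC
  have hC0 : 0 < C := by positivity
  have hCp : C ^ (1 + γ) = (4:ℝ) ^ γ * L := by
    rw [hC, ← Real.rpow_mul (by positivity), one_div_mul_cancel (by positivity), Real.rpow_one]
  intro cp cq p q hp hq hcp ξ s n hn hpn hne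
  -- reduce to positive inner product
  have main : ∀ n : R2, ‖n‖ = 1 → inner ℝ (deriv p ξ) n = 0 →
      inner ℝ (deriv q s) n ≤ C * ‖p ξ - q s‖ ^ (γ / (1 + γ)) := by
    intro n hn hpn
    by_contra hcon
    push Not at hcon
    set φ := inner ℝ (deriv q s) n with hφ
    set ρ := ‖p ξ - q s‖ with hρ
    have hρpos : 0 < ρ := by
      rw [hρ, norm_pos_iff, sub_ne_zero]
      exact hne ξ s (by simpa using half_pos hρ0) (by simpa using half_pos hρ0)
    have hφ0 : 0 < φ := lt_of_le_of_lt (by positivity) hcon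
    have hφM : φ ≤ M := by
      rw [hφ]; refine (le_abs_self _).trans ((inner_abs_le _ _).trans ?_)
      rw [hn, mul_one, hq.spd]; exact hq.cM
    have h1 : (4:ℝ) ^ γ * L * ρ ^ γ < φ ^ γ * φ := by
      have := Real.rpow_lt_rpow (by positivity) hcon (by positivity : 0 < 1 + γ)
      rw [Real.mul_rpow hC0.le (by positivity), hCp, ← Real.rpow_mul hρpos.le,
        div_mul_cancel₀ _ (by positivity : (1 + γ) ≠ 0), add_comm 1 γ, Real.rpow_add_one hφ0.ne'] at this
      exact this
    set Y := 4 * ρ / φ with hYd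
    have hY : 0 < Y := by positivity
    have h2 : Y ^ γ * L < φ := by
      rw [hYd, Real.div_rpow (by positivity) hφ0.le, Real.mul_rpow (by norm_num) hρpos.le,
        div_mul_eq_mul_div, div_lt_iff₀ (by positivity)]
      linarith
    have h3 : Y < Y0 := by
      by_contra hge
      push Not at hge
      have : M / Y0 ^ γ ≤ L := le_max_right _ _
      have h4 : Y0 ^ γ ≤ Y ^ γ := by gcongr
      have h5 : M ≤ Y ^ γ * L := by
        calc M = Y0 ^ γ * (M / Y0 ^ γ) := by field_simp
          _ ≤ _ := by gcongr
      linarith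
    have h4 : K * Y ^ γ ≤ φ / 2 := by
      have : 2 * K ≤ L := le_max_left _ _
      have : Y ^ γ * (2 * K) ≤ Y ^ γ * L := by gcongr
      linarith
    obtain ⟨x, y, h5, h6, h7⟩ := crossing_aux (ρ0 := ρ0) hγ hc0 hx0 hMx0 hp hq hcp hn hpn hφ hY hφ0
      (by rw [← hρ, hYd]; field_simp)
      (h3.trans_le ((min_le_left _ _).trans (min_le_left _ _)))
      (h3.le.trans ((min_le_left _ _).trans (min_le_right _ _)))
      (h3.trans_le (min_le_right _ _)) h4
    exact hne x y h5 h6 h7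
  rw [abs_le]
  constructor
  · have := main (-n) (by rwa [norm_neg]) (by rw [inner_neg_right, hpn, neg_zero])
    rw [inner_neg_right] at this; linarith
  · exact main n hn hpn

lemma conv_bd {E : Type*} [NormedAddCommGroup E] {H : R2 → E}
    (hH : Continuous H) {O : Set R2} (hO : Bornology.IsBounded O) (x0 : R2) :
    ∃ B : ℝ, ∀ y ∈ O, ∀ x ∈ Metric.ball x0 1, ‖H (x - y)‖ ≤ B := by
  obtain ⟨R, hR⟩ := hO.exists_norm_le
  obtain ⟨B, hB⟩ := (isCompact_closedBall (0 : R2) (‖x0‖ + 1 + R)).exists_bound_of_continuousOn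
    hH.continuousOn
  refine ⟨B, fun y hy x hx => hB _ ?_⟩
  rw [mem_closedBall_zero_iff]
  have h1 := norm_sub_le x y
  have h2 := hR y hy
  rw [Metric.mem_ball, dist_eq_norm] at hx
  have h3 : ‖x‖ ≤ ‖x - x0‖ + ‖x0‖ := by simpa using norm_add_le (x - x0) x0
  linarith

lemma conv_intble {E : Type*} [NormedAddCommGroup E] {H : R2 → E}
    (hH : Continuous H) {O : Set R2} (hOo : IsOpen O) (hO : Bornology.IsBounded O) (x0 : R2) :
    IntegrableOn (fun y => H (x0 - y)) O := by
  obtain ⟨B, hB⟩ := conv_bd hH hO x0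
  have : IsFiniteMeasure (volume.restrict O) := ⟨by simpa using hO.measure_lt_top⟩
  refine Integrable.of_bound (C := B) ?_ ?_
  · exact (hH.comp (continuous_const.sub continuous_id)).aestronglyMeasurable
  · filter_upwards [ae_restrict_mem hOo.measurableSet] with y hy
    exact hB y hy x0 (Metric.mem_ball_self one_pos)

lemma conv_cont {E : Type*} [NormedAddCommGroup E] [NormedSpace ℝ E] {H : R2 → E}
    (hH : Continuous H) {O : Set R2} (hOo : IsOpen O) (hO : Bornology.IsBounded O) :
    Continuous (fun x => ∫ y in O, H (x - y)) := by
  rw [continuous_iff_continuousAt]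
  intro x0
  obtain ⟨B, hB⟩ := conv_bd hH hO x0
  have : IsFiniteMeasure (volume.restrict O) := ⟨by simpa using hO.measure_lt_top⟩
  refine continuousAt_of_dominated (bound := fun _ => B) ?_ ?_ (integrable_const B) ?_
  · exact .of_forall fun x => (hH.comp (continuous_const.sub continuous_id)).aestronglyMeasurable
  · filter_upwards [Metric.ball_mem_nhds x0 one_pos] with x hx
    filter_upwards [ae_restrict_mem hOo.measurableSet] with y hy
    exact hB y hy x hx
  · exact .of_forall fun y => (hH.comp (continuous_id.sub continuous_const)).continuousAt

lemma conv_deriv {E : Type*} [NormedAddCommGroup E] [NormedSpace ℝ E] [CompleteSpace E] {G : R2 → E}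
    (hG : ContDiff ℝ 1 G) {O : Set R2} (hOo : IsOpen O) (hO : Bornology.IsBounded O) (x0 : R2) :
    HasFDerivAt (fun x => ∫ y in O, G (x - y)) (∫ y in O, fderiv ℝ G (x0 - y)) x0 := by
  have hc : Continuous (fderiv ℝ G) := hG.continuous_fderiv (by norm_num)
  obtain ⟨B, hB⟩ := conv_bd hc hO x0
  have : IsFiniteMeasure (volume.restrict O) := ⟨by simpa using hO.measure_lt_top⟩
  refine hasFDerivAt_integral_of_dominated_of_fderiv_le (bound := fun _ => B)
    (F' := fun x y => fderiv ℝ G (x - y))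
    (Metric.ball_mem_nhds x0 one_pos) ?_ ?_ ?_ ?_ (integrable_const B) ?_
  · exact .of_forall fun x =>
      (hG.continuous.comp (continuous_const.sub continuous_id)).aestronglyMeasurable
  · exact conv_intble hG.continuous hOo hO x0
  · exact (hc.comp (continuous_const.sub continuous_id)).aestronglyMeasurable
  · filter_upwards [ae_restrict_mem hOo.measurableSet] with y hy
    exact fun x hx => hB y hy x hx
  · refine .of_forall fun y x _ => ?_
    have h1 : HasFDerivAt G (fderiv ℝ G (x - y)) (x - y) :=
      (hG.differentiable (by norm_num) (x - y)).hasFDerivAt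
    have h2 := h1.comp x ((hasFDerivAt_id x).sub_const y)
    exact h2

lemma conv_contDiff {E : Type*} [NormedAddCommGroup E] [NormedSpace ℝ E] [CompleteSpace E] {G : R2 → E}
    (hG : ContDiff ℝ 1 G) {O : Set R2} (hOo : IsOpen O) (hO : Bornology.IsBounded O) :
    ContDiff ℝ 1 (fun x => ∫ y in O, G (x - y)) := by
  rw [contDiff_one_iff_fderiv]
  refine ⟨fun x => (conv_deriv hG hOo hO x).differentiableAt, ?_⟩
  have : fderiv ℝ (fun x => ∫ y in O, G (x - y)) = fun x => ∫ y in O, fderiv ℝ G (x - y) := by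
    ext1 x; exact (conv_deriv hG hOo hO x).fderiv
  rw [this]
  exact conv_cont (hG.continuous_fderiv (by norm_num)) hOo hO

/-- regularized potential -/
def gd (α δ : ℝ) (w : R2) : ℝ := -(1 / (2 * α)) * (‖w‖ ^ 2 + δ ^ 2) ^ (-α)

/-- regularized kernel -/
def kernd (α δ : ℝ) (w : R2) : R2 := (‖w‖ ^ 2 + δ ^ 2) ^ (-1 - α) • perp w

lemma contDiff_base (δ : ℝ) (hδ : 0 < δ) (p : ℝ) :
    ContDiff ℝ 1 (fun w : R2 => (‖w‖ ^ 2 + δ ^ 2) ^ p) := by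
  refine ContDiff.rpow_const_of_ne ?_ ?_
  · exact (contDiff_norm_sq ℝ).add contDiff_const
  · intro x; positivity

lemma gd_contDiff {α δ : ℝ} (hδ : 0 < δ) : ContDiff ℝ 1 (gd α δ) :=
  contDiff_const.mul (contDiff_base δ hδ _)

lemma kernd_contDiff {α δ : ℝ} (hδ : 0 < δ) : ContDiff ℝ 1 (kernd α δ) :=
  (contDiff_base δ hδ _).smul perpL.contDiff

lemma perp_perp (v : R2) : perp (perp v) = -v := by
  ext i; fin_cases i
  · simp [perp_0, perp_1]
  · simp [perp_0, perp_1]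

lemma gd_deriv {α δ : ℝ} (hα : 0 < α) (hδ : 0 < δ) (w v : R2) :
    fderiv ℝ (gd α δ) w v = wd v (kernd α δ w) := by
  have h1 : HasFDerivAt (fun w : R2 => ‖w‖ ^ 2 + δ ^ 2) (2 • (innerSL ℝ w)) w :=
    (hasStrictFDerivAt_norm_sq w).hasFDerivAt.add_const _
  have h2 := (h1.rpow_const (p := -α) (Or.inl (by positivity))).const_mul (-(1 / (2 * α)))
  have h3 : HasFDerivAt (gd α δ) _ w := h2
  rw [h3.fderiv]
  have h4 : wd v (kernd α δ w) = (‖w‖ ^ 2 + δ ^ 2) ^ (-1 - α) * inner ℝ w v := by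
    rw [kernd, wd_smul_right, inner2]; simp only [wd, perp_0, perp_1]; ring
  rw [h4]
  simp only [smul_apply, smul_eq_mul, nsmul_eq_mul, innerSL_apply_apply,
    show -α - 1 = -1 - α by ring]
  simp
  field_simp

lemma kernd_zero {α : ℝ} (w : R2) : kernd α 0 w = kern α w := by
  rw [kernd, kern]
  congr 1
  rw [← Real.rpow_neg (norm_nonneg _), ← Real.rpow_natCast, show (0:ℝ) ^ 2 = 0 by norm_num, add_zero,
    ← Real.rpow_mul (norm_nonneg _)]
  congr 1; push_cast; ring

lemma norm_kern {α : ℝ} (w : R2) (hw : w ≠ 0) : ‖kern α w‖ = ‖w‖ ^ (-(1 + 2 * α)) := by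
  have h0 : 0 < ‖w‖ := norm_pos_iff.2 hw
  rw [kern, norm_smul, norm_perp, norm_inv, Real.norm_of_nonneg (by positivity),
    ← Real.rpow_neg h0.le]
  nth_rewrite 2 [← Real.rpow_one ‖w‖]
  rw [← Real.rpow_add h0]; congr 1; ring

lemma norm_kernd_le {α : ℝ} (hα : 0 < α) (δ : ℝ) (w : R2) : ‖kernd α δ w‖ ≤ ‖kern α w‖ := by
  rcases eq_or_ne w 0 with rfl | hw
  · have : perp (0 : R2) = 0 := perpL.map_zero
    simp [kernd, kern, this]
  rw [← kernd_zero]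
  have h0 : 0 < ‖w‖ := norm_pos_iff.2 hw
  rw [kernd, kernd, norm_smul, norm_smul, Real.norm_of_nonneg (by positivity),
    Real.norm_of_nonneg (by positivity)]
  refine mul_le_mul_of_nonneg_right ?_ (norm_nonneg _)
  apply Real.rpow_le_rpow_of_nonpos (by positivity) _ (by linarith)
  simp; positivity

lemma meas_kernd (α δ : ℝ) : Measurable (kernd α δ) := by
  have h1 : Measurable (fun w : R2 => (‖w‖ ^ 2 + δ ^ 2) ^ (-1 - α)) := by fun_prop
  exact h1.smul perpL.continuous.measurable

lemma kern_int {α : ℝ} (hα0 : 0 < α) (hα : α ≤ 1 / 4) (R : ℝ) :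
    IntegrableOn (kern α) (Metric.ball (0 : R2) R) := by
  refine integrableOn_ball_of_norm_le_rpow (C := 1) (α := 1 + 2 * α) (by simp) ?_ ?_ ?_
  · simp; linarith
  · refine .of_forall fun w => ?_
    rcases eq_or_ne w 0 with rfl | hw
    · have : perp (0 : R2) = 0 := perpL.map_zero
      simp [kern, this]; positivity
    · rw [norm_kern w hw, one_mul]
  · have := (meas_kernd α 0).aestronglyMeasurable (μ := volume)
    simpa only [funext (kernd_zero (α := α))] using this

lemma kernd_int {α : ℝ} (hα0 : 0 < α) (hα : α ≤ 1 / 4) (δ R : ℝ) :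
    IntegrableOn (kernd α δ) (Metric.ball (0 : R2) R) :=
  (kern_int hα0 hα R).norm.mono' (meas_kernd α δ).aestronglyMeasurable
    (.of_forall fun w => norm_kernd_le hα0 δ w)

lemma kernd_conv {α : ℝ} (hα0 : 0 < α) (hα : α ≤ 1 / 4) (R : ℝ) :
    Tendsto (fun δ => ∫ w in Metric.ball (0 : R2) R, ‖kernd α δ w - kern α w‖) (𝓝[>] 0) (𝓝 0) := by
  have h0 : (0:ℝ) = ∫ w in Metric.ball (0 : R2) R, (0:ℝ) := by simp
  rw [h0]
  nth_rewrite 2 [← h0]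
  refine tendsto_integral_filter_of_dominated_convergence (fun w => 2 * ‖kern α w‖) ?_ ?_ ?_ ?_
  · refine .of_forall fun δ => ?_
    have h1 := (meas_kernd α δ).aestronglyMeasurable (μ := volume.restrict (Metric.ball (0 : R2) R))
    have h2 := (meas_kernd α 0).aestronglyMeasurable (μ := volume.restrict (Metric.ball (0 : R2) R))
    rw [funext (kernd_zero (α := α))] at h2
    exact (h1.sub h2).norm
  · refine .of_forall fun δ => .of_forall fun w => ?_
    rw [norm_norm]
    have := norm_kernd_le hα0 δ w
    have := norm_sub_le (kernd α δ w) (kern α w)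
    linarith
  · exact (kern_int hα0 hα R).norm.const_mul 2
  · refine .of_forall fun w => ?_
    have : Tendsto (fun δ => kernd α δ w) (𝓝[>] 0) (𝓝 (kernd α 0 w)) := by
      refine tendsto_nhdsWithin_of_tendsto_nhds ?_
      rcases eq_or_ne w 0 with rfl | hw
      · have : perp (0 : R2) = 0 := perpL.map_zero
        simp [kernd, this]
      have h0 : 0 < ‖w‖ := norm_pos_iff.2 hw
      refine Tendsto.smul_const ?_ _
      have hc : ContinuousAt (fun δ : ℝ => (‖w‖ ^ 2 + δ ^ 2) ^ (-1 - α)) 0 := by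
        refine ContinuousAt.rpow_const (by fun_prop) (Or.inl ?_)
        positivity
      exact hc
    rw [kernd_zero] at this
    have h2 := (this.sub_const (kern α w)).norm
    simpa using h2

lemma kernd_conv_unif {α : ℝ} (hα0 : 0 < α) (hα : α ≤ 1 / 4) {O : Set R2} (hOo : IsOpen O)
    (hO : Bornology.IsBounded O) (R : ℝ) {ε : ℝ} (hε : 0 < ε) :
    ∀ᶠ δ in 𝓝[>] (0:ℝ), ∀ x : R2, ‖x‖ ≤ R →
      ‖(∫ y in O, kernd α δ (x - y)) - ∫ y in O, kern α (x - y)‖ ≤ ε := by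
  obtain ⟨R1, hR1⟩ := hO.exists_norm_le
  have h1 := kernd_conv hα0 hα (R + R1 + 1)
  filter_upwards [h1.eventually_lt_const hε] with δ hδ x hx
  have hsub : ∀ y ∈ O, x - y ∈ Metric.ball (0 : R2) (R + R1 + 1) := by
    intro y hy
    rw [mem_ball_zero_iff]
    have := norm_sub_le x y
    have := hR1 y hy
    linarith
  have key : ∀ {F : Type} [NormedAddCommGroup F] (f : R2 → F),
      IntegrableOn f (Metric.ball (0 : R2) (R + R1 + 1)) → IntegrableOn (fun y => f (x - y)) O := by
    intro F _ f hf
    have h2 : IntegrableOn (fun y => f (x - y)) ((fun y => x - y) ⁻¹' Metric.ball (0 : R2) (R + R1 + 1)) := by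
      have := (Measure.measurePreserving_sub_left (volume : Measure R2) x)
      exact (this.integrableOn_comp_preimage (measurableEmbedding_subLeft x)).2 hf
    exact h2.mono_set hsub
  rw [← integral_sub (key _ (kernd_int hα0 hα δ _)) (key _ (kern_int hα0 hα _))]
  refine (norm_integral_le_integral_norm _).trans ?_
  have h3 : IntegrableOn (fun w => ‖kernd α δ w - kern α w‖) (Metric.ball (0 : R2) (R + R1 + 1)) :=
    ((kernd_int hα0 hα δ _).sub (kern_int hα0 hα _)).norm
  calc ∫ y in O, ‖kernd α δ (x - y) - kern α (x - y)‖
      ≤ ∫ y in (fun y => x - y) ⁻¹' Metric.ball (0 : R2) (R + R1 + 1), ‖kernd α δ (x - y) - kern α (x - y)‖ := by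
        refine setIntegral_mono_set ?_ (.of_forall fun _ => norm_nonneg _) (LE.le.eventuallyLE hsub)
        exact ((Measure.measurePreserving_sub_left (volume : Measure R2) x).integrableOn_comp_preimage
          (measurableEmbedding_subLeft x)).2 h3
    _ = ∫ w in Metric.ball (0 : R2) (R + R1 + 1), ‖kernd α δ w - kern α w‖ :=
        (Measure.measurePreserving_sub_left (volume : Measure R2) x).setIntegral_preimage_emb
          (measurableEmbedding_subLeft x) (fun w => ‖kernd α δ w - kern α w‖) _
    _ ≤ ε := hδ.le

lemma vel1_cont {α : ℝ} (hα0 : 0 < α) (hα : α ≤ 1 / 4) {O : Set R2} (hOo : IsOpen O)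
    (hO : Bornology.IsBounded O) : Continuous (fun x => ∫ y in O, kern α (x - y)) := by
  rw [continuous_iff_continuousAt]
  intro x0
  rw [Metric.continuousAt_iff']
  intro ε hε
  obtain ⟨δ, hδ, hδ0⟩ := ((kernd_conv_unif hα0 hα hOo hO (‖x0‖ + 1) (by linarith : 0 < ε / 4)).and
    self_mem_nhdsWithin).exists
  have hc := (conv_cont (kernd_contDiff (α := α) hδ0).continuous hOo hO).continuousAt (x := x0)
  rw [Metric.continuousAt_iff'] at hc
  filter_upwards [hc (ε / 4) (by linarith), Metric.ball_mem_nhds x0 one_pos] with x hx hx1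
  have h1 := hδ x0 (by linarith)
  have h2 := hδ x (by
    rw [Metric.mem_ball, dist_eq_norm] at hx1
    have : ‖x‖ ≤ ‖x - x0‖ + ‖x0‖ := by simpa using norm_add_le (x - x0) x0
    linarith)
  rw [← dist_eq_norm] at h1 h2
  rw [dist_comm] at h2
  have h3 := dist_triangle4 (∫ y in O, kern α (x - y)) (∫ y in O, kernd α δ (x - y))
    (∫ y in O, kernd α δ (x0 - y)) (∫ y in O, kern α (x0 - y))
  linarith

/-- regularized velocity and potential -/
def veld (α cα δ : ℝ) {N : ℕ} (θ : Fin N → ℝ) (Ω : Fin N → Set R2) (x : R2) : R2 :=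
  cα • ∑ n, θ n • ∫ y in Ω n, kernd α δ (x - y)

lemma vel_cont {α cα : ℝ} (hα0 : 0 < α) (hα : α ≤ 1 / 4) {N : ℕ} (θ : Fin N → ℝ) {Ω : Fin N → Set R2}
    (ho : ∀ n, IsOpen (Ω n)) (hb : ∀ n, Bornology.IsBounded (Ω n)) :
    Continuous (gSQGvel α cα θ Ω) := by
  unfold gSQGvel
  have h1 : Continuous (fun x => ∑ n, θ n • ∫ y in Ω n, kern α (x - y)) :=
    continuous_finsetSum _ fun n _ => (vel1_cont hα0 hα (ho n) (hb n)).const_smul (θ n)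
  exact h1.const_smul cα

lemma veld_contDiff {α cα δ : ℝ} (hδ : 0 < δ) {N : ℕ} (θ : Fin N → ℝ) {Ω : Fin N → Set R2}
    (ho : ∀ n, IsOpen (Ω n)) (hb : ∀ n, Bornology.IsBounded (Ω n)) :
    ContDiff ℝ 1 (veld α cα δ θ Ω) := by
  unfold veld
  refine (ContDiff.sum fun n _ => ?_).const_smul _
  exact (conv_contDiff (kernd_contDiff hδ) (ho n) (hb n)).const_smul _

lemma veld_pot {α cα δ : ℝ} (hα0 : 0 < α) (hδ : 0 < δ) {N : ℕ} (θ : Fin N → ℝ) {Ω : Fin N → Set R2}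
    (ho : ∀ n, IsOpen (Ω n)) (hb : ∀ n, Bornology.IsBounded (Ω n)) :
    ∃ ψ : R2 → ℝ, ContDiff ℝ 1 ψ ∧ ∀ x v, fderiv ℝ ψ x v = wd v (veld α cα δ θ Ω x) := by
  have hcd := fun n => conv_contDiff (gd_contDiff (α := α) hδ) (ho n) (hb n)
  refine ⟨fun x => cα • ∑ n, θ n • ∫ y in Ω n, gd α δ (x - y), ?_, ?_⟩
  · exact (ContDiff.sum fun n _ => (hcd n).const_smul _).const_smul _
  · intro x v
    have h1 : HasFDerivAt (fun x => cα • ∑ n, θ n • ∫ y in Ω n, gd α δ (x - y))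
        (cα • ∑ n, θ n • ∫ y in Ω n, fderiv ℝ (gd α δ) (x - y)) x := by
      have h0 : HasFDerivAt (fun x => ∑ n, θ n • ∫ y in Ω n, gd α δ (x - y))
        (∑ n, θ n • ∫ y in Ω n, fderiv ℝ (gd α δ) (x - y)) x :=
        HasFDerivAt.fun_sum fun n _ =>
          (conv_deriv (gd_contDiff (α := α) hδ) (ho n) (hb n) x).const_smul (θ n)
      exact h0.const_smul cα
    rw [h1.fderiv]
    have h2 : ∀ n, (∫ y in Ω n, fderiv ℝ (gd α δ) (x - y)) v = wd v (∫ y in Ω n, kernd α δ (x - y)) := by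
      intro n
      rw [ContinuousLinearMap.integral_apply
        (conv_intble ((gd_contDiff hδ).continuous_fderiv (by norm_num)) (ho n) (hb n) x)]
      simp only [gd_deriv hα0 hδ]
      simp only [← inner_perp_left]
      exact integral_inner (conv_intble (kernd_contDiff hδ).continuous (ho n) (hb n) x) (perp v)
    simp only [smul_apply, sum_apply, h2]
    rw [veld, ← inner_perp_left, inner_smul_right, inner_sum]
    simp only [inner_smul_right, inner_perp_left, smul_eq_mul]

lemma veld_conv {α cα : ℝ} (hα0 : 0 < α) (hα : α ≤ 1 / 4) {N : ℕ} (θ : Fin N → ℝ) {Ω : Fin N → Set R2}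
    (ho : ∀ n, IsOpen (Ω n)) (hb : ∀ n, Bornology.IsBounded (Ω n)) (R : ℝ) {ε : ℝ} (hε : 0 < ε) :
    ∀ᶠ δ in 𝓝[>] (0:ℝ), ∀ x : R2, ‖x‖ ≤ R →
      ‖veld α cα δ θ Ω x - gSQGvel α cα θ Ω x‖ ≤ ε := by
  set B : ℝ := |cα| * ∑ n, |θ n| with hB
  have hB0 : 0 ≤ B := by positivity
  have h1 : ∀ᶠ δ in 𝓝[>] (0:ℝ), ∀ n, ∀ x : R2, ‖x‖ ≤ R →
      ‖(∫ y in Ω n, kernd α δ (x - y)) - ∫ y in Ω n, kern α (x - y)‖ ≤ ε / (B + 1) :=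
    eventually_all.2 fun n => kernd_conv_unif hα0 hα (ho n) (hb n) R (by positivity)
  filter_upwards [h1] with δ hδ x hx
  rw [veld, gSQGvel, ← smul_sub, ← Finset.sum_sub_distrib, norm_smul]
  have h2 : ‖∑ n, (θ n • (∫ y in Ω n, kernd α δ (x - y)) - θ n • ∫ y in Ω n, kern α (x - y))‖
      ≤ ∑ n, |θ n| * (ε / (B + 1)) := by
    refine norm_sum_le_of_le _ fun n _ => ?_
    rw [← smul_sub, norm_smul]
    exact mul_le_mul_of_nonneg_left (hδ n x hx) (abs_nonneg _)
  rw [← Finset.sum_mul] at h2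
  calc _ ≤ |cα| * ((∑ n, |θ n|) * (ε / (B + 1))) := mul_le_mul_of_nonneg_left h2 (abs_nonneg _)
    _ = B * (ε / (B + 1)) := by rw [hB]; ring
    _ ≤ ε := by
      rw [mul_div_assoc', div_le_iff₀ (by positivity)]; linarith [mul_comm B ε]

lemma cross_frontier {O : Set R2} (hO : IsOpen O) {w v : R2} {ε : ℝ} (hε : 0 ≤ ε)
    (h : (w ∈ O ∧ w + ε • v ∉ O) ∨ (w ∉ O ∧ w + ε • v ∈ O)) :
    ∃ a ∈ Icc 0 ε, w + a • v ∈ frontier O := by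
  by_contra hcon
  push Not at hcon
  set S : Set R2 := (fun a : ℝ => w + a • v) '' Icc 0 ε with hS
  have hpre : IsPreconnected S := isPreconnected_Icc.image _ (by fun_prop)
  have hw : w ∈ S := ⟨0, ⟨le_rfl, hε⟩, by simp⟩
  have hw' : w + ε • v ∈ S := ⟨ε, ⟨hε, le_rfl⟩, rfl⟩
  have hcov : S ⊆ O ∪ (closure O)ᶜ := by
    rintro _ ⟨a, ha, rfl⟩
    have := hcon a ha
    rw [hO.frontier_eq, Set.mem_sdiff] at this
    push Not at this
    by_cases h : w + a • v ∈ closure O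
    · exact Or.inl (this h)
    · exact Or.inr h
  rcases hpre.subset_or_subset hO isClosed_closure.isOpen_compl
    (disjoint_compl_right.mono_left subset_closure) hcov with h1 | h1
  · rcases h with h | h
    · exact h.2 (h1 hw')
    · exact h.1 (h1 hw)
  · rcases h with h | h
    · exact h1 hw (subset_closure h.1)
    · exact h1 hw' (subset_closure h.2)

lemma area_le {Φ : R2 → R2} {Φ' : R2 → R2 →L[ℝ] R2} (hΦ : ∀ p, HasFDerivAt Φ (Φ' p) p)
    (hJ : Measurable (fun p => ENNReal.ofReal |(Φ' p).det|)) {S : Set R2} (hS : MeasurableSet S)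
    {g : R2 → ENNReal} (hg : Measurable g) :
    ∫⁻ w in Φ '' S, g w ≤ ∫⁻ p in S, ENNReal.ofReal |(Φ' p).det| * g (Φ p) := by
  have hΦm : Measurable Φ :=
    (continuous_iff_continuousAt.2 fun p => (hΦ p).continuousAt).measurable
  set J : R2 → ENNReal := fun p => ENNReal.ofReal |(Φ' p).det| with hJd
  have hle : volume.restrict (Φ '' S) ≤ ((volume.restrict S).withDensity J).map Φ := by
    rw [Measure.le_iff]
    intro A hA
    rw [Measure.restrict_apply hA, Measure.map_apply hΦm hA, withDensity_apply _ (hΦm hA),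
      Measure.restrict_restrict (hΦm hA)]
    have e : A ∩ Φ '' S = Φ '' (Φ ⁻¹' A ∩ S) := by
      rw [inter_comm (Φ ⁻¹' A) S, image_inter_preimage, inter_comm]
    rw [e]
    exact addHaar_image_le_lintegral_abs_det_fderiv volume ((hΦm hA).inter hS)
      fun p _ => (hΦ p).hasFDerivWithinAt
  calc ∫⁻ w in Φ '' S, g w ≤ ∫⁻ w, g w ∂(((volume.restrict S).withDensity J).map Φ) :=
        lintegral_mono' hle le_rfl
    _ = ∫⁻ p, g (Φ p) ∂((volume.restrict S).withDensity J) := lintegral_map hg hΦm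
    _ = ∫⁻ p in S, J p * g (Φ p) :=
        lintegral_withDensity_eq_lintegral_mul _ hJ (hg.comp hΦm)

def pj (i : Fin 2) : R2 →L[ℝ] ℝ := EuclideanSpace.proj i

lemma pj_apply (i : Fin 2) (p : R2) : pj i p = p i := rfl

def strip' (e v : R2) : R2 →L[ℝ] R2 := (pj 0).smulRight v + (pj 1).smulRight e

lemma strip_det (e v : R2) : (strip' e v).det = wd v e := by
  rw [ContinuousLinearMap.det, ← LinearMap.det_toMatrix (EuclideanSpace.basisFun (Fin 2) ℝ).toBasis,
    Matrix.det_fin_two]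
  simp [LinearMap.toMatrix_apply, strip', pj_apply, wd]
  ring

lemma strip_deriv {z : ℝ → R2} (hz : Differentiable ℝ z) (e : R2) (p : R2) :
    HasFDerivAt (fun p : R2 => z (p 0) + (p 1) • e) (strip' e (deriv z (p 0))) p := by
  have h0 : HasFDerivAt (fun p : R2 => p 0) (pj 0) p := (pj 0).hasFDerivAt
  have h1 : HasFDerivAt (fun p : R2 => p 1) (pj 1) p := (pj 1).hasFDerivAt
  have h2 : HasFDerivAt (fun p : R2 => z (p 0)) ((pj 0).smulRight (deriv z (p 0))) p := by
    have := (hz (p 0)).hasDerivAt.hasFDerivAt.comp p h0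
    refine this.congr_fderiv ?_
    ext v; simp
  exact h2.add (h1.smul_const e)

lemma mp_R2 : MeasurePreserving (fun p : R2 => ((p 0, p 1) : ℝ × ℝ)) volume volume := by
  have h1 := PiLp.volume_preserving_ofLp (Fin 2)
  have h2 := volume_preserving_finTwoArrow ℝ
  exact h2.comp h1

lemma strip_int {z : ℝ → R2} (hz : ContDiff ℝ 1 z) (e : R2) (he : ‖e‖ = 1) {ε L B : ℝ} (hε : 0 ≤ ε)
    {f : R2 → ℝ} (hf : Continuous f)
    (hfL : ∀ s ∈ Icc 0 (2 * π), ∀ a ∈ Icc 0 ε, |f (z s + a • e)| ≤ |f (z s)| + L * ε) :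
    ∫⁻ w in (fun p : R2 => z (p 0) + (p 1) • e) '' {p | p 0 ∈ Icc 0 (2 * π) ∧ p 1 ∈ Icc 0 ε},
      ENNReal.ofReal |f w| ≤
    ENNReal.ofReal (ε * ∫ s in (0:ℝ)..(2 * π), (|f (z s)| + L * ε) * |wd (deriv z s) e|) := by
  have hdc : Continuous (deriv z) := hz.continuous_deriv (by norm_num)
  have hS : MeasurableSet {p : R2 | p 0 ∈ Icc 0 (2 * π) ∧ p 1 ∈ Icc 0 ε} := by
    apply MeasurableSet.inter
    · exact (pj 0).continuous.measurable measurableSet_Icc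
    · exact (pj 1).continuous.measurable measurableSet_Icc
  have hwc : Continuous (fun s => wd (deriv z s) e) :=
    continuous_wd.comp (hdc.prodMk continuous_const)
  have h1 := area_le (strip_deriv (hz.differentiable (by norm_num)) e) (by
      simp only [strip_det]
      have : Continuous (fun p : R2 => |wd (deriv z (p 0)) e|) :=
        (hwc.comp (pj 0).continuous).abs
      exact this.measurable.ennreal_ofReal) hS (g := fun w => ENNReal.ofReal |f w|)
      hf.abs.measurable.ennreal_ofReal
  refine h1.trans ?_
  simp only [strip_det]
  set H : ℝ × ℝ → ENNReal := fun q =>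
    ENNReal.ofReal |wd (deriv z q.1) e| * ENNReal.ofReal |f (z q.1 + q.2 • e)| with hH
  have hHm : Measurable H := by
    have c1 : Continuous (fun q : ℝ × ℝ => |wd (deriv z q.1) e|) := (hwc.comp continuous_fst).abs
    have c2 : Continuous (fun q : ℝ × ℝ => |f (z q.1 + q.2 • e)|) := by
      have := hz.continuous; fun_prop
    exact c1.measurable.ennreal_ofReal.mul c2.measurable.ennreal_ofReal
  have h2 : ∫⁻ p in {p : R2 | p 0 ∈ Icc 0 (2 * π) ∧ p 1 ∈ Icc 0 ε},
      ENNReal.ofReal |wd (deriv z (p 0)) e| * ENNReal.ofReal |f (z (p 0) + (p 1) • e)|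
      = ∫⁻ q in (Icc 0 (2 * π)) ×ˢ (Icc 0 ε), H q :=
    mp_R2.setLIntegral_comp_preimage (measurableSet_Icc.prod measurableSet_Icc) hHm
  rw [h2]
  set G : ℝ → ℝ := fun s => (|f (z s)| + L * ε) * |wd (deriv z s) e| with hG
  have hGc : Continuous G := by
    have := hz.continuous
    exact ((hf.comp this).abs.add continuous_const).mul hwc.abs
  have hG0 : ∀ s ∈ Icc 0 (2 * π), 0 ≤ G s := by
    intro s hs
    have := hfL s hs 0 ⟨le_rfl, hε⟩
    have h3 := abs_nonneg (f (z s + (0:ℝ) • e))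
    exact mul_nonneg (by linarith) (abs_nonneg _)
  have h3 : ∫⁻ q in (Icc 0 (2 * π)) ×ˢ (Icc 0 ε), H q
      ≤ ∫⁻ q in (Icc 0 (2 * π)) ×ˢ (Icc 0 ε), ENNReal.ofReal (G q.1) := by
    refine setLIntegral_mono' (measurableSet_Icc.prod measurableSet_Icc) fun q hq => ?_
    simp only [hH]
    rw [← ENNReal.ofReal_mul (abs_nonneg _)]
    apply ENNReal.ofReal_le_ofReal
    simp only [hG]
    rw [mul_comm]
    exact mul_le_mul_of_nonneg_right (hfL _ hq.1 _ hq.2) (abs_nonneg _)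
  refine h3.trans ?_
  rw [Measure.volume_eq_prod, ← Measure.prod_restrict, lintegral_prod _ (by
    have : Measurable (fun q : ℝ × ℝ => ENNReal.ofReal (G q.1)) :=
      (hGc.comp continuous_fst).measurable.ennreal_ofReal
    exact this.aemeasurable)]
  simp only [lintegral_const, Measure.restrict_apply MeasurableSet.univ, univ_inter, Real.volume_Icc,
    sub_zero]
  rw [lintegral_mul_const _ hGc.measurable.ennreal_ofReal, mul_comm ε,
    ENNReal.ofReal_mul' hε, intervalIntegral.integral_of_le (by positivity),
    ← integral_Icc_eq_integral_Ioc,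
    ofReal_integral_eq_lintegral_ofReal (hGc.continuousOn.integrableOn_Icc)
      ((ae_restrict_iff' measurableSet_Icc).2 (.of_forall hG0))]

/-- divergence inequality -/
lemma div_ineq {z : ℝ → R2} (hz : ContDiff ℝ 1 z) {O : Set R2} (hOo : IsOpen O)
    (hO : Bornology.IsBounded O) (hfr : frontier O ⊆ z '' Icc 0 (2 * π)) {e : R2} (he : ‖e‖ = 1)
    {G : R2 → ℝ} (hG : ContDiff ℝ 1 G) (x0 : R2) :
    |∫ y in O, fderiv ℝ G (x0 - y) e| ≤ ∫ s in (0:ℝ)..(2 * π), |G (x0 - z s)| * |wd (deriv z s) e| := by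
  have hfc : Continuous (fun y => G (x0 - y)) := hG.continuous.comp (continuous_const.sub continuous_id)
  have hdc : Continuous (deriv z) := hz.continuous_deriv (by norm_num)
  have hwc : Continuous (fun s => wd (deriv z s) e) :=
    continuous_wd.comp (hdc.prodMk continuous_const)
  -- local Lipschitz bound
  obtain ⟨R, hR⟩ := (isCompact_Icc (a := (0:ℝ)) (b := 2 * π)).exists_bound_of_continuousOn
    hz.continuous.continuousOn
  obtain ⟨L, hL⟩ := (isCompact_closedBall (0 : R2) (‖x0‖ + R + 1)).exists_bound_of_continuousOn
    (hG.continuous_fderiv (by norm_num)).continuousOn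
  have hmem : ∀ s ∈ Icc 0 (2 * π), ∀ a ∈ Icc (0:ℝ) 1,
      x0 - (z s + a • -e) ∈ Metric.closedBall (0 : R2) (‖x0‖ + R + 1) := by
    intro s hs a ha
    rw [mem_closedBall_zero_iff]
    have h1 := norm_sub_le x0 (z s + a • -e)
    have h2 := norm_add_le (z s) (a • -e)
    have h3 := hR s hs
    have h4 : ‖a • -e‖ ≤ 1 := by
      rw [norm_smul, norm_neg, he, mul_one, Real.norm_of_nonneg ha.1]; exact ha.2
    linarith
  have hL0 : 0 ≤ L := (norm_nonneg _).trans (hL _ (hmem 0 ⟨le_rfl, by positivity⟩ 0 ⟨le_rfl, zero_le_one⟩))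
  have hlip : ∀ ε ∈ Icc (0:ℝ) 1, ∀ s ∈ Icc 0 (2 * π), ∀ a ∈ Icc 0 ε,
      |G (x0 - (z s + a • -e))| ≤ |G (x0 - z s)| + L * ε := by
    intro ε hε s hs a ha
    have h1 := (convex_closedBall (0 : R2) (‖x0‖ + R + 1)).norm_image_sub_le_of_norm_fderiv_le
      (𝕜 := ℝ) (f := G) (C := L) (fun x _ => hG.differentiable (by norm_num) x) hL
      (hmem s hs 0 ⟨le_rfl, zero_le_one⟩) (hmem s hs a ⟨ha.1, ha.2.trans hε.2⟩)
    have h4 : ‖x0 - (z s + a • -e) - (x0 - (z s + (0:ℝ) • -e))‖ ≤ ε := by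
      have : x0 - (z s + a • -e) - (x0 - (z s + (0:ℝ) • -e)) = a • e := by simp
      rw [this, norm_smul, he, mul_one, Real.norm_of_nonneg ha.1]; exact ha.2
    have h5 := mul_le_mul_of_nonneg_left h4 hL0
    simp only [zero_smul, add_zero] at h1 h5
    have h6 := abs_sub_abs_le_abs_sub (G (x0 - (z s + a • -e))) (G (x0 - z s))
    rw [Real.norm_eq_abs] at h1
    linarith
  set J : ℝ := ∫ s in (0:ℝ)..(2 * π), |G (x0 - z s)| * |wd (deriv z s) e| with hJ
  set K : ℝ := ∫ s in (0:ℝ)..(2 * π), L * |wd (deriv z s) e| with hK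
  have hcJ : Continuous (fun s => |G (x0 - z s)| * |wd (deriv z s) e|) :=
    (hfc.comp hz.continuous).abs.mul hwc.abs
  have hcK : Continuous (fun s => L * |wd (deriv z s) e|) := continuous_const.mul hwc.abs
  set Ψ : R2 → ℝ := fun x => ∫ y in O, G (x - y) with hΨ
  -- difference quotient bound
  have hdiff : ∀ ε ∈ Icc (0:ℝ) 1, |Ψ (x0 + ε • e) - Ψ x0| ≤ ε * (J + ε * K) := by
    intro ε hε
    set O' : Set R2 := (fun y => y + ε • e) ⁻¹' O with hO'
    have hO'o : IsOpen O' := hOo.preimage (by fun_prop)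
    have e1 : Ψ (x0 + ε • e) = ∫ y in O', G (x0 - y) := by
      have hmp := measurePreserving_add_right (volume : Measure R2) (ε • e)
      have := hmp.setIntegral_preimage_emb (measurableEmbedding_addRight (ε • e))
        (fun y => G (x0 + ε • e - y)) O
      simp only [hΨ]
      rw [← this]
      simp only [add_sub_add_right_eq_sub]
      rfl
    have i1 : IntegrableOn (fun y => G (x0 - y)) O := conv_intble hG.continuous hOo hO x0
    have i2 : IntegrableOn (fun y => G (x0 - y)) O' := by
      refine conv_intble hG.continuous hO'o ?_ x0
      obtain ⟨r, hr⟩ := hO.exists_norm_le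
      refine isBounded_iff_forall_norm_le.2 ⟨r + ‖ε • e‖, fun y hy => ?_⟩
      have h1 := hr _ hy
      have h2 := norm_sub_le (y + ε • e) (ε • e)
      rw [add_sub_cancel_right] at h2
      have h3 : ‖y + ε • e‖ ≤ r := h1
      linarith
    set D : Set R2 := (fun p : R2 => z (p 0) + (p 1) • -e) '' {p | p 0 ∈ Icc 0 (2 * π) ∧ p 1 ∈ Icc 0 ε}
      with hD
    have hsub : ∀ w, ¬ (w ∈ O ↔ w ∈ O') → w ∈ D := by
      intro w hw
      have : (w ∈ O ∧ w + ε • e ∉ O) ∨ (w ∉ O ∧ w + ε • e ∈ O) := by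
        have h1 : w ∈ O' ↔ w + ε • e ∈ O := Iff.rfl
        tauto
      obtain ⟨a, ha, hfa⟩ := cross_frontier hOo hε.1 this
      obtain ⟨s, hs, hzs⟩ := hfr hfa
      refine ⟨mk2 s a, ⟨?_, ?_⟩, ?_⟩
      · simpa [mk2] using hs
      · simpa [mk2] using ha
      · simp [mk2, hzs]
    have e2 : Ψ (x0 + ε • e) - Ψ x0
        = ∫ y, (O'.indicator (fun y => G (x0 - y)) y - O.indicator (fun y => G (x0 - y)) y) := by
      rw [e1, integral_sub ((integrable_indicator_iff hO'o.measurableSet).2 i2)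
        ((integrable_indicator_iff hOo.measurableSet).2 i1), integral_indicator hO'o.measurableSet,
        integral_indicator hOo.measurableSet]
    have e3 : ENNReal.ofReal |Ψ (x0 + ε • e) - Ψ x0| ≤ ∫⁻ w in D, ENNReal.ofReal |G (x0 - w)| := by
      rw [e2, ← Real.norm_eq_abs, ofReal_norm]
      refine (enorm_integral_le_lintegral_enorm _).trans ?_
      have hDm : MeasurableSet D := by
        apply IsCompact.measurableSet
        have hk : IsCompact ((fun q : ℝ × ℝ => z q.1 + q.2 • -e) '' (Icc 0 (2 * π) ×ˢ Icc 0 ε)) :=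
          (isCompact_Icc.prod isCompact_Icc).image (by have := hz.continuous; fun_prop)
        convert hk using 1
        ext w; constructor
        · rintro ⟨p, hp, rfl⟩; exact ⟨(p 0, p 1), ⟨hp.1, hp.2⟩, rfl⟩
        · rintro ⟨q, hq, rfl⟩
          exact ⟨mk2 q.1 q.2, ⟨by simpa [mk2] using hq.1, by simpa [mk2] using hq.2⟩, by simp [mk2]⟩
      rw [← lintegral_indicator hDm]
      refine lintegral_mono fun w => ?_
      by_cases hw : w ∈ O ↔ w ∈ O'
      · have : O'.indicator (fun y => G (x0 - y)) w - O.indicator (fun y => G (x0 - y)) w = 0 := by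
          by_cases h : w ∈ O
          · simp [h, hw.1 h]
          · have h' : w ∉ O' := fun h' => h (hw.2 h')
            simp [h, h']
        rw [this]; simp
      · rw [indicator_of_mem (hsub w hw), ← ofReal_norm]
        apply ENNReal.ofReal_le_ofReal
        rw [Real.norm_eq_abs]
        by_cases h : w ∈ O
        · have h' : w ∉ O' := by tauto
          simp [h, h']
        · have h' : w ∈ O' := by tauto
          simp [h, h']
    have e4 := e3.trans (strip_int (B := 0) hz (-e) (by rwa [norm_neg]) hε.1 hfc (hlip ε hε))
    have e5 : ∫ s in (0:ℝ)..(2 * π), (|G (x0 - z s)| + L * ε) * |wd (deriv z s) (-e)| = J + ε * K := by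
      have : ∀ s, (|G (x0 - z s)| + L * ε) * |wd (deriv z s) (-e)|
          = |G (x0 - z s)| * |wd (deriv z s) e| + ε * (L * |wd (deriv z s) e|) := by
        intro s
        have : wd (deriv z s) (-e) = - wd (deriv z s) e := by simp [wd]; ring
        rw [this, abs_neg]; ring
      simp only [this]
      rw [intervalIntegral.integral_add (hcJ.intervalIntegrable _ _)
        ((hcK.const_mul ε).intervalIntegrable _ _), intervalIntegral.integral_const_mul]
    rw [e5] at e4
    have hnn : 0 ≤ ε * (J + ε * K) := by
      have : 0 ≤ J := intervalIntegral.integral_nonneg (by positivity) fun s _ => by positivity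
      have : 0 ≤ K := intervalIntegral.integral_nonneg (by positivity) fun s _ => by positivity
      have := hε.1
      positivity
    exact (ENNReal.ofReal_le_ofReal_iff hnn).1 e4
  -- derivative
  have hI : (∫ y in O, fderiv ℝ G (x0 - y)) e = ∫ y in O, fderiv ℝ G (x0 - y) e :=
    ContinuousLinearMap.integral_apply
        (conv_intble (hG.continuous_fderiv (by norm_num)) hOo hO x0) e
  have hd0 : HasFDerivAt Ψ (∫ y in O, fderiv ℝ G (x0 - y)) x0 := conv_deriv hG hOo hO x0
  have hd := (hd0.hasLineDerivAt e).tendsto_slope_zero_right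
  rw [hI] at hd
  have hlim : Tendsto (fun ε : ℝ => J + ε * K) (𝓝[>] 0) (𝓝 (J + 0 * K)) := by
    apply tendsto_nhdsWithin_of_tendsto_nhds
    have : Continuous (fun ε : ℝ => J + ε * K) := by fun_prop
    exact this.tendsto 0
  rw [zero_mul, add_zero] at hlim
  refine le_of_tendsto_of_tendsto hd.abs hlim ?_
  filter_upwards [Ioo_mem_nhdsGT (zero_lt_one : (0:ℝ) < 1)] with ε hε
  have h1 := hdiff ε ⟨hε.1.le, hε.2.le⟩
  simp only [smul_eq_mul]
  rw [abs_mul, abs_inv, abs_of_pos hε.1, inv_mul_le_iff₀ hε.1]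
  exact h1

lemma lint_abs (h : ℝ → ENNReal) (hm : Measurable h) (s0 ρ : ℝ) :
    ∫⁻ s in Icc (s0 - ρ) (s0 + ρ), h |s - s0| ≤ 2 * ∫⁻ u in Icc 0 ρ, h u := by
  have hsub : Icc (s0 - ρ) (s0 + ρ) ⊆ ((fun s => s0 - s) ⁻¹' Icc 0 ρ) ∪ ((fun s => s - s0) ⁻¹' Icc 0 ρ) := by
    intro s hs
    rcases le_total s s0 with h1 | h1
    · left; constructor
      · simpa using h1
      · show s0 - s ≤ ρ; linarith [hs.1]
    · right; constructor
      · simpa using h1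
      · show s - s0 ≤ ρ; linarith [hs.2]
  refine (lintegral_mono_set hsub).trans ((lintegral_union_le _ _ _).trans ?_)
  rw [two_mul]
  refine add_le_add (le_of_eq ?_) (le_of_eq ?_)
  · rw [← (Measure.measurePreserving_sub_left (volume : Measure ℝ) s0).setLIntegral_comp_preimage
      measurableSet_Icc hm]
    refine setLIntegral_congr_fun ((measurable_const.sub measurable_id) measurableSet_Icc) fun s hs => ?_
    have : 0 ≤ s0 - s := hs.1
    simp only [abs_sub_comm s s0, abs_of_nonneg this]
  · rw [← (measurePreserving_sub_right (volume : Measure ℝ) s0).setLIntegral_comp_preimage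
      measurableSet_Icc hm]
    refine setLIntegral_congr_fun ((measurable_id.sub measurable_const) measurableSet_Icc) fun s hs => ?_
    have : 0 ≤ s - s0 := hs.1
    simp only [abs_of_nonneg this]

lemma lint1 {d ρ a : ℝ} (hd : 0 < d) (hρ : 0 ≤ ρ) (ha : 0 < a) :
    ∫⁻ u in Icc 0 ρ, ENNReal.ofReal ((d + u) ^ (-(1 + a))) ≤ ENNReal.ofReal (d ^ (-a) / a) := by
  have hc : ContinuousOn (fun u => (d + u) ^ (-(1 + a))) (Icc 0 ρ) := by
    refine ContinuousOn.rpow_const (by fun_prop) fun u hu => Or.inl ?_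
    have := hu.1; positivity
  rw [← ofReal_integral_eq_lintegral_ofReal hc.integrableOn_Icc
    ((ae_restrict_iff' measurableSet_Icc).2 (.of_forall fun u hu => by
      have := hu.1
      show 0 ≤ (d + u) ^ (-(1 + a))
      positivity))]
  apply ENNReal.ofReal_le_ofReal
  rw [integral_Icc_eq_integral_Ioc, ← intervalIntegral.integral_of_le hρ,
    intervalIntegral.integral_comp_add_left (fun v => v ^ (-(1 + a))) d, integral_rpow]
  · rw [show -(1 + a) + 1 = -a by ring, add_zero, div_neg, ← neg_div, neg_sub]
    apply div_le_div_of_nonneg_right _ ha.le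
    have : 0 ≤ (d + ρ) ^ (-a) := by positivity
    linarith
  · right
    constructor
    · intro h; linarith
    · rw [uIcc_of_le (by linarith)]
      intro h; linarith [h.1]

lemma lint2 {ρ p : ℝ} (hρ : 0 ≤ ρ) (hp : -1 < p) :
    ∫⁻ u in Icc 0 ρ, ENNReal.ofReal (u ^ p) = ENNReal.ofReal (ρ ^ (p + 1) / (p + 1)) := by
  have hi := (intervalIntegral.intervalIntegrable_rpow' hp (a := 0) (b := ρ))
  rw [intervalIntegrable_iff_integrableOn_Icc_of_le hρ] at hi
  rw [← ofReal_integral_eq_lintegral_ofReal hi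
    ((ae_restrict_iff' measurableSet_Icc).2 (.of_forall fun u hu => Real.rpow_nonneg hu.1 _))]
  rw [integral_Icc_eq_integral_Ioc, ← intervalIntegral.integral_of_le hρ, integral_rpow (Or.inl hp),
    Real.zero_rpow (by linarith), sub_zero]

lemma win_pt {M γ α c0 ρ0 C1 d' r a t : ℝ} (hα0 : 0 < α) (hM : 0 < M) (hc0 : 0 < c0)
    (hC1 : 0 < C1) (hd' : 0 ≤ d') (ht : 0 < t) (hr1 : d' ≤ r) (hr2 : c0 / 4 * t ≤ r)
    (ha : a ≤ C1 * d' ^ (2 * α) + M * t ^ γ) :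
    r ^ (-(1 + 2 * α)) * a ≤ C1 * (min 1 (c0 / 4) / 2) ^ (-(1 + 2 * α)) * (d' ^ (2 * α) * (d' + t) ^ (-(1 + 2 * α)))
      + M * (c0 / 4) ^ (-(1 + 2 * α)) * t ^ (γ - 1 - 2 * α) := by
  have hm : 0 < min 1 (c0 / 4) := by positivity
  have hr0 : 0 < r := lt_of_lt_of_le (by positivity) hr2
  have h1 : min 1 (c0 / 4) / 2 * (d' + t) ≤ r := by
    have e1 : min 1 (c0 / 4) * d' ≤ 1 * d' := mul_le_mul_of_nonneg_right (min_le_left _ _) hd'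
    have e2 : min 1 (c0 / 4) * t ≤ c0 / 4 * t := mul_le_mul_of_nonneg_right (min_le_right _ _) ht.le
    linarith
  have h2 : r ^ (-(1 + 2 * α)) ≤ (min 1 (c0 / 4) / 2) ^ (-(1 + 2 * α)) * (d' + t) ^ (-(1 + 2 * α)) := by
    rw [← Real.mul_rpow (by positivity) (by positivity)]
    exact Real.rpow_le_rpow_of_nonpos (by positivity) h1 (by linarith)
  have h3 : r ^ (-(1 + 2 * α)) ≤ (c0 / 4) ^ (-(1 + 2 * α)) * t ^ (-(1 + 2 * α)) := by
    rw [← Real.mul_rpow (by positivity) (by positivity)]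
    exact Real.rpow_le_rpow_of_nonpos (by positivity) hr2 (by linarith)
  have h4 : t ^ (γ - 1 - 2 * α) = t ^ (-(1 + 2 * α)) * t ^ γ := by
    rw [← Real.rpow_add ht]; congr 1; ring
  have hrp : 0 ≤ r ^ (-(1 + 2 * α)) := by positivity
  calc r ^ (-(1 + 2 * α)) * a ≤ r ^ (-(1 + 2 * α)) * (C1 * d' ^ (2 * α) + M * t ^ γ) := by gcongr
    _ = (C1 * d' ^ (2 * α)) * r ^ (-(1 + 2 * α)) + (M * t ^ γ) * r ^ (-(1 + 2 * α)) := by ring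
    _ ≤ (C1 * d' ^ (2 * α)) * ((min 1 (c0 / 4) / 2) ^ (-(1 + 2 * α)) * (d' + t) ^ (-(1 + 2 * α)))
        + (M * t ^ γ) * ((c0 / 4) ^ (-(1 + 2 * α)) * t ^ (-(1 + 2 * α))) := by gcongr
    _ = _ := by rw [h4]; ring

lemma win_int {M γ α c0 ρ0 C1 : ℝ} (hα0 : 0 < α) (hγ : 2 * α < γ) (hM : 0 < M) (hc0 : 0 < c0)
    (hρ0 : 0 < ρ0) (hMρ : M * ρ0 ^ γ ≤ c0 / 2) (hC1 : 0 < C1) :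
    ∃ C, 0 < C ∧ ∀ (c : ℝ) (z : ℝ → R2), Cv M γ c z → c0 ≤ c → ∀ (x n : R2), ‖n‖ = 1 →
      (∀ s, |inner ℝ (deriv z s) n| ≤ C1 * ‖x - z s‖ ^ (2 * α)) → ∀ a : ℝ,
      ∫⁻ s in Icc a (a + ρ0), ENNReal.ofReal (‖x - z s‖ ^ (-(1 + 2 * α)) * |inner ℝ (deriv z s) n|)
        ≤ ENNReal.ofReal C := by
  set κ1 : ℝ := C1 * (min 1 (c0 / 4) / 2) ^ (-(1 + 2 * α)) with hκ1
  set κ2 : ℝ := M * (c0 / 4) ^ (-(1 + 2 * α)) with hκ2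
  have h1 : 0 < κ1 := by positivity
  have h2 : 0 < κ2 := by positivity
  have hp : 0 < γ - 1 - 2 * α + 1 := by linarith
  refine ⟨2 * (κ1 * (1 / (2 * α)) + κ2 * (ρ0 ^ (γ - 1 - 2 * α + 1) / (γ - 1 - 2 * α + 1))),
    by positivity, ?_⟩
  intro c z hz hc x n hn hang a
  obtain ⟨s0, hs0, hmin⟩ := (isCompact_Icc (a := a) (b := a + ρ0)).exists_isMinOn
    (nonempty_Icc.2 (by linarith)) (f := fun s => ‖x - z s‖)
    (continuous_const.sub hz.cont).norm.continuousOn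
  set d' := ‖x - z s0‖ with hd'
  have hd'0 : 0 ≤ d' := norm_nonneg _
  set h : ℝ → ENNReal := fun t => ENNReal.ofReal (κ1 * (d' ^ (2 * α) * (d' + t) ^ (-(1 + 2 * α)))
      + κ2 * t ^ (γ - 1 - 2 * α)) with hh
  have hhm : Measurable h := by rw [hh]; fun_prop
  have hpt : ∀ s ∈ Icc a (a + ρ0), s ≠ s0 →
      ENNReal.ofReal (‖x - z s‖ ^ (-(1 + 2 * α)) * |inner ℝ (deriv z s) n|) ≤ h |s - s0| := by
    intro s hs hne
    apply ENNReal.ofReal_le_ofReal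
    have ht : 0 < |s - s0| := abs_pos.2 (sub_ne_zero.2 hne)
    have hst : |s - s0| ≤ ρ0 := by
      rw [abs_le]; constructor <;> linarith [hs.1, hs.2, hs0.1, hs0.2]
    have hr1 : d' ≤ ‖x - z s‖ := hmin hs
    refine win_pt (ρ0 := ρ0) hα0 hM hc0 hC1 hd'0 ht hr1 ?_ ?_
    · have e1 := hz.chord (by linarith) (hMρ.trans (by linarith)) hst
      have e2 : ‖z s - z s0‖ ≤ ‖x - z s‖ + ‖x - z s0‖ := by
        have := norm_sub_le (x - z s0) (x - z s)
        rw [sub_sub_sub_cancel_left] at this; linarith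
      have e3 : c0 * |s - s0| ≤ c * |s - s0| := by gcongr
      linarith
    · have e1 : inner ℝ (deriv z s) n = inner ℝ (deriv z s0) n + inner ℝ (deriv z s - deriv z s0) n := by
        rw [← inner_add_left]; simp
      rw [e1]
      refine (abs_add_le _ _).trans (add_le_add (hang s0) ?_)
      refine (inner_abs_le _ _).trans ?_
      rw [hn, mul_one]; exact hz.hol s s0
  calc ∫⁻ s in Icc a (a + ρ0), ENNReal.ofReal (‖x - z s‖ ^ (-(1 + 2 * α)) * |inner ℝ (deriv z s) n|)
      ≤ ∫⁻ s in Icc a (a + ρ0), h |s - s0| := by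
        refine lintegral_mono_ae ?_
        rw [ae_restrict_iff' measurableSet_Icc]
        have : ∀ᵐ s : ℝ, s ≠ s0 := by simp [ae_iff]
        filter_upwards [this] with s hs1 hs2 using hpt s hs2 hs1
    _ ≤ ∫⁻ s in Icc (s0 - ρ0) (s0 + ρ0), h |s - s0| := by
        refine lintegral_mono_set fun s hs => ⟨?_, ?_⟩ <;> linarith [hs.1, hs.2, hs0.1, hs0.2]
    _ ≤ 2 * ∫⁻ u in Icc 0 ρ0, h u := lint_abs h hhm s0 ρ0
    _ ≤ 2 * (ENNReal.ofReal (κ1 * (1 / (2 * α)))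
          + ENNReal.ofReal (κ2 * (ρ0 ^ (γ - 1 - 2 * α + 1) / (γ - 1 - 2 * α + 1)))) := by
        refine mul_le_mul_right ?_ 2
        have e1 : ∫⁻ u in Icc 0 ρ0, h u ≤ ∫⁻ u in Icc 0 ρ0,
            (ENNReal.ofReal (κ1 * d' ^ (2 * α)) * ENNReal.ofReal ((d' + u) ^ (-(1 + 2 * α)))
            + ENNReal.ofReal κ2 * ENNReal.ofReal (u ^ (γ - 1 - 2 * α))) := by
          refine setLIntegral_mono' measurableSet_Icc fun u hu => ?_
          rw [hh, ← ENNReal.ofReal_mul (by positivity), ← ENNReal.ofReal_mul h2.le, mul_assoc]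
          exact ENNReal.ofReal_add_le
        refine e1.trans ?_
        rw [lintegral_add_right _ (by fun_prop), lintegral_const_mul _ (by fun_prop),
          lintegral_const_mul _ (by fun_prop), lint2 hρ0.le (by linarith), ← ENNReal.ofReal_mul h2.le]
        refine add_le_add ?_ le_rfl
        rcases hd'0.eq_or_lt with h0 | h0
        · rw [← h0, Real.zero_rpow (by positivity)]; simp
        · refine (mul_le_mul_right (lint1 h0 hρ0.le (by positivity : 0 < 2 * α)) _).trans ?_
          rw [← ENNReal.ofReal_mul (by positivity)]
          apply ENNReal.ofReal_le_ofReal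
          apply le_of_eq
          rw [Real.rpow_neg h0.le]
          have : d' ^ (2 * α) ≠ 0 := by positivity
          field_simp
    _ = _ := by
        rw [← ENNReal.ofReal_add (by positivity) (by positivity),
          show (2 : ENNReal) = ENNReal.ofReal 2 by simp, ← ENNReal.ofReal_mul (by norm_num)]

lemma full_int {M γ α c0 ρ0 C1 : ℝ} (hα0 : 0 < α) (hγ : 2 * α < γ) (hM : 0 < M) (hc0 : 0 < c0)
    (hρ0 : 0 < ρ0) (hMρ : M * ρ0 ^ γ ≤ c0 / 2) (hC1 : 0 < C1) :
    ∃ C, 0 < C ∧ ∀ (c : ℝ) (z : ℝ → R2), Cv M γ c z → c0 ≤ c → ∀ (x n : R2), ‖n‖ = 1 →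
      (∀ s, |inner ℝ (deriv z s) n| ≤ C1 * ‖x - z s‖ ^ (2 * α)) →
      ∫⁻ s in Icc 0 (2 * π), ENNReal.ofReal (‖x - z s‖ ^ (-(1 + 2 * α)) * |inner ℝ (deriv z s) n|)
        ≤ ENNReal.ofReal C := by
  obtain ⟨C, hC, hwin⟩ := win_int hα0 hγ hM hc0 hρ0 hMρ hC1
  set K : ℕ := ⌈2 * π / ρ0⌉₊ + 1 with hK
  refine ⟨K * C, by positivity, fun c z hz hc x n hn hang => ?_⟩
  have hsub : Icc 0 (2 * π) ⊆ ⋃ i : Fin K, Icc ((i : ℕ) * ρ0) ((i : ℕ) * ρ0 + ρ0) := by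
    intro s hs
    have h0 : 0 ≤ s / ρ0 := div_nonneg hs.1 hρ0.le
    simp only [mem_iUnion]
    refine ⟨⟨⌊s / ρ0⌋₊, ?_⟩, ?_, ?_⟩
    · have h1 : s / ρ0 ≤ 2 * π / ρ0 := by gcongr; exact hs.2
      have h2 := Nat.floor_mono (h1.trans (Nat.le_ceil _))
      rw [Nat.floor_natCast] at h2
      omega
    · have := Nat.floor_le h0
      rwa [le_div_iff₀ hρ0] at this
    · have := (Nat.lt_floor_add_one (s / ρ0)).le
      rw [div_le_iff₀ hρ0] at this
      linarith
  refine (lintegral_mono_set hsub).trans ?_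
  refine (lintegral_iUnion_le _ _).trans ?_
  rw [tsum_fintype]
  refine (Finset.sum_le_sum fun (i : Fin K) _ => hwin c z hz hc x n hn hang ((i : ℕ) * ρ0)).trans ?_
  rw [Finset.sum_const, Finset.card_univ, Fintype.card_fin, nsmul_eq_mul, ENNReal.ofReal_mul (by positivity)]
  simp

lemma gd_radial {α δ t1 t2 : ℝ} (hα0 : 0 < α) (hδ : 0 < δ) (ht1 : 0 < t1) (h12 : t1 ≤ t2) :
    |(1 / (2 * α)) * (t2 ^ 2 + δ ^ 2) ^ (-α) - (1 / (2 * α)) * (t1 ^ 2 + δ ^ 2) ^ (-α)|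
      ≤ t1 ^ (-(1 + 2 * α)) * (t2 - t1) := by
  have hd : ∀ t ∈ Icc t1 t2, HasDerivWithinAt (fun t : ℝ => (1 / (2 * α)) * (t ^ 2 + δ ^ 2) ^ (-α))
      (-(t * (t ^ 2 + δ ^ 2) ^ (-α - 1))) (Icc t1 t2) t := by
    intro t ht
    have h1 : HasDerivAt (fun t : ℝ => t ^ 2 + δ ^ 2) (2 * t) t := by
      simpa using (hasDerivAt_pow 2 t).add_const (δ ^ 2)
    have h2 := (h1.rpow_const (p := -α) (Or.inl (by positivity))).const_mul (1 / (2 * α))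
    refine (h2.congr_deriv ?_).hasDerivWithinAt
    field_simp
  have := (convex_Icc t1 t2).norm_image_sub_le_of_norm_hasDerivWithin_le (C := t1 ^ (-(1 + 2 * α))) hd
    (fun t ht => by
      have ht0 : 0 < t := ht1.trans_le ht.1
      rw [norm_neg, Real.norm_of_nonneg (by positivity)]
      have e1 : (t ^ 2 + δ ^ 2) ^ (-α - 1) ≤ (t ^ 2) ^ (-α - 1) :=
        Real.rpow_le_rpow_of_nonpos (by positivity) (by linarith [sq_nonneg δ]) (by linarith)
      have e2 : (t ^ 2) ^ (-α - 1) = t ^ (-(2 + 2 * α)) := by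
        rw [← Real.rpow_natCast, ← Real.rpow_mul ht0.le]; congr 1; push_cast; ring
      have e3 : t * t ^ (-(2 + 2 * α)) = t ^ (-(1 + 2 * α)) := by
        nth_rewrite 1 [← Real.rpow_one t]
        rw [← Real.rpow_add ht0]; congr 1; ring
      calc t * (t ^ 2 + δ ^ 2) ^ (-α - 1) ≤ t * (t ^ 2) ^ (-α - 1) := by gcongr
        _ = t ^ (-(1 + 2 * α)) := by rw [e2, e3]
        _ ≤ t1 ^ (-(1 + 2 * α)) := Real.rpow_le_rpow_of_nonpos ht1 ht.1 (by linarith))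
    (left_mem_Icc.2 h12) (right_mem_Icc.2 h12)
  rw [Real.norm_eq_abs, Real.norm_of_nonneg (by linarith : 0 ≤ t2 - t1)] at this
  exact this

lemma gd_diff {α δ : ℝ} (hα0 : 0 < α) (hδ : 0 < δ) {a b : R2} (ha : a ≠ 0) (hb : b ≠ 0) :
    |gd α δ a - gd α δ b| ≤ ‖a - b‖ * (‖a‖ ^ (-(1 + 2 * α)) + ‖b‖ ^ (-(1 + 2 * α))) := by
  have ha0 : 0 < ‖a‖ := norm_pos_iff.2 ha
  have hb0 : 0 < ‖b‖ := norm_pos_iff.2 hb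
  have h3 := abs_le.1 (abs_norm_sub_norm_le a b)
  have p1 : 0 < ‖a‖ ^ (-(1 + 2 * α)) := by positivity
  have p2 : 0 < ‖b‖ ^ (-(1 + 2 * α)) := by positivity
  have p3 := norm_nonneg (a - b)
  rcases le_total ‖a‖ ‖b‖ with h | h
  · have h1 := gd_radial hα0 hδ ha0 h
    have e : gd α δ a - gd α δ b = (1 / (2 * α)) * (‖b‖ ^ 2 + δ ^ 2) ^ (-α)
      - (1 / (2 * α)) * (‖a‖ ^ 2 + δ ^ 2) ^ (-α) := by simp only [gd]; ring
    rw [e]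
    refine h1.trans ?_
    have h4 : ‖a‖ ^ (-(1 + 2 * α)) * (‖b‖ - ‖a‖) ≤ ‖a‖ ^ (-(1 + 2 * α)) * ‖a - b‖ :=
      mul_le_mul_of_nonneg_left (by linarith) p1.le
    linarith [mul_nonneg p3 p2.le]
  · have h1 := gd_radial hα0 hδ hb0 h
    have e : gd α δ a - gd α δ b = -((1 / (2 * α)) * (‖a‖ ^ 2 + δ ^ 2) ^ (-α)
      - (1 / (2 * α)) * (‖b‖ ^ 2 + δ ^ 2) ^ (-α)) := by simp only [gd]; ring
    rw [e, abs_neg]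
    refine h1.trans ?_
    have h4 : ‖b‖ ^ (-(1 + 2 * α)) * (‖a‖ - ‖b‖) ≤ ‖b‖ ^ (-(1 + 2 * α)) * ‖a - b‖ :=
      mul_le_mul_of_nonneg_left (by linarith) p2.le
    linarith [mul_nonneg p3 p1.le]

lemma Cv.ae_ne {M γ c : ℝ} {z : ℝ → R2} (hz : Cv M γ c z) (x : R2) : ∀ᵐ s : ℝ, x - z s ≠ 0 := by
  have hcount : {s : ℝ | z s = x}.Countable := by
    rcases Set.eq_empty_or_nonempty {s : ℝ | z s = x} with h | ⟨s1, hs1⟩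
    · rw [h]; exact countable_empty
    · refine (countable_range (fun k : ℤ => s1 + 2 * π * k)).mono ?_
      intro s hs
      have : z s = z s1 := Eq.trans hs (Eq.symm hs1)
      obtain ⟨k, hk⟩ := distT_zero (hz.inj _ _ this)
      exact ⟨k, hk.symm⟩
  rw [ae_iff]
  refine measure_mono_null ?_ (hcount.measure_zero volume)
  intro s hs
  have h : ¬ (x - z s ≠ 0) := hs
  push Not at h
  exact (sub_eq_zero.1 h).symm

lemma vel1_est {M γ α c0 ρ0 C1 : ℝ} (hα0 : 0 < α) (hα : α ≤ 1 / 4) (hγ : 2 * α < γ) (hM : 0 < M) (hc0 : 0 < c0)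
    (hρ0 : 0 < ρ0) (hMρ : M * ρ0 ^ γ ≤ c0 / 2) (hC1 : 0 < C1) :
    ∃ C, 0 < C ∧ ∀ (c : ℝ) (z : ℝ → R2) (O : Set R2), Cv M γ c z → c0 ≤ c → IsOpen O →
      Bornology.IsBounded O → frontier O ⊆ z '' Icc 0 (2 * π) → ∀ (P Q n : R2), ‖n‖ = 1 →
      (∀ s, |inner ℝ (deriv z s) n| ≤ C1 * ‖P - z s‖ ^ (2 * α)) →
      (∀ s, |inner ℝ (deriv z s) n| ≤ C1 * ‖Q - z s‖ ^ (2 * α)) →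
      |inner ℝ ((∫ y in O, kern α (P - y)) - ∫ y in O, kern α (Q - y)) n| ≤ C * ‖P - Q‖ := by
  obtain ⟨C, hC, hfull⟩ := full_int hα0 hγ hM hc0 hρ0 hMρ hC1
  refine ⟨2 * C, by positivity, ?_⟩
  intro c z O hz hc hOo hO hfr P Q n hn hP hQ
  have hreg : ∀ δ > 0, |inner ℝ ((∫ y in O, kernd α δ (P - y)) - ∫ y in O, kernd α δ (Q - y)) n|
      ≤ 2 * C * ‖P - Q‖ := by
    intro δ hδ
    set G : R2 → ℝ := fun v => gd α δ v - gd α δ (v - (P - Q)) with hG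
    have hgd := gd_contDiff (α := α) hδ
    have hGc : ContDiff ℝ 1 G := hgd.sub (hgd.comp (contDiff_id.sub contDiff_const))
    have hGd : ∀ y, fderiv ℝ G (P - y) (perp n) = - inner ℝ (kernd α δ (P - y) - kernd α δ (Q - y)) n := by
      intro y
      have d1 : HasFDerivAt (gd α δ) (fderiv ℝ (gd α δ) (P - y)) (P - y) :=
        (hgd.differentiable (by norm_num) _).hasFDerivAt
      have d2 : HasFDerivAt (gd α δ) (fderiv ℝ (gd α δ) (P - y - (P - Q))) (P - y - (P - Q)) :=
        (hgd.differentiable (by norm_num) _).hasFDerivAt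
      have d3 := d2.comp (P - y) ((hasFDerivAt_id (P - y)).sub_const (P - Q))
      have d4 : HasFDerivAt G _ (P - y) := d1.sub d3
      rw [d4.fderiv]
      have e1 : P - y - (P - Q) = Q - y := by abel
      rw [e1]
      show fderiv ℝ (gd α δ) (P - y) (perp n) - fderiv ℝ (gd α δ) (Q - y) (perp n) = _
      rw [gd_deriv hα0 hδ, gd_deriv hα0 hδ, ← wd_sub_right, ← inner_perp_left, perp_perp, inner_neg_left,
        real_inner_comm]
    have hdiv := div_ineq hz.C1 hOo hO hfr (e := perp n) (by rw [norm_perp, hn]) hGc P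
    simp only [hGd] at hdiv
    have hk1 := conv_intble (kernd_contDiff (α := α) hδ).continuous hOo hO P
    have hk2 := conv_intble (kernd_contDiff (α := α) hδ).continuous hOo hO Q
    have e1 : ∫ y in O, - inner ℝ (kernd α δ (P - y) - kernd α δ (Q - y)) n
        = - inner ℝ ((∫ y in O, kernd α δ (P - y)) - ∫ y in O, kernd α δ (Q - y)) n := by
      have e0 := integral_inner (𝕜 := ℝ) (hk1.sub hk2) n
      simp only [Pi.sub_apply] at e0
      rw [integral_neg, ← integral_sub hk1 hk2, real_inner_comm, ← e0]
      simp only [real_inner_comm]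
    rw [e1, abs_neg] at hdiv
    refine hdiv.trans ?_
    have hwd : ∀ s, wd (deriv z s) (perp n) = inner ℝ (deriv z s) n := by
      intro s; rw [inner2]; simp only [wd, perp_0, perp_1]; ring
    simp only [hwd]
    have hcI : Continuous (fun s => |G (P - z s)| * |inner ℝ (deriv z s) n|) :=
      (hGc.continuous.comp (continuous_const.sub hz.cont)).abs.mul (hz.dcont.inner continuous_const).abs
    rw [intervalIntegral.integral_of_le (by positivity), ← integral_Icc_eq_integral_Ioc]
    rw [← ENNReal.ofReal_le_ofReal_iff (by positivity),
      ofReal_integral_eq_lintegral_ofReal hcI.continuousOn.integrableOn_Icc (.of_forall fun s => by positivity)]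
    have hle : ∫⁻ s in Icc 0 (2 * π), ENNReal.ofReal (|G (P - z s)| * |inner ℝ (deriv z s) n|)
        ≤ ∫⁻ s in Icc 0 (2 * π), ENNReal.ofReal ‖P - Q‖ *
          (ENNReal.ofReal (‖P - z s‖ ^ (-(1 + 2 * α)) * |inner ℝ (deriv z s) n|)
          + ENNReal.ofReal (‖Q - z s‖ ^ (-(1 + 2 * α)) * |inner ℝ (deriv z s) n|)) := by
      refine lintegral_mono_ae (ae_restrict_of_ae ?_)
      filter_upwards [hz.ae_ne P, hz.ae_ne Q] with s h1 h2
      rw [← ENNReal.ofReal_add (by positivity) (by positivity), ← ENNReal.ofReal_mul (norm_nonneg _)]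
      apply ENNReal.ofReal_le_ofReal
      have h3 := gd_diff hα0 hδ h1 h2
      rw [show P - z s - (Q - z s) = P - Q by abel] at h3
      have h4 : G (P - z s) = gd α δ (P - z s) - gd α δ (Q - z s) := by
        simp only [hG]; congr 2; abel
      rw [h4, ← add_mul, ← mul_assoc]
      exact mul_le_mul_of_nonneg_right h3 (abs_nonneg _)
    refine hle.trans ?_
    have hm : ∀ x : R2, Measurable (fun s => ENNReal.ofReal (‖x - z s‖ ^ (-(1 + 2 * α)) * |inner ℝ (deriv z s) n|)) := by
      intro x
      have m1 : Measurable (fun s => ‖x - z s‖) := (continuous_const.sub hz.cont).norm.measurable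
      have m2 : Measurable (fun s => |inner ℝ (deriv z s) n|) :=
        (hz.dcont.inner continuous_const).abs.measurable
      exact ((m1.pow_const _).mul m2).ennreal_ofReal
    have hmPQ : Measurable (fun s => ENNReal.ofReal (‖P - z s‖ ^ (-(1 + 2 * α)) * |inner ℝ (deriv z s) n|)
          + ENNReal.ofReal (‖Q - z s‖ ^ (-(1 + 2 * α)) * |inner ℝ (deriv z s) n|)) := (hm P).add (hm Q)
    rw [lintegral_const_mul _ hmPQ, lintegral_add_right _ (hm Q)]
    refine (mul_le_mul_right (add_le_add (hfull c z hz hc P n hn hP) (hfull c z hz hc Q n hn hQ)) _).trans ?_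
    rw [← ENNReal.ofReal_add hC.le hC.le, ← ENNReal.ofReal_mul (norm_nonneg _)]
    apply ENNReal.ofReal_le_ofReal
    apply le_of_eq; ring
  -- pass to the limit
  refine le_of_forall_pos_le_add fun ε hε => ?_
  obtain ⟨δ, hδ, hδ0⟩ := ((kernd_conv_unif hα0 hα hOo hO (max ‖P‖ ‖Q‖) (by linarith : 0 < ε / 2)).and
    self_mem_nhdsWithin).exists
  have h1 := hδ P (le_max_left _ _)
  have h2 := hδ Q (le_max_right _ _)
  have h3 := hreg δ hδ0
  set A := ∫ y in O, kern α (P - y)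
  set B := ∫ y in O, kern α (Q - y)
  set A' := ∫ y in O, kernd α δ (P - y)
  set B' := ∫ y in O, kernd α δ (Q - y)
  have e : inner ℝ (A - B) n = inner ℝ (A' - B') n - inner ℝ (A' - A) n + inner ℝ (B' - B) n := by
    rw [← inner_sub_left, ← inner_add_left]; congr 1; abel
  have h4 := inner_abs_le (A' - A) n
  have h5 := inner_abs_le (B' - B) n
  rw [hn, mul_one] at h4 h5
  rw [e]
  have h6 := abs_add_le (inner ℝ (A' - B') n - inner ℝ (A' - A) n) (inner ℝ (B' - B) n)
  have h7 := abs_sub (inner ℝ (A' - B') n) (inner ℝ (A' - A) n)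
  linarith

lemma angle_est {M γ α c0 ρ0 : ℝ} (hα0 : 0 < α) (hα : α ≤ 1 / 4) (hγ : γ = 2 * α / (1 - 2 * α)) (hM : 0 < M)
    (hc0 : 0 < c0) (hρ0 : 0 < ρ0) (hMρ : M * ρ0 ^ γ ≤ c0 / 2) :
    ∃ C, 0 < C ∧ ∀ (N : ℕ) (z : Fin N → ℝ → R2) (c : Fin N → ℝ), (∀ m, Cv M γ (c m) (z m)) →
      (∀ m, c0 ≤ c m) → (∀ m j, m ≠ j → ∀ x y, z m x ≠ z j y) → ∀ m ξ n, ‖n‖ = 1 →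
      inner ℝ (deriv (z m) ξ) n = 0 →
      ∀ j s, |inner ℝ (deriv (z j) s) n| ≤ C * ‖z m ξ - z j s‖ ^ (2 * α) := by
  have hγ0 : 0 < γ := by rw [hγ]; apply div_pos <;> linarith
  have h12 : 0 < 1 - 2 * α := by linarith
  have hγ2 : γ / (1 + γ) = 2 * α := by
    rw [hγ]; field_simp; ring
  have hγα : 2 * α ≤ γ := by
    rw [hγ, le_div_iff₀ h12]; nlinarith
  obtain ⟨C, hC, hcr⟩ := crossing hγ0 hM hc0 hρ0
  set C2 : ℝ := M * (2 / c0) ^ γ * (2 * M) ^ (γ - 2 * α) with hC2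
  have hC2p : 0 < C2 := by positivity
  refine ⟨C + C2, by positivity, ?_⟩
  intro N z c hz hc hdis m ξ n hn hperp j s
  have hx0 : 0 ≤ ‖z m ξ - z j s‖ ^ (2 * α) := by positivity
  have hp1 : 0 ≤ C * ‖z m ξ - z j s‖ ^ (2 * α) := by positivity
  have hp2 : 0 ≤ C2 * ‖z m ξ - z j s‖ ^ (2 * α) := by positivity
  rw [add_mul]
  by_cases hfar : (∀ x y, |x - ξ| < ρ0 / 2 → |y - s| < ρ0 / 2 → z m x ≠ z j y)
  · have := hcr (c m) (c j) (z m) (z j) (hz m) (hz j) (hc m) ξ s n hn hperp hfar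
    rw [hγ2] at this
    linarith
  · have hmj : m = j := by
      by_contra hne
      exact hfar fun x y _ _ => hdis m j hne x y
    subst hmj
    have hd : distT ξ s < ρ0 := by
      by_contra hge
      push Not at hge
      apply hfar
      intro x y hx hy heq
      have h1 := (hz m).inj _ _ heq
      have h2 := distT_tri ξ s x y
      rw [abs_sub_comm] at hx hy
      linarith
    have h3 := (hz m).holT ξ s
    have h4 := (hz m).chordT (by linarith) (hMρ.trans (by linarith [hc m])) hd.le
    have h5 : distT ξ s ≤ 2 / c0 * ‖z m ξ - z m s‖ := by
      rw [div_mul_eq_mul_div, le_div_iff₀ hc0]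
      have := mul_le_mul_of_nonneg_right (hc m) (distT_nonneg ξ s)
      linarith
    have h6 : ‖z m ξ - z m s‖ ≤ 2 * M := by
      have := norm_sub_le (z m ξ) (z m s)
      linarith [(hz m).bd ξ, (hz m).bd s]
    have h7 : |inner ℝ (deriv (z m) s) n| ≤ M * distT ξ s ^ γ := by
      have e1 : inner ℝ (deriv (z m) s) n = - inner ℝ (deriv (z m) ξ - deriv (z m) s) n := by
        rw [inner_sub_left, hperp]; ring
      rw [e1, abs_neg]
      refine (inner_abs_le _ _).trans ?_
      rw [hn, mul_one]; exact h3
    have h8 : distT ξ s ^ γ ≤ (2 / c0) ^ γ * ‖z m ξ - z m s‖ ^ γ := by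
      rw [← Real.mul_rpow (by positivity) (norm_nonneg _)]
      exact Real.rpow_le_rpow (distT_nonneg _ _) h5 hγ0.le
    have h9 : ‖z m ξ - z m s‖ ^ γ ≤ (2 * M) ^ (γ - 2 * α) * ‖z m ξ - z m s‖ ^ (2 * α) := by
      have e : ‖z m ξ - z m s‖ ^ γ = ‖z m ξ - z m s‖ ^ (γ - 2 * α) * ‖z m ξ - z m s‖ ^ (2 * α) := by
        rw [← Real.rpow_add_of_nonneg (norm_nonneg _) (by linarith) (by linarith)]; congr 1; ring
      rw [e]
      exact mul_le_mul_of_nonneg_right (Real.rpow_le_rpow (norm_nonneg _) h6 (by linarith)) hx0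
    have h10 : M * distT ξ s ^ γ ≤ C2 * ‖z m ξ - z m s‖ ^ (2 * α) := by
      calc M * distT ξ s ^ γ ≤ M * ((2 / c0) ^ γ * ((2 * M) ^ (γ - 2 * α) * ‖z m ξ - z m s‖ ^ (2 * α))) := by
            refine mul_le_mul_of_nonneg_left (h8.trans ?_) hM.le
            exact mul_le_mul_of_nonneg_left h9 (by positivity)
        _ = _ := by rw [hC2]; ring
    linarith

lemma V_est {M γ α c0 ρ0 : ℝ} (hα0 : 0 < α) (hα : α ≤ 1 / 4) (hγ : γ = 2 * α / (1 - 2 * α)) (hM : 0 < M)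
    (hc0 : 0 < c0) (hρ0 : 0 < ρ0) (hMρ : M * ρ0 ^ γ ≤ c0 / 2) (cα : ℝ) {N : ℕ} (θ : Fin N → ℝ) :
    ∃ C, 0 < C ∧ ∀ (z : Fin N → ℝ → R2) (c : Fin N → ℝ) (Ω : Fin N → Set R2), (∀ m, Cv M γ (c m) (z m)) →
      (∀ m, c0 ≤ c m) → (∀ m, IsOpen (Ω m)) → (∀ m, Bornology.IsBounded (Ω m)) →
      (∀ m, frontier (Ω m) ⊆ z m '' Icc 0 (2 * π)) →
      (∀ m j, m ≠ j → ∀ x y, z m x ≠ z j y) → ∀ m j ξ η,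
      inner ℝ (deriv (z m) ξ) (z m ξ - z j η) = 0 → inner ℝ (deriv (z j) η) (z m ξ - z j η) = 0 →
      |inner ℝ (gSQGvel α cα θ Ω (z m ξ) - gSQGvel α cα θ Ω (z j η)) (z m ξ - z j η)|
        ≤ C * ‖z m ξ - z j η‖ ^ 2 := by
  have h12 : 0 < 1 - 2 * α := by linarith
  have hγα : 2 * α < γ := by
    rw [hγ, lt_div_iff₀ h12]; nlinarith
  obtain ⟨C1, hC1, hang⟩ := angle_est hα0 hα hγ hM hc0 hρ0 hMρ
  obtain ⟨C, hC, hvel⟩ := vel1_est hα0 hα hγα hM hc0 hρ0 hMρ hC1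
  refine ⟨|cα| * ∑ m, |θ m| * C + 1, by positivity, ?_⟩
  intro z c Ω hz hc hΩo hΩb hfr hdis m j ξ η hp1 hp2
  set P := z m ξ with hP
  set Q := z j η with hQ
  rcases eq_or_ne (P - Q) 0 with h0 | h0
  · rw [h0]; simp
  have hr : 0 < ‖P - Q‖ := norm_pos_iff.2 h0
  set n : R2 := ‖P - Q‖⁻¹ • (P - Q) with hn
  have hn1 : ‖n‖ = 1 := by rw [hn, norm_smul, norm_inv, norm_norm, inv_mul_cancel₀ hr.ne']
  have hPQ : P - Q = ‖P - Q‖ • n := by rw [hn, smul_smul, mul_inv_cancel₀ hr.ne', one_smul]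
  have hn2 : inner ℝ (deriv (z m) ξ) n = 0 := by rw [hn, inner_smul_right, hp1, mul_zero]
  have hn3 : inner ℝ (deriv (z j) η) n = 0 := by rw [hn, inner_smul_right, hp2, mul_zero]
  have hk : ∀ i, |inner ℝ ((∫ y in Ω i, kern α (P - y)) - ∫ y in Ω i, kern α (Q - y)) n| ≤ C * ‖P - Q‖ :=
    fun i => hvel (c i) (z i) (Ω i) (hz i) (hc i) (hΩo i) (hΩb i) (hfr i) P Q n hn1
      (hang N z c hz hc hdis m ξ n hn1 hn2 i) (hang N z c hz hc hdis j η n hn1 hn3 i)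
  have e1 : gSQGvel α cα θ Ω P - gSQGvel α cα θ Ω Q
      = cα • ∑ i, θ i • ((∫ y in Ω i, kern α (P - y)) - ∫ y in Ω i, kern α (Q - y)) := by
    simp only [gSQGvel, smul_sub, Finset.sum_sub_distrib]
  have e2 : |inner ℝ (gSQGvel α cα θ Ω P - gSQGvel α cα θ Ω Q) n| ≤ |cα| * (∑ i, |θ i| * C) * ‖P - Q‖ := by
    rw [e1, real_inner_smul_left, abs_mul, sum_inner, mul_assoc]
    refine mul_le_mul_of_nonneg_left ?_ (abs_nonneg _)
    refine (Finset.abs_sum_le_sum_abs _ _).trans ?_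
    rw [Finset.sum_mul]
    refine Finset.sum_le_sum fun i _ => ?_
    rw [real_inner_smul_left, abs_mul, mul_assoc]
    exact mul_le_mul_of_nonneg_left (hk i) (abs_nonneg _)
  have e3 : inner ℝ (gSQGvel α cα θ Ω P - gSQGvel α cα θ Ω Q) (P - Q)
      = ‖P - Q‖ * inner ℝ (gSQGvel α cα θ Ω P - gSQGvel α cα θ Ω Q) n := by
    conv_lhs => rw [hPQ]
    rw [real_inner_smul_right]
  rw [e3, abs_mul, abs_of_pos hr]
  have e4 := mul_le_mul_of_nonneg_left e2 hr.le
  have e5 : 0 ≤ ‖P - Q‖ ^ 2 := by positivity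
  linarith

lemma Cv.lift {M γ c : ℝ} {z : ℝ → R2} (h : Cv M γ c z) {Z : ℝ → R2} (hZ : Continuous Z)
    (him : ∀ x, ∃ s, z s = Z x) : ∃ σ : ℝ → ℝ, Continuous σ ∧ ∀ x, z (σ x) = Z x := by
  haveI : Fact (0 < 2 * π) := ⟨by positivity⟩
  have hper : Function.Periodic z (2 * π) := h.per
  set zb : AddCircle (2 * π) → R2 := hper.lift with hzb
  have hzbc : Continuous zb := continuous_quot_lift _ h.cont
  have hinj : Function.Injective zb := by
    intro a b
    induction a using QuotientAddGroup.induction_on with | _ a => ?_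
    induction b using QuotientAddGroup.induction_on with | _ b => ?_
    intro hab
    have hab' : z a = z b := hab
    obtain ⟨k, hk⟩ := distT_zero (h.inj _ _ hab')
    rw [hk]
    have := AddCircle.coe_add (2 * π) b (2 * π * k)
    refine this.trans ?_
    rw [show 2 * π * (k : ℝ) = k • (2 * π) by rw [zsmul_eq_mul]; ring, AddCircle.coe_zsmul,
      AddCircle.coe_period]
    simp
  have hemb := hzbc.isClosedEmbedding hinj
  choose s hs using him
  set Zb : ℝ → AddCircle (2 * π) := fun x => (s x : AddCircle (2 * π)) with hZb
  have hZb1 : ∀ x, zb (Zb x) = Z x := fun x => hs x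
  have hZbc : Continuous Zb := by
    rw [hemb.isInducing.continuous_iff]
    refine hZ.congr fun x => (hZb1 x).symm
  obtain ⟨F, ⟨-, hF⟩, -⟩ := (AddCircle.isCoveringMap_coe (2 * π)).existsUnique_continuousMap_lifts
    (⟨Zb, hZbc⟩ : C(ℝ, AddCircle (2 * π))) 0 (s 0) rfl
  refine ⟨F, F.continuous, fun x => ?_⟩
  have h1 : ((F x : ℝ) : AddCircle (2 * π)) = Zb x := congrFun hF x
  have h2 : zb ((F x : ℝ) : AddCircle (2 * π)) = Z x := by rw [h1, hZb1]
  exact h2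

lemma Cv.lift_deriv {M γ c : ℝ} {z : ℝ → R2} (h : Cv M γ c z) {Z : ℝ → R2} {V : R2} {x : ℝ}
    (hZ : HasDerivAt Z V x) {σ : ℝ → ℝ} (hσ : Continuous σ) (hzσ : ∀ x, z (σ x) = Z x) :
    ∃ m : ℝ, HasDerivAt σ m x ∧ V = m • deriv z (σ x) := by
  set T := deriv z (σ x) with hT
  have hT2 : inner ℝ T T = c ^ 2 := by rw [real_inner_self_eq_norm_sq, hT, h.spd]
  have hc := h.cpos
  have hz1 : HasStrictDerivAt z T (σ x) := h.C1.contDiffAt.hasStrictDerivAt (by norm_num)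
  have hg : HasStrictDerivAt (fun s => inner ℝ T (z s)) (c ^ 2) (σ x) := by
    have := (innerSL ℝ T).hasStrictFDerivAt.comp_hasStrictDerivAt (σ x) hz1
    rw [← hT2]; exact this
  have hc2 : c ^ 2 ≠ 0 := by positivity
  have hli := hg.to_localInverse hc2
  have hlinv : ∀ᶠ s in 𝓝 (σ x), HasStrictDerivAt.localInverse (fun s => inner ℝ T (z s)) _ _ hg hc2
      (inner ℝ T (z s)) = s := HasStrictFDerivAt.eventually_left_inverse _
  have h1 : ∀ᶠ y in 𝓝 x, HasStrictDerivAt.localInverse (fun s => inner ℝ T (z s)) _ _ hg hc2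
      (inner ℝ T (Z y)) = σ y := by
    filter_upwards [hσ.continuousAt.eventually hlinv] with y hy
    rw [← hzσ y]; exact hy
  have h2 : HasDerivAt (fun y => inner ℝ T (Z y)) (inner ℝ T V) x :=
    (innerSL ℝ T).hasFDerivAt.comp_hasDerivAt x hZ
  have h3 := hli.hasDerivAt
  rw [hzσ x] at h3
  have h4 := h3.comp x h2
  have h5 := h4.congr_of_eventuallyEq (h1.mono fun y hy => hy.symm)
  refine ⟨_, h5, ?_⟩
  have h6 : HasDerivAt (fun y => z (σ y)) _ x := (h.hd (σ x)).scomp x h5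
  have h7 : (fun y => z (σ y)) = Z := funext hzσ
  rw [h7] at h6
  exact hZ.unique h6

lemma Cv.cover {M γ c c' : ℝ} {z : ℝ → R2} (h : Cv M γ c z) {Z V : ℝ → R2} (hZ : ∀ x, HasDerivAt Z (V x) x)
    (hV : Continuous V) (hc' : 0 < c') (hVn : ∀ x, ‖V x‖ = c') (hper : ∀ x, Z (x + 2 * π) = Z x)
    (him : ∀ x, ∃ s, z s = Z x) : ∃ (φ : ℝ) (k : ℤ), k ≠ 0 ∧ ∀ x, Z x = z (φ + k * x) := by
  have hc := h.cpos
  have hZc : Continuous Z := continuous_iff_continuousAt.2 fun x => (hZ x).continuousAt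
  obtain ⟨σ, hσ, hzσ⟩ := h.lift hZc him
  choose m hm1 hm2 using fun x => h.lift_deriv (hZ x) hσ hzσ
  have hmc : ∀ x, m x = inner ℝ (V x) (deriv z (σ x)) / c ^ 2 := by
    intro x
    rw [hm2 x, real_inner_smul_left, real_inner_self_eq_norm_sq, h.spd]
    field_simp
  have hmabs : ∀ x, |m x| = c' / c := by
    intro x
    rw [eq_div_iff hc.ne', ← h.spd (σ x), ← Real.norm_eq_abs, ← norm_smul, ← hm2, hVn]
  have hmcont : Continuous m := by
    rw [show m = fun x => inner ℝ (V x) (deriv z (σ x)) / c ^ 2 from funext hmc]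
    exact (hV.inner (h.dcont.comp hσ)).div_const _
  have hmne : ∀ x, m x ≠ 0 := fun x h0 => by
    have := hmabs x
    rw [h0, abs_zero] at this
    have : 0 < c' / c := by positivity
    linarith
  have hconst : ∀ x, m x = m 0 := by
    intro x
    have hsame : 0 < m x * m 0 := by
      by_contra hneg
      push Not at hneg
      have hI : (0:ℝ) ∈ m '' (uIcc x 0) := by
        apply intermediate_value_uIcc hmcont.continuousOn
        rcases le_total 0 (m 0) with h0 | h0
        · have h0' : 0 < m 0 := lt_of_le_of_ne h0 (hmne 0).symm
          have : m x ≤ 0 := by by_contra hh; push Not at hh; linarith [mul_pos hh h0']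
          rw [mem_uIcc]; left; exact ⟨this, h0⟩
        · have h0' : m 0 < 0 := lt_of_le_of_ne h0 (hmne 0)
          have : 0 ≤ m x := by by_contra hh; push Not at hh; linarith [mul_pos_of_neg_of_neg hh h0']
          rw [mem_uIcc]; right; exact ⟨h0, this⟩
      obtain ⟨y, -, hy⟩ := hI
      exact hmne y hy
    have habs : |m x| = |m 0| := by rw [hmabs, hmabs]
    rcases abs_eq_abs.1 habs with h1 | h1
    · exact h1
    · rw [h1] at hsame
      nlinarith [mul_self_nonneg (m 0)]
  have haff : ∀ x, σ x = σ 0 + m 0 * x := by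
    have hd : ∀ x, HasDerivAt (fun y => σ y - m 0 * y) 0 x := by
      intro x
      have := (hm1 x).sub ((hasDerivAt_id x).const_mul (m 0))
      rw [hconst x] at this
      exact HasDerivAt.congr_deriv (f := fun y => σ y - m 0 * y) this (by simp)
    intro x
    have := is_const_of_deriv_eq_zero (fun x => (hd x).differentiableAt) (fun x => (hd x).deriv) x 0
    simp only [mul_zero, sub_zero] at this
    linarith
  obtain ⟨k, hk⟩ : ∃ k : ℤ, σ (0 + 2 * π) = σ 0 + 2 * π * k := by
    apply distT_zero
    apply h.inj
    rw [hzσ, hzσ, hper]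
  rw [haff (0 + 2 * π)] at hk
  have hp := Real.pi_pos
  have hmk : m 0 = k := by
    have : (2 * π) * m 0 = (2 * π) * k := by linarith
    exact mul_left_cancel₀ (by positivity) this
  refine ⟨σ 0, k, ?_, fun x => ?_⟩
  · intro h0; apply hmne 0; rw [hmk, h0]; simp
  · rw [← hzσ, haff, hmk]

def ar (w : ℝ → R2) : ℝ := ∫ ξ in (0:ℝ)..(2 * π), wd (w ξ) (deriv w ξ)

lemma hasDerivAt_wd {f g : ℝ → R2} {f' g' : R2} {x : ℝ} (hf : HasDerivAt f f' x) (hg : HasDerivAt g g' x) :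
    HasDerivAt (fun x => wd (f x) (g x)) (wd f' (g x) + wd (f x) g') x := by
  have h1 : ∀ i, HasDerivAt (fun x => f x i) (f' i) x := fun i =>
    (EuclideanSpace.proj (𝕜 := ℝ) i).hasFDerivAt.comp_hasDerivAt x hf
  have h2 : ∀ i, HasDerivAt (fun x => g x i) (g' i) x := fun i =>
    (EuclideanSpace.proj (𝕜 := ℝ) i).hasFDerivAt.comp_hasDerivAt x hg
  refine (((h1 0).mul (h2 1)).sub ((h1 1).mul (h2 0))).congr_deriv ?_
  simp only [wd]; ring

lemma cwd {X : Type*} [TopologicalSpace X] {f g : X → R2} (hf : Continuous f) (hg : Continuous g) :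
    Continuous (fun x => wd (f x) (g x)) := continuous_wd.comp (hf.prodMk hg)

lemma area_diff {w Z : ℝ → R2} (hw : ContDiff ℝ 1 w) (hZ : ContDiff ℝ 1 Z) (pw : w (2 * π) = w 0)
    (pZ : Z (2 * π) = Z 0) :
    ar w - ar Z = ∫ ξ in (0:ℝ)..(2 * π), wd (w ξ - Z ξ) (deriv w ξ + deriv Z ξ) := by
  have c1 := hw.continuous; have c2 := hZ.continuous
  have c3 := hw.continuous_deriv (by norm_num); have c4 := hZ.continuous_deriv (by norm_num)
  have hd : ∀ x ∈ uIcc 0 (2 * π), HasDerivAt (fun x => wd (Z x) (w x)) (wd (deriv Z x) (w x) + wd (Z x) (deriv w x)) x :=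
    fun x _ => hasDerivAt_wd (hZ.differentiable (by norm_num) x).hasDerivAt (hw.differentiable (by norm_num) x).hasDerivAt
  have hFTC := intervalIntegral.integral_eq_sub_of_hasDerivAt hd
    (((cwd c4 c1).add (cwd c2 c3)).intervalIntegrable _ _)
  simp only [pw, pZ, sub_self] at hFTC
  have e : ar w - ar Z - ∫ ξ in (0:ℝ)..(2 * π), wd (w ξ - Z ξ) (deriv w ξ + deriv Z ξ) = 0 := by
    have i1 : IntervalIntegrable (fun x => wd (w x) (deriv w x) - wd (Z x) (deriv Z x)) volume 0 (2 * π) :=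
      ((cwd c1 c3).sub (cwd c2 c4)).intervalIntegrable _ _
    have i2 : IntervalIntegrable (fun x => wd (w x - Z x) (deriv w x + deriv Z x)) volume 0 (2 * π) :=
      (cwd (c1.sub c2) (c3.add c4)).intervalIntegrable _ _
    rw [ar, ar, ← intervalIntegral.integral_sub ((cwd c1 c3).intervalIntegrable _ _)
      ((cwd c2 c4).intervalIntegrable _ _), ← intervalIntegral.integral_sub i1 i2, ← hFTC]
    congr 1; ext x
    simp only [wd_sub_left, wd_add_right, wd_swap (deriv Z x) (w x)]; ring
  linarith

lemma area_diff_le {w Z : ℝ → R2} (hw : ContDiff ℝ 1 w) (hZ : ContDiff ℝ 1 Z) (pw : w (2 * π) = w 0)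
    (pZ : Z (2 * π) = Z 0) {δ K : ℝ} (hK0 : 0 ≤ K) (h1 : ∀ x, ‖w x - Z x‖ ≤ δ) (h2 : ∀ x, ‖deriv w x‖ ≤ K)
    (h3 : ∀ x, ‖deriv Z x‖ ≤ K) : |ar w - ar Z| ≤ 4 * π * K * δ := by
  rw [area_diff hw hZ pw pZ]
  have := intervalIntegral.norm_integral_le_of_norm_le_const (a := 0) (b := 2 * π) (C := δ * (2 * K))
    (f := fun ξ => wd (w ξ - Z ξ) (deriv w ξ + deriv Z ξ)) (fun x _ => by
      have e := (norm_nonneg _).trans (h1 x)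
      refine (wd_le _ _).trans ?_
      refine mul_le_mul (h1 x) ((norm_add_le _ _).trans (by linarith [h2 x, h3 x])) (norm_nonneg _) e)
  rw [Real.norm_eq_abs, sub_zero, abs_of_pos Real.two_pi_pos] at this
  linarith

lemma ar_cover {z Z : ℝ → R2} (hz : ContDiff ℝ 1 z) (hper : Function.Periodic z (2 * π)) {φ : ℝ} {k : ℤ}
    (hk : k ≠ 0) (hZ : ∀ x, Z x = z (φ + k * x)) : ar Z = k * ar z := by
  have hk' : (k : ℝ) ≠ 0 := by exact_mod_cast hk
  have hZ' : Z = fun x => z (φ + k * x) := funext hZ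
  have hd : ∀ x, deriv Z x = (k : ℝ) • deriv z (φ + k * x) := by
    intro x
    have h1 : HasDerivAt (fun x : ℝ => φ + k * x) k x := by
      simpa using ((hasDerivAt_id x).const_mul (k:ℝ)).const_add φ
    have := (hz.differentiable (by norm_num) (φ + k * x)).hasDerivAt.scomp x h1
    rw [hZ']; exact this.deriv
  have hdper : Function.Periodic (fun x => wd (z x) (deriv z x)) (2 * π) := by
    intro x
    have : deriv z (x + 2 * π) = deriv z x := by
      rw [← deriv_comp_add_const]; congr 1; ext1 y; exact hper y
    simp only [this, hper x]
  have hcont := cwd hz.continuous (hz.continuous_deriv (by norm_num))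
  rw [ar, ar]
  simp only [hd, hZ, wd_smul_right]
  rw [intervalIntegral.integral_const_mul,
    intervalIntegral.integral_comp_add_mul (fun x => wd (z x) (deriv z x)) hk' φ, smul_eq_mul, mul_inv_cancel_left₀ hk']
  have := hdper.intervalIntegral_add_zsmul_eq k φ (fun a b => hcont.intervalIntegrable a b)
  rw [show φ + (k : ℝ) * 0 = φ by ring, show φ + (k : ℝ) * (2 * π) = φ + k • (2 * π) by rw [zsmul_eq_mul], this,
    zsmul_eq_mul, hdper.intervalIntegral_add_eq φ 0, zero_add]

/-- C0 closeness gives C1 closeness. -/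
lemma c0c1 {M γ : ℝ} (hγ : 0 < γ) (hM : 0 < M) {δ : ℝ} (hδ : 0 < δ) : ∃ κ, 0 < κ ∧ ∀ {w Z : ℝ → R2} {x : ℝ} {a b : R2},
    (∀ y, ‖w y - w x - (y - x) • a‖ ≤ M * |y - x| ^ γ * |y - x|) →
    (∀ y, ‖Z y - Z x - (y - x) • b‖ ≤ M * |y - x| ^ γ * |y - x|) →
    (∀ y, ‖w y - Z y‖ ≤ κ) → ‖a - b‖ ≤ δ := by
  set s : ℝ := (δ / (4 * M)) ^ (1 / γ) with hs
  have hs0 : 0 < s := by positivity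
  have hsγ : M * s ^ γ = δ / 4 := by
    rw [hs, ← Real.rpow_mul (by positivity), one_div_mul_cancel hγ.ne', Real.rpow_one]; field_simp
  refine ⟨s * δ / 4, by positivity, ?_⟩
  intro w Z x a b h1 h2 h3
  have e1 := h1 (x + s); have e2 := h2 (x + s)
  rw [show x + s - x = s by ring, abs_of_pos hs0, hsγ] at e1 e2
  have e3 := h3 (x + s); have e4 := h3 x
  have e5 : s • (a - b) = (w (x + s) - Z (x + s)) - (w x - Z x) - (w (x + s) - w x - s • a)
      + (Z (x + s) - Z x - s • b) := by rw [smul_sub]; abel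
  have e6 : ‖s • (a - b)‖ ≤ s * δ / 4 + s * δ / 4 + δ / 4 * s + δ / 4 * s := by
    rw [e5]
    refine (norm_add_le _ _).trans (add_le_add ((norm_sub_le _ _).trans (add_le_add ((norm_sub_le _ _).trans
      (add_le_add e3 e4)) e1)) e2)
  rw [norm_smul, Real.norm_of_nonneg hs0.le] at e6
  have : s * ‖a - b‖ ≤ s * δ := by linarith
  exact le_of_mul_le_mul_left this hs0

lemma sign_const {f : ℝ → ℝ} (hf : Continuous f) (h0 : ∀ x, f x ≠ 0) : (∀ x, 0 < f x) ∨ (∀ x, f x < 0) := by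
  by_contra hcon
  push Not at hcon
  obtain ⟨⟨x, hx⟩, ⟨y, hy⟩⟩ := hcon
  have hI : (0:ℝ) ∈ f '' (uIcc x y) := by
    apply intermediate_value_uIcc hf.continuousOn
    rw [mem_uIcc]; left; exact ⟨hx, hy⟩
  obtain ⟨u, -, hu⟩ := hI
  exact h0 u hu

lemma incr_bd {f f' : ℝ → ℝ} {C r : ℝ} (hf : ∀ x, HasDerivAt f (f' x) x) (hb : ∀ x ∈ Icc (-r) r, C ≤ f' x)
    {x y : ℝ} (hx : x ∈ Icc (-r) r) (hy : y ∈ Icc (-r) r) (hxy : x ≤ y) : C * (y - x) ≤ f y - f x := by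
  refine Convex.mul_sub_le_image_sub_of_le_deriv (convex_Icc (-r) r)
    (fun x _ => (hf x).continuousAt.continuousWithinAt) (fun x _ => (hf x).differentiableAt.differentiableWithinAt)
    (fun x hx => ?_) x hx y hy hxy
  rw [(hf x).deriv]; exact hb x (interior_subset hx)

lemma no_wind {M γ c r δ : ℝ} {z v : ℝ → R2} (hz : Cv M γ c z) (hγ : 0 < γ) {k : ℕ} (hk : 2 ≤ k)
    (hr : 0 < r) (hr1 : r ≤ 1) (hMr : M * r ^ γ ≤ c / 4) (hδ : δ < r * c / 2)
    (hv : ContDiff ℝ 1 v) (hvper : ∀ x, v (x + 2 * π * k) = v x)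
    (hvinj : ∀ x y, v x = v y → ∃ m : ℤ, x = y + 2 * π * k * m)
    (h0 : ∀ x, ‖v x - z x‖ ≤ δ) (h1 : ∀ x, ‖deriv v x - deriv z x‖ ≤ c / 4) : False := by
  have hp := Real.pi_gt_three
  have hc := hz.cpos
  have hvd : ∀ x, HasDerivAt v (deriv v x) x := fun x => (hv.differentiable (by norm_num) x).hasDerivAt
  set G : ℝ → ℝ → ℝ := fun θ x => inner ℝ (deriv z θ) (v (θ + x) - z θ) with hG
  have hGc : Continuous (fun p : ℝ × ℝ => G p.1 p.2) := by
    refine (hz.dcont.comp continuous_fst).inner ?_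
    exact (hv.continuous.comp (continuous_fst.add continuous_snd)).sub (hz.cont.comp continuous_fst)
  have hGd : ∀ θ x, HasDerivAt (G θ) (inner ℝ (deriv z θ) (deriv v (θ + x))) x := by
    intro θ x
    have e1 : HasDerivAt (fun x => v (θ + x) - z θ) (deriv v (θ + x)) x :=
      ((hvd (θ + x)).comp_const_add θ x).sub_const _
    exact (innerSL ℝ (deriv z θ)).hasFDerivAt.comp_hasDerivAt x e1
  have hGb : ∀ θ, ∀ x ∈ Icc (-r) r, c ^ 2 / 2 ≤ inner ℝ (deriv z θ) (deriv v (θ + x)) := by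
    intro θ x hx
    have e1 : deriv v (θ + x) = deriv z θ + (deriv v (θ + x) - deriv z (θ + x)) + (deriv z (θ + x) - deriv z θ) := by
      abel
    rw [e1, inner_add_right, inner_add_right, real_inner_self_eq_norm_sq, hz.spd]
    have e2 := inner_abs_le (deriv z θ) (deriv v (θ + x) - deriv z (θ + x))
    have e3 := inner_abs_le (deriv z θ) (deriv z (θ + x) - deriv z θ)
    rw [hz.spd] at e2 e3
    have e4 := hz.hol (θ + x) θ
    have e5 : |θ + x - θ| ^ γ ≤ r ^ γ := by
      rw [add_sub_cancel_left]
      exact Real.rpow_le_rpow (abs_nonneg _) (abs_le.2 hx) hγ.le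
    have e6 : ‖deriv z (θ + x) - deriv z θ‖ ≤ c / 4 :=
      e4.trans ((mul_le_mul_of_nonneg_left e5 hz.Mpos.le).trans hMr)
    have e7 := mul_le_mul_of_nonneg_left (h1 (θ + x)) hc.le
    have e8 := mul_le_mul_of_nonneg_left e6 hc.le
    have e9 := abs_le.1 e2
    have e10 := abs_le.1 e3
    nlinarith [e9.1, e10.1]
  have hr0 : (0:ℝ) ∈ Icc (-r) r := ⟨by linarith, hr.le⟩
  have hG0 : ∀ θ, |G θ 0| ≤ c * δ := by
    intro θ
    refine (inner_abs_le _ _).trans ?_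
    rw [hz.spd, add_zero]
    exact mul_le_mul_of_nonneg_left (h0 θ) hc.le
  obtain ⟨s, hs, hs1⟩ := zero_cont (S := univ) hGc hr
    (fun θ _ x hx y hy hxy => by
      have := incr_bd (hGd θ) (hGb θ) hx hy hxy.le
      have : 0 < c ^ 2 / 2 * (y - x) := mul_pos (by positivity) (by linarith)
      linarith)
    (fun θ _ => by
      have e1 := incr_bd (hGd θ) (hGb θ) (x := -r) (y := 0) ⟨le_rfl, by linarith⟩ hr0 (by linarith)
      have e2 := abs_le.1 (hG0 θ)
      nlinarith)
    (fun θ _ => by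
      have e1 := incr_bd (hGd θ) (hGb θ) (x := 0) (y := r) hr0 ⟨by linarith, le_rfl⟩ (by linarith)
      have e2 := abs_le.1 (hG0 θ)
      nlinarith)
  have hs2 : Continuous s := continuousOn_univ.1 hs
  have hsr : ∀ θ, s θ ∈ Ioo (-r) r := fun θ => (hs1 θ trivial).1
  have hs0 : ∀ θ, G θ (s θ) = 0 := fun θ => (hs1 θ trivial).2.1
  set D : ℝ → ℝ := fun θ => wd (v (θ + 2 * π + s (θ + 2 * π)) - v (θ + s θ)) (deriv z θ) with hD
  have hDc : Continuous D := by
    refine cwd (Continuous.sub ?_ ?_) hz.dcont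
    · exact hv.continuous.comp (by fun_prop)
    · exact hv.continuous.comp (by fun_prop)
  have hDne : ∀ θ, D θ ≠ 0 := by
    intro θ hDθ
    have hT : deriv z θ ≠ 0 := by
      rw [← norm_pos_iff, hz.spd]; exact hc
    have e1 : v (θ + 2 * π + s (θ + 2 * π)) = v (θ + s θ) := by
      apply eq_of_inner_wd hT
      · have e2 := hs0 (θ + 2 * π)
        have e3 := hs0 θ
        simp only [hG, hz.dper, hz.per, inner_sub_right] at e2 e3
        rw [real_inner_comm, real_inner_comm (deriv z θ) (v (θ + s θ))]; linarith
      · have : wd (v (θ + 2 * π + s (θ + 2 * π)) - v (θ + s θ)) (deriv z θ) = 0 := hDθ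
        rw [wd_sub_left] at this; linarith
    obtain ⟨m, hm⟩ := hvinj _ _ e1
    have e2 := hsr θ
    have e3 := hsr (θ + 2 * π)
    have e4 : s (θ + 2 * π) - s θ = 2 * π * ((k * m - 1 : ℤ) : ℝ) := by push_cast; linarith
    have e5 : (k * m - 1 : ℤ) ≠ 0 := by
      intro h
      have h2 : (k : ℤ) * m = 1 := by linarith
      have := Int.isUnit_iff.1 (IsUnit.of_mul_eq_one _ h2)
      omega
    have e6 : (1:ℝ) ≤ |((k * m - 1 : ℤ) : ℝ)| := by
      rw [← Int.cast_abs]; exact_mod_cast Int.one_le_abs e5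
    have e7 : |s (θ + 2 * π) - s θ| < 2 := by
      rw [abs_lt]; constructor <;> linarith [e2.1, e2.2, e3.1, e3.2]
    rw [e4, abs_mul, abs_of_pos Real.two_pi_pos] at e7
    nlinarith
  have hsk : s (0 + 2 * π * k) = s 0 := by
    apply (hs1 0 trivial).2.2 _ (Ioo_subset_Icc_self (hsr _))
    have e := hs0 (0 + 2 * π * k)
    have e1 := hz.dperk 0 k
    have e2 := hz.perk 0 k
    simp only [Int.cast_natCast] at e1 e2
    simp only [hG] at e ⊢
    rw [e1, e2, show 0 + 2 * π * (k:ℝ) + s (0 + 2 * π * k) = 0 + s (0 + 2 * π * k) + 2 * π * k by ring, hvper] at e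
    exact e
  have hsum : ∑ j ∈ Finset.range k, D (2 * π * j) = 0 := by
    have e1 : ∀ j ∈ Finset.range k, D (2 * π * j) =
        wd (v (2 * π * ((j + 1 : ℕ) : ℝ) + s (2 * π * ((j + 1 : ℕ) : ℝ)))) (deriv z 0)
        - wd (v (2 * π * (j : ℝ) + s (2 * π * (j : ℝ)))) (deriv z 0) := by
      intro j _
      have e2 := hz.dperk 0 j
      simp only [Int.cast_natCast, zero_add] at e2
      simp only [hD, e2, wd_sub_left]
      push_cast
      rw [show 2 * π * (j:ℝ) + 2 * π = 2 * π * (j + 1) by ring]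
    refine (Finset.sum_congr rfl e1).trans ((Finset.sum_range_sub
      (fun j : ℕ => wd (v (2 * π * (j : ℝ) + s (2 * π * (j : ℝ)))) (deriv z 0)) k).trans ?_)
    rw [zero_add] at hsk
    simp only [Nat.cast_zero, mul_zero, zero_add, hsk]
    rw [add_comm (2 * π * (k:ℝ)), hvper, sub_self]
  have hkne : (Finset.range k).Nonempty := ⟨0, Finset.mem_range.2 (by omega)⟩
  rcases sign_const hDc hDne with hpos | hneg
  · have := Finset.sum_pos (s := Finset.range k) (f := fun j : ℕ => D (2 * π * j)) (fun j _ => hpos _) hkne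
    linarith
  · have := Finset.sum_pos (s := Finset.range k) (f := fun j : ℕ => -D (2 * π * j)) (fun j _ => by linarith [hneg (2 * π * j)]) hkne
    rw [Finset.sum_neg_distrib] at this
    linarith

lemma unif_conv {ι : Type*} {U : Filter ι} {w : ι → ℝ → R2} {Z : ℝ → R2} {M : ℝ} (hM : 0 < M)
    (hw : ∀ i x y, ‖w i x - w i y‖ ≤ M * |x - y|) (hZ : ∀ x y, ‖Z x - Z y‖ ≤ M * |x - y|)
    (hwp : ∀ i, Function.Periodic (w i) (2 * π)) (hZp : Function.Periodic Z (2 * π))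
    (hlim : ∀ x, Tendsto (fun i => w i x) U (𝓝 (Z x))) {ε : ℝ} (hε : 0 < ε) :
    ∀ᶠ i in U, ∀ x, ‖w i x - Z x‖ ≤ ε := by
  have key : ∀ᶠ i in U, ∀ x ∈ Icc 0 (2 * π), ‖w i x - Z x‖ ≤ ε := by
    refine isCompact_Icc.induction_on (p := fun s => ∀ᶠ i in U, ∀ x ∈ s, ‖w i x - Z x‖ ≤ ε) ?_ ?_ ?_ ?_
    · simp
    · intro s t hst ht
      filter_upwards [ht] with i hi x hx using hi x (hst hx)
    · intro s t hs ht
      filter_upwards [hs, ht] with i h1 h2 x hx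
      exact hx.elim (h1 x) (h2 x)
    · intro x _
      refine ⟨Metric.ball x (ε / (4 * M)), mem_nhdsWithin_of_mem_nhds (Metric.ball_mem_nhds _ (by positivity)), ?_⟩
      have := (tendsto_iff_norm_sub_tendsto_zero.1 (hlim x)).eventually_lt_const (by positivity : 0 < ε / 2)
      filter_upwards [this] with i hi y hy
      rw [Metric.mem_ball, Real.dist_eq, lt_div_iff₀ (by positivity)] at hy
      have e1 := hw i y x
      have e2 := hZ x y
      rw [abs_sub_comm x y] at e2
      have e3 : w i y - Z y = (w i y - w i x) + (w i x - Z x) + (Z x - Z y) := by abel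
      have e4 : ‖w i y - Z y‖ ≤ ‖w i y - w i x‖ + ‖w i x - Z x‖ + ‖Z x - Z y‖ := by
        rw [e3]; exact norm_add₃_le
      linarith
  filter_upwards [key] with i hi x
  obtain ⟨k, hk⟩ := exists_rep x
  have e1 : w i (x + 2 * π * k) = w i x := by
    have := (hwp i).int_mul k x; rwa [mul_comm]
  have e2 : Z (x + 2 * π * k) = Z x := by
    have := hZp.int_mul k x; rwa [mul_comm]
  rw [← e1, ← e2]
  exact hi _ (Ico_subset_Icc_self hk)

lemma S_lem {M γ c : ℝ} {z : ℝ → R2} (hγ : 0 < γ) (hz : Cv M γ c z) (hA : 0 < ar z) {δ : ℝ} (hδ : 0 < δ) :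
    ∃ κ > 0, ∀ (c' : ℝ) (w : ℝ → R2), Cv M γ c' w → 0 < ar w → (∀ η, ∃ ξ, ‖w η - z ξ‖ ≤ κ) →
      (∀ ξ, ∃ η, ‖z ξ - w η‖ ≤ κ) → ∃ φ, ∀ η, ‖w η - z (η + φ)‖ ≤ δ := by
  by_contra hcon
  push Not at hcon
  have hM := hz.Mpos
  have hc := hz.cpos
  choose c' w hw hwA hw1 hw2 hw3 using fun n : ℕ => hcon (1 / ((n : ℝ) + 1)) (by positivity)
  set U : Ultrafilter ℕ := Filter.hyperfilter ℕ with hU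
  have hU0 : Tendsto (fun n : ℕ => 1 / ((n : ℝ) + 1)) U (𝓝 0) :=
    tendsto_one_div_add_atTop_nhds_zero_nat.mono_left Nat.hyperfilter_le_atTop
  have hlimE : ∀ f : ℕ → R2, (∀ n, ‖f n‖ ≤ M) → ∃ a, Tendsto f U (𝓝 a) := by
    intro f hf
    obtain ⟨a, -, ha⟩ := (isCompact_closedBall (0 : R2) M).ultrafilter_le_nhds (U.map f) (by
      rw [Ultrafilter.coe_map, le_principal_iff, mem_map]
      refine univ_mem' fun n => ?_
      show f n ∈ Metric.closedBall 0 M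
      rw [mem_closedBall_zero_iff]; exact hf n)
    exact ⟨a, ha⟩
  choose Z hZ using fun η => hlimE (fun n => w n η) (fun n => (hw n).bd η)
  choose V hV using fun η => hlimE (fun n => deriv (w n) η) (fun n => by rw [(hw n).spd]; exact (hw n).cM)
  have hc'lim : ∀ η, Tendsto c' U (𝓝 ‖V η‖) := by
    intro η
    refine (hV η).norm.congr fun n => (hw n).spd η
  -- speed lower bound
  set d0 : ℝ := ‖z 0 - z π‖ with hd0
  have hd0p : 0 < d0 := by
    rw [hd0, norm_pos_iff, sub_ne_zero]
    intro h
    have h1 := hz.inj _ _ h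
    rw [distT_eq_abs (by rw [zero_sub, abs_neg, abs_of_pos Real.pi_pos]), zero_sub, abs_neg, abs_of_pos Real.pi_pos] at h1
    linarith [Real.pi_pos]
  have hlow : ∀ n : ℕ, d0 ≤ 2 * (1 / ((n : ℝ) + 1)) + c' n * π := by
    intro n
    obtain ⟨η1, h1⟩ := hw2 n 0
    obtain ⟨η2, h2⟩ := hw2 n π
    obtain ⟨k, hk, hk2⟩ := distT_exists η1 η2
    have h3 := (hw n).lip (η1 + 2 * π * k) η2
    rw [show η1 + 2 * π * k - η2 = η1 - η2 + 2 * π * k by ring, ← hk, (hw n).perk] at h3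
    have h4 := mul_le_mul_of_nonneg_left hk2 (hw n).cpos.le
    have e : z 0 - z π = (z 0 - w n η1) + (w n η1 - w n η2) - (z π - w n η2) := by abel
    have h5 : d0 ≤ ‖z 0 - w n η1‖ + ‖w n η1 - w n η2‖ + ‖z π - w n η2‖ := by
      rw [hd0, e]; exact (norm_sub_le _ _).trans (add_le_add (norm_add_le _ _) le_rfl)
    linarith
  set cc := ‖V 0‖ with hcc
  have hVn : ∀ x, ‖V x‖ = cc := fun x => tendsto_nhds_unique (hc'lim x) (hc'lim 0)
  have hccp : 0 < cc := by
    have h1 : Tendsto (fun n : ℕ => 2 * (1 / ((n : ℝ) + 1)) + c' n * π) U (𝓝 (2 * 0 + cc * π)) :=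
      (hU0.const_mul 2).add ((hc'lim 0).mul_const π)
    have h2 := ge_of_tendsto' h1 hlow
    have h3 : 0 < cc * π := by linarith
    exact (pos_iff_pos_of_mul_pos h3).2 Real.pi_pos
  have htay : ∀ x y, ‖Z y - Z x - (y - x) • V x‖ ≤ M * |y - x| ^ γ * |y - x| := by
    intro x y
    refine le_of_tendsto (((hZ y).sub (hZ x)).sub ((hV x).const_smul (y - x))).norm (.of_forall fun n => ?_)
    exact (hw n).taylor hγ.le x y
  have hZlip : ∀ x y, ‖Z x - Z y‖ ≤ M * |x - y| := fun x y =>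
    le_of_tendsto ((hZ x).sub (hZ y)).norm (.of_forall fun n => (hw n).lipM x y)
  have hVhol : ∀ x y, ‖V x - V y‖ ≤ M * |x - y| ^ γ := fun x y =>
    le_of_tendsto ((hV x).sub (hV y)).norm (.of_forall fun n => (hw n).hol x y)
  have hZper : ∀ x, Z (x + 2 * π) = Z x := fun x =>
    tendsto_nhds_unique ((hZ (x + 2 * π)).congr fun n => (hw n).per x) (hZ x)
  have hrp : Tendsto (fun u : ℝ => M * |u| ^ γ) (𝓝 0) (𝓝 0) := by
    have : Continuous (fun u : ℝ => M * |u| ^ γ) :=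
      (continuous_abs.rpow_const fun _ => Or.inr hγ.le).const_mul M
    have h := this.tendsto 0
    simpa [Real.zero_rpow hγ.ne'] using h
  have hrp' : ∀ x : ℝ, Tendsto (fun y : ℝ => M * |y - x| ^ γ) (𝓝 x) (𝓝 0) := by
    intro x
    refine hrp.comp ?_
    have : Tendsto (fun y : ℝ => y - x) (𝓝 x) (𝓝 (x - x)) := (continuous_id.sub continuous_const).tendsto x
    rwa [sub_self] at this
  have hZd : ∀ x, HasDerivAt Z (V x) x := by
    intro x
    rw [hasDerivAt_iff_isLittleO, Asymptotics.isLittleO_iff]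
    intro ε hε
    filter_upwards [(hrp' x).eventually_lt_const hε] with y hy
    refine (htay x y).trans ?_
    rw [Real.norm_eq_abs]
    exact mul_le_mul_of_nonneg_right hy.le (abs_nonneg _)
  have hVc : Continuous V := by
    rw [continuous_iff_continuousAt]
    intro x
    rw [ContinuousAt, tendsto_iff_norm_sub_tendsto_zero]
    exact squeeze_zero (fun _ => norm_nonneg _) (fun y => hVhol y x) (hrp' x)
  have hrange : IsClosed (z '' Icc 0 (2 * π)) := (isCompact_Icc.image hz.cont).isClosed
  have him : ∀ x, ∃ s, z s = Z x := by
    intro x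
    choose ξ hξ using fun n => hw1 n x
    have h1 : Tendsto (fun n => z (ξ n)) U (𝓝 (Z x)) := by
      have h2 : Tendsto (fun n => w n x - z (ξ n)) U (𝓝 0) :=
        squeeze_zero_norm (fun n => hξ n) hU0
      have := (hZ x).sub h2
      simpa using this
    have h3 : Z x ∈ z '' Icc 0 (2 * π) := by
      refine hrange.mem_of_tendsto h1 (.of_forall fun n => ?_)
      obtain ⟨k, hk⟩ := exists_rep (ξ n)
      exact ⟨_, Ico_subset_Icc_self hk, hz.perk _ _⟩
    obtain ⟨s, -, hs⟩ := h3
    exact ⟨s, hs⟩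
  obtain ⟨φ, k, hk0, hZk⟩ := hz.cover hZd hVc hccp hVn hZper him
  have hZC1 : ContDiff ℝ 1 Z := by
    rw [show Z = fun x => z (φ + k * x) from funext hZk]
    exact hz.C1.comp (by fun_prop)
  have hZderiv : ∀ x, deriv Z x = V x := fun x => (hZd x).deriv
  have hccM : cc ≤ M := by
    rw [← hVn 0]; exact le_of_tendsto (hc'lim 0) (.of_forall fun n => (hw n).cM)
  have hunif : ∀ ε > 0, ∀ᶠ n in (U : Filter ℕ), ∀ x, ‖w n x - Z x‖ ≤ ε := fun ε hε =>
    unif_conv hM (fun n => (hw n).lipM) hZlip (fun n => (hw n).per) hZper hZ hε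
  have har : ar Z = k * ar z := ar_cover hz.C1 hz.per hk0 hZk
  have hkpos : 0 < k := by
    by_contra hneg
    push Not at hneg
    have hk1 : k ≤ -1 := by omega
    have hk2 : (k : ℝ) ≤ -1 := by exact_mod_cast hk1
    have h1 : ar Z < 0 := by rw [har]; nlinarith
    obtain ⟨n, hn⟩ := (hunif (-ar Z / (8 * π * M)) (by
      apply div_pos <;> [linarith; positivity])).exists
    have h2 := area_diff_le (hw n).C1 hZC1 (by simpa using (hw n).per 0) (by simpa using hZper 0) hM.le hn
      (fun x => by rw [(hw n).spd]; exact (hw n).cM) (fun x => by rw [hZderiv, hVn]; exact hccM)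
    have h3 : 4 * π * M * (-ar Z / (8 * π * M)) = -ar Z / 2 := by
      have := Real.pi_pos.ne'
      field_simp; ring
    rw [h3] at h2
    have := (abs_le.1 h2).2
    linarith [hwA n]
  obtain ⟨kn, rfl⟩ : ∃ kn : ℕ, k = kn := ⟨k.toNat, by omega⟩
  have hkn1 : 1 ≤ kn := by omega
  have hknR : (1:ℝ) ≤ kn := by exact_mod_cast hkn1
  simp only [Int.cast_natCast] at hZk
  rcases hkn1.eq_or_lt with hk1 | hk2
  · obtain ⟨n, hn⟩ := (hunif δ hδ).exists
    obtain ⟨η, hη⟩ := hw3 n φ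
    have := hn η
    rw [hZk, ← hk1, Nat.cast_one, one_mul, add_comm] at this
    linarith
  · obtain ⟨κ, hκ, hκ1⟩ := c0c1 hγ hM (by positivity : 0 < c / 4)
    set r : ℝ := min 1 ((c / (4 * M)) ^ (1 / γ)) with hr
    have hrp : 0 < r := by positivity
    have hMr : M * r ^ γ ≤ c / 4 := by
      have h1 : r ^ γ ≤ ((c / (4 * M)) ^ (1 / γ)) ^ γ := Real.rpow_le_rpow hrp.le (min_le_right _ _) hγ.le
      rw [← Real.rpow_mul (by positivity), one_div_mul_cancel hγ.ne', Real.rpow_one] at h1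
      calc M * r ^ γ ≤ M * (c / (4 * M)) := by gcongr
        _ = c / 4 := by field_simp
    obtain ⟨n, hn⟩ := (hunif (min κ (r * c / 4)) (by positivity)).exists
    have hkne : (kn : ℝ) ≠ 0 := by positivity
    have hderv : ∀ x, deriv (fun x => w n ((x - φ) / kn)) x = (1 / (kn : ℝ)) • deriv (w n) ((x - φ) / kn) := by
      intro x
      have e1 : HasDerivAt (fun x : ℝ => (x - φ) / kn) (1 / (kn:ℝ)) x :=
        ((hasDerivAt_id x).sub_const φ).div_const _
      exact (((hw n).hd ((x - φ) / kn)).scomp x e1).deriv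
    have hback : ∀ x, Z ((x - φ) / kn) = z x := by
      intro x; rw [hZk]; congr 1; field_simp; ring
    have hVk : ∀ x, V ((x - φ) / kn) = (kn : ℝ) • deriv z x := by
      intro x
      have e1 : HasDerivAt (fun x : ℝ => φ + kn * x) (kn:ℝ) ((x - φ) / kn) := by
        simpa using ((hasDerivAt_id ((x - φ) / kn)).const_mul (kn:ℝ)).const_add φ
      have e2 := (hz.hd (φ + kn * ((x - φ) / kn))).scomp ((x - φ) / kn) e1
      have e3 : HasDerivAt Z _ ((x - φ) / kn) := e2.congr_of_eventuallyEq (.of_forall fun y => hZk y)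
      rw [(hZd _).unique e3]
      congr 2; field_simp; ring
    refine no_wind (v := fun x => w n ((x - φ) / kn)) (δ := r * c / 4) hz hγ (k := kn) hk2 hrp (min_le_left _ _) hMr ?_ ?_ ?_ ?_ ?_ ?_
    · have : 0 < r * c := by positivity
      linarith
    · exact (hw n).C1.comp (by fun_prop)
    · intro x
      show w n ((x + 2 * π * kn - φ) / kn) = _
      rw [show (x + 2 * π * kn - φ) / kn = (x - φ) / kn + 2 * π by field_simp; ring]
      exact (hw n).per _
    · intro x y hxy
      obtain ⟨m, hm⟩ := distT_zero ((hw n).inj _ _ hxy)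
      refine ⟨m, ?_⟩
      field_simp at hm
      linarith
    · intro x
      have := hn ((x - φ) / kn)
      rw [hback] at this
      exact this.trans (min_le_right _ _)
    · intro x
      have e1 := hκ1 (fun y => (hw n).taylor hγ.le ((x - φ) / kn) y) (fun y => htay ((x - φ) / kn) y)
        (fun y => (hn y).trans (min_le_left _ _))
      rw [hderv, show deriv z x = (1 / (kn : ℝ)) • V ((x - φ) / kn) by
        rw [hVk, smul_smul, one_div_mul_cancel hkne, one_smul], ← smul_sub, norm_smul, Real.norm_of_nonneg (by positivity)]
      have e2 : 1 / (kn : ℝ) ≤ 1 := by rw [div_le_one (by positivity)]; exact hknR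
      calc _ ≤ 1 * ‖deriv (w n) ((x - φ) / kn) - V ((x - φ) / kn)‖ := mul_le_mul_of_nonneg_right e2 (norm_nonneg _)
        _ ≤ _ := by rw [one_mul]; exact e1

lemma implicit1 {F Fy : ℝ → ℝ → ℝ} {ξ : ℝ → ℝ} {x0 a : ℝ} (hFy : ∀ x y, HasDerivAt (F x) (Fy x y) y)
    (hFyc : Continuous (fun p : ℝ × ℝ => Fy p.1 p.2)) (hFx : HasDerivAt (fun x => F x (ξ x0)) a x0)
    (hξ : Continuous ξ) (h0 : ∀ x, F x (ξ x) = 0) (hne : Fy x0 (ξ x0) ≠ 0) :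
    HasDerivAt ξ (-a / Fy x0 (ξ x0)) x0 := by
  have hmv : ∀ x, ∃ c ∈ uIcc (ξ x0) (ξ x), F x (ξ x) - F x (ξ x0) = Fy x c * (ξ x - ξ x0) := by
    intro x
    have hcont : ContinuousOn (F x) univ := fun y _ => (hFy x y).continuousAt.continuousWithinAt
    rcases lt_trichotomy (ξ x0) (ξ x) with h | h | h
    · obtain ⟨c, hc, hc1⟩ := exists_hasDerivAt_eq_slope (F x) (Fy x) h (hcont.mono (subset_univ _)) (fun y _ => hFy x y)
      refine ⟨c, ?_, ?_⟩
      · rw [uIcc_of_le h.le]; exact Ioo_subset_Icc_self hc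
      · rw [hc1, div_mul_cancel₀]; linarith
    · exact ⟨ξ x0, left_mem_uIcc, by rw [h]; ring⟩
    · obtain ⟨c, hc, hc1⟩ := exists_hasDerivAt_eq_slope (F x) (Fy x) h (hcont.mono (subset_univ _)) (fun y _ => hFy x y)
      refine ⟨c, ?_, ?_⟩
      · rw [uIcc_of_ge h.le]; exact Ioo_subset_Icc_self hc
      · have : ξ x0 - ξ x ≠ 0 := by linarith
        rw [hc1]; field_simp; ring
  choose c hc hc1 using hmv
  have hclim : Tendsto c (𝓝 x0) (𝓝 (ξ x0)) := by
    rw [tendsto_iff_norm_sub_tendsto_zero]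
    have h1 : Tendsto (fun x => ‖ξ x - ξ x0‖) (𝓝 x0) (𝓝 0) :=
      tendsto_iff_norm_sub_tendsto_zero.1 hξ.continuousAt
    refine squeeze_zero (fun _ => norm_nonneg _) (fun x => ?_) h1
    rw [Real.norm_eq_abs, Real.norm_eq_abs]
    exact abs_sub_left_of_mem_uIcc (hc x)
  have hq : Tendsto (fun x => Fy x (c x)) (𝓝 x0) (𝓝 (Fy x0 (ξ x0))) :=
    (hFyc.tendsto (x0, ξ x0)).comp (tendsto_id.prodMk_nhds hclim)
  rw [hasDerivAt_iff_tendsto_slope] at hFx ⊢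
  have hlim := hFx.neg.div (hq.mono_left nhdsWithin_le_nhds) hne
  refine hlim.congr' ?_
  have hev : ∀ᶠ x in 𝓝[≠] x0, Fy x (c x) ≠ 0 := (hq.mono_left nhdsWithin_le_nhds).eventually_ne hne
  filter_upwards [hev, self_mem_nhdsWithin] with x hx1 hx2
  have hx3 : x - x0 ≠ 0 := sub_ne_zero.2 hx2
  have h1 := hc1 x
  rw [h0 x] at h1
  show -slope (fun x => F x (ξ x0)) x0 x / Fy x (c x) = slope ξ x0 x
  rw [slope_def_field, slope_def_field, h0 x0]
  field_simp
  linarith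

/-- chord tangent -/
def chT (z : ℝ → R2) (b x : ℝ) : R2 := (1 / (2 * b)) • (z (x + b) - z (x - b))

lemma chT_hd {M γ c : ℝ} {z : ℝ → R2} (hz : Cv M γ c z) (b x : ℝ) :
    HasDerivAt (chT z b) ((1 / (2 * b)) • (deriv z (x + b) - deriv z (x - b))) x :=
  HasDerivAt.congr_deriv (f := chT z b)
    ((((hz.hd (x + b)).comp_add_const x b).sub ((hz.hd (x - b)).comp_sub_const x b)).const_smul (1 / (2 * b))) rfl

lemma chT_close {M γ c : ℝ} {z : ℝ → R2} (hz : Cv M γ c z) (hγ : 0 < γ) {b : ℝ} (hb : 0 < b) (x : ℝ) :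
    ‖chT z b x - deriv z x‖ ≤ M * b ^ γ := by
  have h1 := hz.taylor hγ.le x (x + b)
  have h2 := hz.taylor hγ.le x (x - b)
  rw [show x + b - x = b by ring, abs_of_pos hb] at h1
  rw [show x - b - x = -b by ring, abs_neg, abs_of_pos hb] at h2
  have e : chT z b x - deriv z x = (1 / (2 * b)) • ((z (x + b) - z x - b • deriv z x) - (z (x - b) - z x - (-b) • deriv z x)) := by
    have : deriv z x = (1 / (2 * b)) • ((2 * b) • deriv z x) := by
      rw [smul_smul, one_div_mul_cancel (by positivity), one_smul]
    rw [chT]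
    conv_lhs => rw [this]
    rw [← smul_sub]
    congr 1
    rw [neg_smul, two_mul, add_smul]; abel
  rw [e, norm_smul, Real.norm_of_nonneg (by positivity), one_div, inv_mul_le_iff₀ (by positivity)]
  refine (norm_sub_le _ _).trans ?_
  linarith

lemma chT_norm {M γ c : ℝ} {z : ℝ → R2} (hz : Cv M γ c z) {b : ℝ} (hb : 0 < b) (x : ℝ) :
    ‖chT z b x‖ ≤ c := by
  have h1 := hz.lip (x + b) (x - b)
  rw [show x + b - (x - b) = 2 * b by ring, abs_of_pos (by positivity)] at h1
  rw [chT, norm_smul, Real.norm_of_nonneg (by positivity), one_div, inv_mul_le_iff₀ (by positivity)]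
  linarith

lemma chT_dnorm {M γ c : ℝ} {z : ℝ → R2} (hz : Cv M γ c z) {b : ℝ} (hb : 0 < b) (x : ℝ) :
    ‖(1 / (2 * b)) • (deriv z (x + b) - deriv z (x - b))‖ ≤ c / b := by
  have h1 := norm_sub_le (deriv z (x + b)) (deriv z (x - b))
  rw [hz.spd, hz.spd] at h1
  rw [norm_smul, Real.norm_of_nonneg (by positivity), one_div, inv_mul_le_iff₀ (by positivity)]
  refine h1.trans (le_of_eq ?_)
  field_simp; ring

lemma ar_reparam {z : ℝ → R2} (hz : ContDiff ℝ 1 z) (hper : Function.Periodic z (2 * π)) {ξ ξ' : ℝ → ℝ}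
    (hξ : ∀ x, HasDerivAt ξ (ξ' x) x) (hξc : Continuous ξ') (hξp : ξ (2 * π) = ξ 0 + 2 * π) :
    ar (fun x => z (ξ x)) = ar z := by
  have hd : ∀ x, deriv (fun x => z (ξ x)) x = ξ' x • deriv z (ξ x) := fun x =>
    ((hz.differentiable (by norm_num) (ξ x)).hasDerivAt.scomp x (hξ x)).deriv
  have hdper : Function.Periodic (fun x => wd (z x) (deriv z x)) (2 * π) := by
    intro x
    have : deriv z (x + 2 * π) = deriv z x := by
      rw [← deriv_comp_add_const]; congr 1; ext1 y; exact hper y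
    simp only [this, hper x]
  have hcont := cwd hz.continuous (hz.continuous_deriv (by norm_num))
  rw [ar, ar]
  simp only [hd, wd_smul_right]
  have := intervalIntegral.integral_comp_mul_deriv (a := 0) (b := 2 * π) (f := ξ) (f' := ξ')
    (g := fun x => wd (z x) (deriv z x)) (fun x _ => hξ x) hξc.continuousOn hcont
  rw [hξp, hdper.intervalIntegral_add_eq (ξ 0) 0, zero_add] at this
  rw [← this]
  congr 1; ext x; simp only [Function.comp]; ring

set_option maxHeartbeats 800000 in
lemma area_lem {M γ c K : ℝ} {z : ℝ → R2} (hγ : 0 < γ) (hz : Cv M γ c z) (hK : 0 < K) :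
    ∃ δ0 > 0, ∀ (w : ℝ → R2) (ε : ℝ), ContDiff ℝ 1 w → Function.Periodic w (2 * π) →
      (∀ x, ‖deriv w x‖ ≤ K) → (∀ x, ‖w x - z x‖ ≤ δ0) → 0 ≤ ε → (∀ x, ∃ s, ‖w x - z s‖ ≤ ε) →
      |ar w - ar z| ≤ 40 * π * K * ε := by
  have hM := hz.Mpos
  have hc := hz.cpos
  set b : ℝ := (c / (4 * M)) ^ (1 / γ) with hb
  have hb0 : 0 < b := by positivity
  have hMb : M * b ^ γ ≤ c / 4 := by
    rw [hb, ← Real.rpow_mul (by positivity), one_div_mul_cancel hγ.ne', Real.rpow_one]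
    apply le_of_eq; field_simp
  set r : ℝ := b / 8 with hr
  have hr0 : 0 < r := by positivity
  obtain ⟨κ, hκ, hκ1⟩ := hz.unif_inj hr0
  set δ0 : ℝ := min (κ / 4) (min (c * b / 8) (r * c / 4)) with hδ0
  have hδp : 0 < δ0 := by positivity
  have hδ1 : δ0 ≤ κ / 4 := min_le_left _ _
  have hδ2 : δ0 ≤ c * b / 8 := (min_le_right _ _).trans (min_le_left _ _)
  have hδ3 : δ0 ≤ r * c / 4 := (min_le_right _ _).trans (min_le_right _ _)
  refine ⟨δ0, hδp, ?_⟩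
  intro w ε hw hwp hwK hwz hε hnear
  have hwd : ∀ x, HasDerivAt w (deriv w x) x := fun x => (hw.differentiable (by norm_num) x).hasDerivAt
  have hwdc := hw.continuous_deriv (by norm_num)
  set T := chT z b with hT
  set T' : ℝ → R2 := fun x => (1 / (2 * b)) • (deriv z (x + b) - deriv z (x - b)) with hT'
  have hTd : ∀ x, HasDerivAt T (T' x) x := chT_hd hz b
  have hTn : ∀ x, ‖T x‖ ≤ c := chT_norm hz hb0
  have hT'n : ∀ x, ‖T' x‖ ≤ c / b := chT_dnorm hz hb0
  have hTc : Continuous T := continuous_iff_continuousAt.2 fun x => (hTd x).continuousAt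
  have hT'c : Continuous T' := by
    have := hz.dcont
    rw [hT']; fun_prop
  have hTz : ∀ x, c ^ 2 * (3 / 4) ≤ inner ℝ (deriv z x) (T x) := by
    intro x
    have e1 : T x = deriv z x + (T x - deriv z x) := by abel
    rw [e1, inner_add_right, real_inner_self_eq_norm_sq, hz.spd]
    have e2 := inner_abs_le (deriv z x) (T x - deriv z x)
    rw [hz.spd] at e2
    have e3 := mul_le_mul_of_nonneg_left ((chT_close hz hγ hb0 x).trans hMb) hc.le
    have e4 := (abs_le.1 e2).1
    simp only [← hT] at e3
    linarith
  -- the function F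
  set F : ℝ → ℝ → ℝ := fun η ξ => inner ℝ (z ξ - w η) (T ξ) with hF
  set Fy : ℝ → ℝ → ℝ := fun η ξ => inner ℝ (z ξ - w η) (T' ξ) + inner ℝ (deriv z ξ) (T ξ) with hFy
  have hFd : ∀ η ξ, HasDerivAt (F η) (Fy η ξ) ξ := fun η ξ =>
    ((hz.hd ξ).sub_const (w η)).inner ℝ (hTd ξ)
  have hFyc : Continuous (fun p : ℝ × ℝ => Fy p.1 p.2) := by
    have c1 : Continuous (fun p : ℝ × ℝ => z p.2 - w p.1) :=
      (hz.cont.comp continuous_snd).sub (hw.continuous.comp continuous_fst)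
    exact (c1.inner (hT'c.comp continuous_snd)).add
      ((hz.dcont.comp continuous_snd).inner (hTc.comp continuous_snd))
  have hFyb : ∀ η ξ, |ξ - η| ≤ r → c ^ 2 / 2 ≤ Fy η ξ := by
    intro η ξ h
    have e1 := inner_abs_le (z ξ - w η) (T' ξ)
    have e2 : ‖z ξ - w η‖ ≤ c * r + δ0 := by
      have e3 : z ξ - w η = (z ξ - z η) - (w η - z η) := by abel
      rw [e3]
      refine (norm_sub_le _ _).trans (add_le_add ((hz.lip ξ η).trans ?_) (hwz η))
      exact mul_le_mul_of_nonneg_left h hc.le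
    have e4 : ‖z ξ - w η‖ * ‖T' ξ‖ ≤ (c * b / 4) * (c / b) := by
      refine mul_le_mul (e2.trans ?_) (hT'n ξ) (norm_nonneg _) (by positivity)
      rw [hr]; linarith
    have e5 : (c * b / 4) * (c / b) = c ^ 2 / 4 := by field_simp
    have e6 := (abs_le.1 (e1.trans e4)).1
    rw [e5] at e6
    have e7 := hTz ξ
    simp only [hFy]
    linarith
  set G : ℝ → ℝ → ℝ := fun η x => F η (η + x) with hG
  have hGc : Continuous (fun p : ℝ × ℝ => G p.1 p.2) := by
    have c0 : Continuous (fun p : ℝ × ℝ => p.1 + p.2) := continuous_fst.add continuous_snd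
    exact ((hz.cont.comp c0).sub (hw.continuous.comp continuous_fst)).inner (hTc.comp c0)
  have hGd : ∀ η x, HasDerivAt (G η) (Fy η (η + x)) x := fun η x => (hFd η (η + x)).comp_const_add η x
  have hGb : ∀ η, ∀ x ∈ Icc (-r) r, c ^ 2 / 2 ≤ Fy η (η + x) := fun η x hx =>
    hFyb η _ (by rw [add_sub_cancel_left]; exact abs_le.2 hx)
  have hr1 : (0:ℝ) ∈ Icc (-r) r := ⟨by linarith, hr0.le⟩
  have hG0 : ∀ η, |G η 0| ≤ δ0 * c := by
    intro η
    refine (inner_abs_le _ _).trans ?_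
    rw [add_zero, norm_sub_rev]
    exact mul_le_mul (hwz η) (hTn η) (norm_nonneg _) hδp.le
  have hc2 : 0 < c ^ 2 / 2 := by positivity
  have hδc : δ0 * c < c ^ 2 / 2 * r := by
    have e1 := mul_le_mul_of_nonneg_right hδ3 hc.le
    have e2 : 0 < r * c * c := by positivity
    nlinarith
  obtain ⟨s, hs, hs1⟩ := zero_cont (S := univ) hGc hr0
    (fun η _ x hx y hy hxy => by
      have := incr_bd (hGd η) (hGb η) hx hy hxy.le
      have : 0 < c ^ 2 / 2 * (y - x) := mul_pos hc2 (by linarith)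
      linarith)
    (fun η _ => by
      have e1 := incr_bd (hGd η) (hGb η) (x := -r) (y := 0) ⟨le_rfl, by linarith⟩ hr1 (by linarith)
      have e2 := abs_le.1 (hG0 η)
      linarith)
    (fun η _ => by
      have e1 := incr_bd (hGd η) (hGb η) (x := 0) (y := r) hr1 ⟨by linarith, le_rfl⟩ (by linarith)
      have e2 := abs_le.1 (hG0 η)
      linarith)
  have hs2 : Continuous s := continuousOn_univ.1 hs
  have hsr : ∀ θ, s θ ∈ Ioo (-r) r := fun θ => (hs1 θ trivial).1
  have hs0 : ∀ θ, G θ (s θ) = 0 := fun θ => (hs1 θ trivial).2.1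
  set ξ : ℝ → ℝ := fun η => η + s η with hξ
  have hξc : Continuous ξ := continuous_id.add hs2
  have hξ0 : ∀ η, F η (ξ η) = 0 := hs0
  have hξr : ∀ η, |ξ η - η| ≤ r := by
    intro η; simp only [hξ, add_sub_cancel_left]; exact abs_le.2 (Ioo_subset_Icc_self (hsr η))
  have hFyne : ∀ η, 0 < Fy η (ξ η) := fun η => hc2.trans_le (hFyb η _ (hξr η))
  set ξ' : ℝ → ℝ := fun η => -(-(inner ℝ (deriv w η) (T (ξ η)))) / Fy η (ξ η) with hξ'
  have hξd : ∀ η, HasDerivAt ξ (ξ' η) η := by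
    intro η
    refine implicit1 hFd hFyc ?_ hξc hξ0 (hFyne η).ne'
    have e1 := ((hasDerivAt_const η (z (ξ η))).sub (hwd η)).inner ℝ (hasDerivAt_const η (T (ξ η)))
    refine e1.congr_deriv ?_
    simp
  have hξ'c : Continuous ξ' := by
    have k1 : Continuous (fun η => inner ℝ (deriv w η) (T (ξ η))) := hwdc.inner (hTc.comp hξc)
    have k5 : Continuous (fun η : ℝ => ((η, ξ η) : ℝ × ℝ)) := continuous_id.prodMk hξc
    have k2 : Continuous (fun η => Fy η (ξ η)) := by
      clear_value Fy ξ
      exact hFyc.comp k5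
    have k3 : ∀ η, Fy η (ξ η) ≠ 0 := fun η => (hFyne η).ne'
    have k4 : Continuous (fun η => -(-(inner ℝ (deriv w η) (T (ξ η))))) := by
      simp only [neg_neg]; exact k1
    exact Continuous.div k4 k2 k3
  have hξ'b : ∀ η, |ξ' η| ≤ 2 * K / c := by
    intro η
    have e1 := inner_abs_le (deriv w η) (T (ξ η))
    have e2 := mul_le_mul (hwK η) (hTn (ξ η)) (norm_nonneg _) hK.le
    have e3 := hFyb η _ (hξr η)
    simp only [hξ', neg_neg, abs_div, abs_of_pos (hFyne η)]
    rw [div_le_div_iff₀ (hFyne η) hc]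
    have e4 : |inner ℝ (deriv w η) (T (ξ η))| * c ≤ K * c * c := mul_le_mul_of_nonneg_right (e1.trans e2) hc.le
    have e5 : 2 * K * (c ^ 2 / 2) ≤ 2 * K * Fy η (ξ η) := mul_le_mul_of_nonneg_left e3 (by positivity)
    linarith
  have hsper : s (0 + 2 * π) = s 0 := by
    apply (hs1 0 trivial).2.2 _ (Ioo_subset_Icc_self (hsr _))
    have e := hs0 (0 + 2 * π)
    have e2 : ∀ x, T (x + 2 * π) = T x := by
      intro x
      simp only [hT, chT]
      rw [show x + 2 * π + b = x + b + 2 * π by ring, show x + 2 * π - b = x - b + 2 * π by ring, hz.per, hz.per]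
    simp only [hG, hF] at e ⊢
    rw [show 0 + 2 * π + s (0 + 2 * π) = 0 + s (0 + 2 * π) + 2 * π by ring, e2, hz.per, hwp] at e
    exact e
  have hξp : ξ (2 * π) = ξ 0 + 2 * π := by
    simp only [hξ]
    rw [zero_add] at hsper
    rw [hsper]; ring
  have harz := ar_reparam hz.C1 hz.per hξd hξ'c hξp
  have hZd : ∀ x, HasDerivAt (fun x => z (ξ x)) (ξ' x • deriv z (ξ x)) x := fun x => (hz.hd (ξ x)).scomp x (hξd x)
  have hZC : ContDiff ℝ 1 (fun x => z (ξ x)) := by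
    rw [contDiff_one_iff_deriv]
    refine ⟨fun x => (hZd x).differentiableAt, ?_⟩
    rw [show deriv (fun x => z (ξ x)) = fun x => ξ' x • deriv z (ξ x) from funext fun x => (hZd x).deriv]
    exact hξ'c.smul (hz.dcont.comp hξc)
  have hdist : ∀ x, ‖w x - z (ξ x)‖ ≤ 5 * ε := by
    intro x
    obtain ⟨x1, hx1, hx1r⟩ : ∃ x1, ‖w x - z x1‖ ≤ ε ∧ |x1 - x| ≤ r := by
      rcases le_total δ0 ε with h | h
      · exact ⟨x, (hwz x).trans h, by simpa using hr0.le⟩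
      · obtain ⟨x1, hx1⟩ := hnear x
        have e1 : ‖z x1 - z x‖ < κ := by
          have e2 : z x1 - z x = (w x - z x) - (w x - z x1) := by abel
          rw [e2]
          have := norm_sub_le (w x - z x) (w x - z x1)
          linarith [hwz x]
        have e3 := hκ1 _ _ e1
        obtain ⟨k, hk, -⟩ := distT_exists x1 x
        refine ⟨x1 + 2 * π * k, by rw [hz.perk]; exact hx1, ?_⟩
        rw [show x1 + 2 * π * k - x = x1 - x + 2 * π * k by ring, ← hk]; exact e3.le
    have hx1' : x1 - x ∈ Icc (-r) r := abs_le.1 hx1r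
    have hsx := Ioo_subset_Icc_self (hsr x)
    have e1 : |G x (x1 - x)| ≤ ε * c := by
      refine (inner_abs_le _ _).trans ?_
      rw [add_sub_cancel, norm_sub_rev]
      exact mul_le_mul hx1 (hTn _) (norm_nonneg _) hε
    have e2 : c ^ 2 / 2 * |s x - (x1 - x)| ≤ ε * c := by
      rcases le_total (s x) (x1 - x) with h | h
      · have := incr_bd (hGd x) (hGb x) hsx hx1' h
        rw [hs0] at this
        rw [abs_of_nonpos (by linarith)]
        linarith [(abs_le.1 e1).2]
      · have := incr_bd (hGd x) (hGb x) hx1' hsx h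
        rw [hs0] at this
        rw [abs_of_nonneg (by linarith)]
        linarith [(abs_le.1 e1).1]
    have e3 : c * |s x - (x1 - x)| ≤ 2 * ε := by
      have : c * (c * |s x - (x1 - x)|) ≤ c * (2 * ε) := by linarith
      exact le_of_mul_le_mul_left this hc
    have e4 := hz.lip x1 (ξ x)
    rw [show x1 - ξ x = -(s x - (x1 - x)) by simp only [hξ]; ring, abs_neg] at e4
    have e5 : w x - z (ξ x) = (w x - z x1) + (z x1 - z (ξ x)) := by abel
    rw [e5]
    refine (norm_add_le _ _).trans ?_
    linarith
  have hfin := area_diff_le (K := 2 * K) (δ := 5 * ε) hw hZC (by simpa using hwp 0)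
    (by show z (ξ (2 * π)) = z (ξ 0); rw [hξp, hz.per]) (by positivity) hdist (fun x => by linarith [hwK x]) (fun x => by
      rw [(hZd x).deriv, norm_smul, hz.spd, Real.norm_eq_abs]
      calc |ξ' x| * c ≤ 2 * K / c * c := mul_le_mul_of_nonneg_right (hξ'b x) hc.le
        _ = 2 * K := by field_simp)
  rw [harz] at hfin
  refine hfin.trans (le_of_eq (by ring))

lemma area_flow {M γ c B L h : ℝ} {W : ℝ → R2} {v : R2 → R2} {ψ : R2 → ℝ} (hW : Cv M γ c W) (hv : ContDiff ℝ 1 v)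
    (hψ : ContDiff ℝ 1 ψ) (hψv : ∀ x y, fderiv ℝ ψ x y = wd y (v x)) (hB : ∀ x, ‖x‖ ≤ M → ‖v x‖ ≤ B)
    (hL : ∀ x, ‖x‖ ≤ M → ‖fderiv ℝ v x‖ ≤ L) :
    ContDiff ℝ 1 (fun x => W x - h • v (W x)) ∧
    (∀ x, ‖deriv (fun x => W x - h • v (W x)) x‖ ≤ M + |h| * (L * M)) ∧
    |ar W - ar (fun x => W x - h • v (W x))| ≤ 2 * π * (B * (L * M)) * h ^ 2 := by
  have hM := hW.Mpos
  have hB0 : 0 ≤ B := (norm_nonneg _).trans (hB 0 (by simpa using hM.le))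
  have hL0 : 0 ≤ L := (norm_nonneg _).trans (hL 0 (by simpa using hM.le))
  have hvW : ContDiff ℝ 1 (fun x => v (W x)) := hv.comp hW.C1
  have hdv : ∀ x, HasDerivAt (fun x => v (W x)) (fderiv ℝ v (W x) (deriv W x)) x := fun x =>
    (hv.differentiable (by norm_num) (W x)).hasFDerivAt.comp_hasDerivAt x (hW.hd x)
  have hdv' : ∀ x, deriv (fun x => v (W x)) x = fderiv ℝ v (W x) (deriv W x) := fun x => (hdv x).deriv
  have hdvn : ∀ x, ‖deriv (fun x => v (W x)) x‖ ≤ L * M := by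
    intro x
    rw [hdv']
    refine (ContinuousLinearMap.le_opNorm _ _).trans ?_
    exact mul_le_mul (hL _ (hW.bd x)) (by rw [hW.spd]; exact hW.cM) (norm_nonneg _) hL0
  have hC : ContDiff ℝ 1 (fun x => W x - h • v (W x)) := hW.C1.sub (hvW.const_smul h)
  have hd : ∀ x, deriv (fun x => W x - h • v (W x)) x = deriv W x - h • deriv (fun x => v (W x)) x := by
    intro x
    have e1 := (hdv x)
    rw [← hdv'] at e1
    exact ((hW.hd x).sub (e1.const_smul h)).deriv
  refine ⟨hC, ?_, ?_⟩
  · intro x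
    rw [hd]
    refine (norm_sub_le _ _).trans ?_
    rw [norm_smul, Real.norm_eq_abs, hW.spd]
    exact add_le_add hW.cM (mul_le_mul_of_nonneg_left (hdvn x) (abs_nonneg _))
  · have pW : W (2 * π) = W 0 := by have := hW.per 0; rwa [zero_add] at this
    rw [area_diff hW.C1 hC pW (by simp only [pW])]
    have c1 := hW.cont; have c2 := hW.dcont; have c3 := hvW.continuous
    have c4 := hvW.continuous_deriv (by norm_num)
    have hsplit : ∀ ξ, wd (W ξ - (W ξ - h • v (W ξ))) (deriv W ξ + deriv (fun x => W x - h • v (W x)) ξ)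
        = (-(2 * h)) * wd (deriv W ξ) (v (W ξ)) - h ^ 2 * wd (v (W ξ)) (deriv (fun x => v (W x)) ξ) := by
      intro ξ
      rw [hd, sub_sub_cancel, wd_smul_left, show deriv W ξ + (deriv W ξ - h • deriv (fun x => v (W x)) ξ)
        = (2:ℝ) • deriv W ξ - h • deriv (fun x => v (W x)) ξ by rw [two_smul]; abel, wd_sub_right, wd_smul_right,
        wd_smul_right, wd_swap (v (W ξ)) (deriv W ξ)]
      ring
    simp only [hsplit]
    have i1 : IntervalIntegrable (fun ξ => (-(2 * h)) * wd (deriv W ξ) (v (W ξ))) volume 0 (2 * π) :=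
      (continuous_const.mul (cwd c2 c3)).intervalIntegrable _ _
    have i2 : IntervalIntegrable (fun ξ => h ^ 2 * wd (v (W ξ)) (deriv (fun x => v (W x)) ξ)) volume 0 (2 * π) :=
      (continuous_const.mul (cwd c3 c4)).intervalIntegrable _ _
    rw [intervalIntegral.integral_sub i1 i2, intervalIntegral.integral_const_mul, intervalIntegral.integral_const_mul]
    have hz : (∫ ξ in (0:ℝ)..(2 * π), wd (deriv W ξ) (v (W ξ))) = 0 := by
      have e : ∀ x ∈ uIcc 0 (2 * π), HasDerivAt (fun x => ψ (W x)) (wd (deriv W x) (v (W x))) x := by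
        intro x _
        rw [← hψv]
        exact (hψ.differentiable (by norm_num) (W x)).hasFDerivAt.comp_hasDerivAt x (hW.hd x)
      rw [intervalIntegral.integral_eq_sub_of_hasDerivAt e ((cwd c2 c3).intervalIntegrable _ _), pW, sub_self]
    rw [hz, mul_zero, zero_sub, abs_neg, abs_mul, abs_of_nonneg (sq_nonneg h)]
    have := intervalIntegral.norm_integral_le_of_norm_le_const (a := 0) (b := 2 * π) (C := B * (L * M))
      (f := fun ξ => wd (v (W ξ)) (deriv (fun x => v (W x)) ξ)) (fun x _ => by
        rw [Real.norm_eq_abs]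
        exact (wd_le _ _).trans (mul_le_mul (hB _ (hW.bd x)) (hdvn x) (norm_nonneg _) hB0))
    rw [sub_zero, abs_of_pos Real.two_pi_pos, Real.norm_eq_abs] at this
    have := mul_le_mul_of_nonneg_left this (sq_nonneg h)
    linarith

structure Sol (α γ T cα M : ℝ) {N : ℕ} (θ : Fin N → ℝ) (Ω : Fin N → ℝ → Set R2) (Z : Fin N → ℝ → ℝ → R2) : Prop where
  a0 : 0 < α
  a1 : α ≤ 1 / 4
  g : γ = 2 * α / (1 - 2 * α)
  M0 : 0 < M
  T0 : 0 < T
  cv : ∀ n, ∀ t ∈ Ico 0 T, ∃ c, Cv M γ c (Z n t)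
  arp : ∀ n, ∀ t ∈ Ico 0 T, 0 < ar (Z n t)
  op : ∀ t ∈ Ico 0 T, ∀ n, IsOpen (Ω n t)
  bdd : ∀ t ∈ Ico 0 T, ∀ n, Bornology.IsBounded (Ω n t)
  fr : ∀ t ∈ Ico 0 T, ∀ n, frontier (Ω n t) ⊆ Z n t '' Icc 0 (2 * π)
  disj : ∀ t ∈ Ico 0 T, ∀ n j, n ≠ j → ∀ x y, Z n t x ≠ Z j t y
  haus : ∀ n, ∀ t₀ ∈ Ico 0 T, ∀ ε > 0, ∀ᶠ t in 𝓝[Ico 0 T] t₀, (∀ η, ∃ ξ, ‖Z n t η - Z n t₀ ξ‖ ≤ ε) ∧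
    (∀ ξ, ∃ η, ‖Z n t₀ ξ - Z n t η‖ ≤ ε)
  patch : ∀ t ∈ Ioo 0 T, ∀ ε > 0, ∀ᶠ h in 𝓝[>] (0:ℝ), ∀ n ξ, ∃ m η,
    ‖Z n (t + h) ξ - (Z m t η + h • gSQGvel α cα θ (fun n => Ω n t) (Z m t η))‖ ≤ ε * h

namespace Sol
variable {α γ T cα M : ℝ} {N : ℕ} {θ : Fin N → ℝ} {Ω : Fin N → ℝ → Set R2} {Z : Fin N → ℝ → ℝ → R2}

lemma g0 (S : Sol α γ T cα M θ Ω Z) : 0 < γ := by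
  rw [S.g]; have := S.a0; have := S.a1
  apply div_pos <;> linarith

lemma conv (S : Sol α γ T cα M θ Ω Z) (n : Fin N) {t : ℝ} (ht : t ∈ Ico 0 T) {δ : ℝ} (hδ : 0 < δ) :
    ∀ᶠ s in 𝓝[Ico 0 T] t, ∃ φ, ∀ η, ‖Z n s η - Z n t (η + φ)‖ ≤ δ := by
  obtain ⟨c, hc⟩ := S.cv n t ht
  obtain ⟨κ, hκ, h⟩ := S_lem S.g0 hc (S.arp n t ht) hδ
  filter_upwards [S.haus n t ht κ hκ, self_mem_nhdsWithin] with s hs hsT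
  obtain ⟨c', hc'⟩ := S.cv n s hsT
  exact h c' _ hc' (S.arp n s hsT) hs.1 hs.2

lemma ar_shift {c : ℝ} {z : ℝ → R2} (hz : Cv M γ c z) (φ : ℝ) : ar (fun x => z (x + φ)) = ar z := by
  have := ar_cover (φ := φ) (k := 1) hz.C1 hz.per one_ne_zero (Z := fun x => z (x + φ)) (fun x => by
    simp only [Int.cast_one, one_mul, add_comm])
  simpa using this

lemma ar_cont (S : Sol α γ T cα M θ Ω Z) (n : Fin N) : ContinuousOn (fun t => ar (Z n t)) (Ico 0 T) := by
  intro t ht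
  have hM := S.M0
  obtain ⟨c, hc⟩ := S.cv n t ht
  rw [ContinuousWithinAt, Metric.tendsto_nhds]
  intro ε hε
  filter_upwards [S.conv n ht (δ := ε / (8 * π * M)) (by positivity), self_mem_nhdsWithin] with s hs hsT
  obtain ⟨φ, hφ⟩ := hs
  obtain ⟨c', hc'⟩ := S.cv n s hsT
  have hsh := hc.shift φ
  have p1 : Z n s (2 * π) = Z n s 0 := by have := hc'.per 0; rwa [zero_add] at this
  have p2 : Z n t (2 * π + φ) = Z n t (0 + φ) := by
    have := hsh.per 0; rwa [zero_add] at this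
  have := area_diff_le hc'.C1 hsh.C1 p1 p2 hM.le hφ (fun x => by rw [hc'.spd]; exact hc'.cM)
    (fun x => by rw [hsh.spd]; exact hsh.cM)
  rw [ar_shift hc] at this
  rw [Real.dist_eq]
  refine this.trans_lt ?_
  rw [show 4 * π * M * (ε / (8 * π * M)) = ε / 2 by field_simp; ring]
  linarith

lemma sep (S : Sol α γ T cα M θ Ω Z) {t : ℝ} (ht : t ∈ Ico 0 T) : ∃ σ > 0, ∀ n j, n ≠ j → ∀ x y, σ ≤ ‖Z n t x - Z j t y‖ := by
  have h1 : ∀ n j, ∃ σ > 0, n ≠ j → ∀ x y, σ ≤ ‖Z n t x - Z j t y‖ := by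
    intro n j
    by_cases hnj : n = j
    · exact ⟨1, one_pos, fun h => absurd hnj h⟩
    obtain ⟨c, hc⟩ := S.cv n t ht
    obtain ⟨c', hc'⟩ := S.cv j t ht
    have hcont : Continuous (fun p : ℝ × ℝ => ‖Z n t p.1 - Z j t p.2‖) :=
      ((hc.cont.comp continuous_fst).sub (hc'.cont.comp continuous_snd)).norm
    obtain ⟨p, hp, hmin⟩ := (isCompact_Icc.prod isCompact_Icc : IsCompact (Icc (0:ℝ) (2 * π) ×ˢ Icc (0:ℝ) (2 * π))).exists_isMinOn
      ⟨(0, 0), ⟨⟨le_rfl, Real.two_pi_pos.le⟩, ⟨le_rfl, Real.two_pi_pos.le⟩⟩⟩ hcont.continuousOn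
    refine ⟨_, norm_pos_iff.2 (sub_ne_zero.2 (S.disj t ht n j hnj p.1 p.2)), fun _ x y => ?_⟩
    obtain ⟨k, hk⟩ := exists_rep x
    obtain ⟨l, hl⟩ := exists_rep y
    have := hmin (a := (x + 2 * π * k, y + 2 * π * l)) ⟨Ico_subset_Icc_self hk, Ico_subset_Icc_self hl⟩
    simp only [mem_setOf_eq, hc.perk, hc'.perk] at this
    exact this
  choose σ hσ h using h1
  rcases isEmpty_or_nonempty (Fin N) with he | he
  · exact ⟨1, one_pos, fun n => (he.false n).elim⟩
  obtain ⟨p, hp⟩ := Finite.exists_min (fun p : Fin N × Fin N => σ p.1 p.2)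
  exact ⟨σ p.1 p.2, hσ _ _, fun n j hnj x y => (hp (n, j)).trans (h n j hnj x y)⟩

lemma vbound {v : R2 → R2} (hv : Continuous v) (M : ℝ) : ∃ B > 0, ∀ x, ‖x‖ ≤ M → ‖v x‖ ≤ B := by
  obtain ⟨B, hB⟩ := ((isCompact_closedBall (0:R2) M).image hv).isBounded.exists_norm_le
  exact ⟨max B 1, by positivity, fun x hx => (hB _ ⟨x, by simpa using hx, rfl⟩).trans (le_max_left _ _)⟩

lemma tends (S : Sol α γ T cα M θ Ω Z) {t : ℝ} (ht : t ∈ Ico 0 T) :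
    Tendsto (fun h => t + h) (𝓝[>] (0:ℝ)) (𝓝[Ico 0 T] t) := by
  rw [tendsto_nhdsWithin_iff]
  constructor
  · have : Tendsto (fun h : ℝ => t + h) (𝓝 0) (𝓝 (t + 0)) := (continuous_const.add continuous_id).tendsto 0
    rw [add_zero] at this
    exact this.mono_left nhdsWithin_le_nhds
  · have : Ioo 0 (T - t) ∈ 𝓝[>] (0:ℝ) := Ioo_mem_nhdsGT (by linarith [ht.2])
    filter_upwards [this] with h hh
    exact ⟨by linarith [ht.1, hh.1], by linarith [hh.2]⟩

lemma small {c : ℝ} (hc : 0 < c) : ∀ᶠ h in 𝓝[>] (0:ℝ), 0 < h ∧ h ≤ c := by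
  filter_upwards [Ioo_mem_nhdsGT hc] with h hh
  exact ⟨hh.1, hh.2.le⟩

set_option maxHeartbeats 1000000 in
lemma step (S : Sol α γ T cα M θ Ω Z) (n : Fin N) {t : ℝ} (ht : t ∈ Ioo 0 T) {κ : ℝ} (hκ : 0 < κ) :
    ∀ᶠ h in 𝓝[>] (0:ℝ), ar (Z n t) - κ * h ≤ ar (Z n (t + h)) := by
  have ht' : t ∈ Ico 0 T := Ioo_subset_Ico_self ht
  have hM := S.M0
  obtain ⟨c, hc⟩ := S.cv n t ht'
  obtain ⟨δ0, hδ0, harea⟩ := area_lem S.g0 hc (K := 2 * M) (by positivity)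
  obtain ⟨σ, hσ, hsep⟩ := S.sep ht'
  set ε : ℝ := κ / (480 * π * M) with hε
  have hε0 : 0 < ε := by positivity
  set u := gSQGvel α cα θ (fun n => Ω n t) with hu
  have huc : Continuous u := vel_cont S.a0 S.a1 θ (S.op t ht') (S.bdd t ht')
  obtain ⟨δ, hδc, hδp⟩ := ((veld_conv (cα := cα) S.a0 S.a1 θ (S.op t ht') (S.bdd t ht') M hε0).and
    (self_mem_nhdsWithin : Ioi (0:ℝ) ∈ 𝓝[>] (0:ℝ))).exists
  set v := veld α cα δ θ (fun n => Ω n t) with hv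
  have hvC : ContDiff ℝ 1 v := veld_contDiff hδp θ (S.op t ht') (S.bdd t ht')
  obtain ⟨ψ, hψ, hψv⟩ := veld_pot (α := α) (cα := cα) S.a0 hδp θ (S.op t ht') (S.bdd t ht')
  obtain ⟨Bu, hBu0, hBu⟩ := vbound huc M
  obtain ⟨B, hB0, hB⟩ := vbound hvC.continuous M
  obtain ⟨L, hL0, hL⟩ : ∃ L > 0, ∀ x, ‖x‖ ≤ M → ‖fderiv ℝ v x‖ ≤ L := by
    obtain ⟨B, hB⟩ := ((isCompact_closedBall (0:R2) M).image (hvC.continuous_fderiv (by norm_num))).isBounded.exists_norm_le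
    exact ⟨max B 1, by positivity, fun x hx => (hB _ ⟨x, by simpa using hx, rfl⟩).trans (le_max_left _ _)⟩
  have hlip : ∀ x y, ‖x‖ ≤ M → ‖y‖ ≤ M → ‖v y - v x‖ ≤ L * ‖y - x‖ := by
    intro x y hx hy
    exact (convex_closedBall (0:R2) M).norm_image_sub_le_of_norm_fderiv_le (𝕜 := ℝ)
      (fun z _ => hvC.differentiable (by norm_num) z) (fun z hz => hL z (by simpa using hz))
      (by simpa using hx) (by simpa using hy)
  have hδ1 : 0 < min (δ0 / 2) (σ / 4) := by positivity
  have hpi := Real.pi_pos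
  filter_upwards [(S.tends ht').eventually (S.conv n ht' hδ1), (S.tends ht').eventually self_mem_nhdsWithin,
    S.patch t ht ε hε0, small (c := δ0 / 2 / B) (by positivity), small (c := 1 / L) (by positivity),
    small (c := σ / 4 / (ε + Bu)) (by positivity), small (c := ε / (L * (ε + Bu))) (by positivity),
    small (c := κ / (4 * π * (B * (L * M)))) (by positivity)] with h hφ hT hp h1 h2 h3 h4 h5
  obtain ⟨φ, hφ⟩ := hφ
  have hh0 := h1.1
  obtain ⟨c', hc'⟩ := S.cv n (t + h) hT
  set W : ℝ → R2 := fun x => Z n (t + h) (x + (-φ)) with hW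
  have hWC : Cv M γ c' W := hc'.shift (-φ)
  have harW : ar W = ar (Z n (t + h)) := ar_shift hc' (-φ)
  have hWz : ∀ x, ‖W x - Z n t x‖ ≤ min (δ0 / 2) (σ / 4) := by
    intro x
    have := hφ (x + (-φ))
    rwa [neg_add_cancel_right] at this
  obtain ⟨f1, f2, f3⟩ := area_flow (h := h) hWC hvC hψ hψv hB hL
  have g1 : h * B ≤ δ0 / 2 := by have := h1.2; rwa [le_div_iff₀ hB0] at this
  have g2 : h * L ≤ 1 := by have := h2.2; rwa [le_div_iff₀ hL0] at this
  have g3 : h * (ε + Bu) ≤ σ / 4 := by have := h3.2; rwa [le_div_iff₀ (by positivity)] at this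
  have g4 : h * (L * (ε + Bu)) ≤ ε := by have := h4.2; rwa [le_div_iff₀ (by positivity)] at this
  have g5 : h * (4 * π * (B * (L * M))) ≤ κ := by have := h5.2; rwa [le_div_iff₀ (by positivity)] at this
  have key := harea (fun x => W x - h • v (W x)) (3 * ε * h) f1 (fun x => by simp only [hWC.per x])
    (fun x => (f2 x).trans (by
      rw [abs_of_pos hh0]
      have := mul_le_mul_of_nonneg_right g2 hM.le
      linarith)) (fun x => by
      have e1 : W x - h • v (W x) - Z n t x = (W x - Z n t x) - h • v (W x) := by abel
      rw [e1]
      refine (norm_sub_le _ _).trans ?_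
      rw [norm_smul, Real.norm_of_nonneg hh0.le]
      have e2 := mul_le_mul_of_nonneg_left (hB _ (hWC.bd x)) hh0.le
      have e3 := (hWz x).trans (min_le_left _ _)
      linarith) (by positivity) (fun x => by
      obtain ⟨m, η, hm⟩ := hp n (x + (-φ))
      obtain ⟨cm, hcm⟩ := S.cv m t ht'
      set P := Z m t η with hP
      have hPM : ‖P‖ ≤ M := hcm.bd η
      have hWP : ‖W x - P‖ ≤ h * (ε + Bu) := by
        have e1 : W x - P = (W x - (P + h • u P)) + h • u P := by abel
        rw [e1]
        refine (norm_add_le _ _).trans ?_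
        rw [norm_smul, Real.norm_of_nonneg hh0.le]
        have e2 := mul_le_mul_of_nonneg_left (hBu _ hPM) hh0.le
        have e3 : ‖W x - (P + h • u P)‖ ≤ ε * h := hm
        linarith
      have hmn : m = n := by
        by_contra hne
        have e1 := hsep m n hne η x
        have e2 : Z m t η - Z n t x = (W x - Z n t x) - (W x - P) := by rw [hP]; abel
        rw [e2] at e1
        have e3 := norm_sub_le (W x - Z n t x) (W x - P)
        have e4 := (hWz x).trans (min_le_right _ _)
        linarith
      subst hmn
      refine ⟨η, ?_⟩
      have e1 : W x - h • v (W x) - P = (W x - (P + h • u P)) - h • (v P - u P) - h • (v (W x) - v P) := by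
        rw [smul_sub, smul_sub]; abel
      rw [e1]
      refine (norm_sub_le _ _).trans ?_
      rw [norm_smul, Real.norm_of_nonneg hh0.le]
      have e2 := norm_sub_le (W x - (P + h • u P)) (h • (v P - u P))
      rw [norm_smul, Real.norm_of_nonneg hh0.le] at e2
      have e3 : ‖W x - (P + h • u P)‖ ≤ ε * h := hm
      have e4 := mul_le_mul_of_nonneg_left (hδc P hPM) hh0.le
      have e5 := (hlip P (W x) hPM (hWC.bd x)).trans (mul_le_mul_of_nonneg_left hWP hL0.le)
      have e6 : L * (h * (ε + Bu)) ≤ ε := by linarith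
      have e7 := mul_le_mul_of_nonneg_left (e5.trans e6) hh0.le
      linarith)
  rw [← harW]
  have k1 := (abs_le.1 key).1
  have k2 := (abs_le.1 f3).1
  have k3 : 40 * π * (2 * M) * (3 * ε * h) = κ / 2 * h := by
    rw [hε]; field_simp; ring
  have k4 := mul_le_mul_of_nonneg_left g5 hh0.le
  rw [k3] at k1
  nlinarith

lemma ar_mono (S : Sol α γ T cα M θ Ω Z) (n : Fin N) {a b : ℝ} (ha : 0 < a) (hab : a ≤ b) (hb : b < T) :
    ar (Z n a) ≤ ar (Z n b) := by
  have hsub : Icc a b ⊆ Ico 0 T := fun x hx => ⟨ha.le.trans hx.1, hx.2.trans_lt hb⟩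
  have hcont : ContinuousOn (fun t => ar (Z n t)) (Icc a b) := (S.ar_cont n).mono hsub
  have main : ∀ κ > 0, ∀ x ∈ Icc a b, ar (Z n a) - κ * (x - a) ≤ ar (Z n x) := by
    intro κ hκ
    have hcl : IsClosed ({x | ar (Z n a) - κ * (x - a) ≤ ar (Z n x)} ∩ Icc a b) := by
      have : ContinuousOn (fun x => ar (Z n x) - (ar (Z n a) - κ * (x - a))) (Icc a b) := by fun_prop
      have h2 := this.preimage_isClosed_of_isClosed isClosed_Icc (isClosed_Ici (a := (0:ℝ)))
      convert h2 using 1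
      ext x
      simp only [mem_inter_iff, mem_preimage, mem_Ici, mem_setOf_eq, sub_nonneg]
      tauto
    refine hcl.Icc_subset_of_forall_mem_nhdsWithin (by simp) ?_
    rintro x ⟨hx, hx1⟩
    have hx2 : ar (Z n a) - κ * (x - a) ≤ ar (Z n x) := hx
    have hstep := S.step n (t := x) ⟨ha.trans_le hx1.1, hx1.2.trans hb⟩ hκ
    have hmap : Tendsto (fun y => y - x) (𝓝[>] x) (𝓝[>] 0) := by
      rw [tendsto_nhdsWithin_iff]
      constructor
      · have : Tendsto (fun y : ℝ => y - x) (𝓝 x) (𝓝 (x - x)) := (continuous_id.sub continuous_const).tendsto x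
        rw [sub_self] at this
        exact this.mono_left nhdsWithin_le_nhds
      · filter_upwards [self_mem_nhdsWithin] with y hy
        have hy1 : x < y := hy
        exact sub_pos.2 hy1
    filter_upwards [hmap.eventually hstep] with y hy
    rw [add_sub_cancel] at hy
    show ar (Z n a) - κ * (y - a) ≤ ar (Z n y)
    linarith
  by_contra hcon
  push Not at hcon
  rcases hab.eq_or_lt with h | h
  · subst h; exact lt_irrefl _ hcon
  have h1 : 0 < b - a := by linarith
  have := main ((ar (Z n a) - ar (Z n b)) / (2 * (b - a))) (div_pos (by linarith) (by linarith)) b ⟨hab, le_rfl⟩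
  rw [show (ar (Z n a) - ar (Z n b)) / (2 * (b - a)) * (b - a) = (ar (Z n a) - ar (Z n b)) / 2 by field_simp] at this
  linarith

lemma c_low (S : Sol α γ T cα M θ Ω Z) : ∃ c0 > 0, ∀ n, ∀ t ∈ Ico 0 T, ∀ c, Cv M γ c (Z n t) → c0 ≤ c := by
  have hM := S.M0
  have hT0 := S.T0
  have hpi := Real.pi_pos
  have h1 : ∀ n, ∃ A > 0, ∀ t ∈ Ico 0 T, A ≤ ar (Z n t) := by
    intro n
    have hsub : Icc 0 (T / 2) ⊆ Ico 0 T := fun x hx => ⟨hx.1, by linarith [hx.2]⟩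
    obtain ⟨x, hx, hmin⟩ := isCompact_Icc.exists_isMinOn (⟨0, le_rfl, by linarith⟩ : (Icc 0 (T / 2)).Nonempty)
      ((S.ar_cont n).mono hsub)
    refine ⟨_, S.arp n x (hsub hx), fun t ht => ?_⟩
    rcases le_total t (T / 2) with h | h
    · exact hmin (a := t) ⟨ht.1, h⟩
    · have e1 := hmin (a := T / 2) ⟨by linarith, le_rfl⟩
      exact le_trans e1 (S.ar_mono n (by linarith) h ht.2)
  choose A hA hA1 using h1
  rcases isEmpty_or_nonempty (Fin N) with he | he
  · exact ⟨1, one_pos, fun n => (he.false n).elim⟩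
  obtain ⟨p, hp⟩ := Finite.exists_min A
  refine ⟨A p / (2 * π * M), div_pos (hA p) (by positivity), fun n t ht c hc => ?_⟩
  rw [div_le_iff₀ (by positivity)]
  refine ((hp n).trans (hA1 n t ht)).trans ?_
  have := intervalIntegral.norm_integral_le_of_norm_le_const (a := 0) (b := 2 * π) (C := M * c)
    (f := fun ξ => wd (Z n t ξ) (deriv (Z n t) ξ)) (fun x _ => by
      rw [Real.norm_eq_abs]
      exact (wd_le _ _).trans (mul_le_mul (hc.bd x) (hc.spd x).le (norm_nonneg _) hM.le))
  rw [sub_zero, abs_of_pos Real.two_pi_pos] at this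
  have h2 := (Real.le_norm_self _).trans this
  rw [ar]; linarith

end Sol

lemma distT_tri3 (a b a' b' : ℝ) : distT a b ≤ distT a' b' + distT a a' + distT b b' := by
  obtain ⟨k, hk, -⟩ := distT_exists a a'
  obtain ⟨l, hl, -⟩ := distT_exists b b'
  have h1 := distT_tri (a + 2 * π * k) (b + 2 * π * l) a' b'
  rw [show a + 2 * π * k - a' = a - a' + 2 * π * k by ring, ← hk,
    show b + 2 * π * l - b' = b - b' + 2 * π * l by ring, ← hl] at h1
  have e : distT (a + 2 * π * k) (b + 2 * π * l) = distT a b := by rw [distT_per, distT_per']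
  rwa [e] at h1

/-- lower bound over far pairs -/
def Low {N : ℕ} (Z : Fin N → ℝ → ℝ → R2) (ρ t b : ℝ) : Prop :=
  ∀ n j x y, (n ≠ j ∨ ρ ≤ distT x y) → b ≤ ‖Z n t x - Z j t y‖

namespace Sol
variable {α γ T cα M : ℝ} {N : ℕ} {θ : Fin N → ℝ} {Ω : Fin N → ℝ → Set R2} {Z : Fin N → ℝ → ℝ → R2}

lemma conv_all (S : Sol α γ T cα M θ Ω Z) {t : ℝ} (ht : t ∈ Ico 0 T) {δ : ℝ} (hδ : 0 < δ) :
    ∀ᶠ s in 𝓝[Ico 0 T] t, ∃ φ : Fin N → ℝ, ∀ n η, ‖Z n s η - Z n t (η + φ n)‖ ≤ δ := by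
  have : ∀ᶠ s in 𝓝[Ico 0 T] t, ∀ n, ∃ φ, ∀ η, ‖Z n s η - Z n t (η + φ)‖ ≤ δ :=
    eventually_all.2 fun n => S.conv n ht hδ
  filter_upwards [this] with s hs
  choose φ hφ using hs
  exact ⟨φ, hφ⟩

lemma far_shift {ρ : ℝ} {n j : Fin N} {x y : ℝ} (φ : Fin N → ℝ) (h : n ≠ j ∨ ρ ≤ distT x y) :
    n ≠ j ∨ ρ ≤ distT (x + φ n) (y + φ j) := by
  by_cases hnj : n = j
  · subst hnj
    right; rw [distT_shift]; exact h.resolve_left (by simp)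
  · exact Or.inl hnj

lemma low_fwd (S : Sol α γ T cα M θ Ω Z) {t : ℝ} (ht : t ∈ Ico 0 T) {ρ b δ : ℝ} (hδ : 0 < δ) (hb : Low Z ρ t b) :
    ∀ᶠ s in 𝓝[Ico 0 T] t, Low Z ρ s (b - δ) := by
  filter_upwards [S.conv_all ht (half_pos hδ)] with s hs
  obtain ⟨φ, hφ⟩ := hs
  intro n j x y hf
  have h1 := hb n j _ _ (far_shift φ hf)
  have e : Z n t (x + φ n) - Z j t (y + φ j) = (Z n s x - Z j s y) - (Z n s x - Z n t (x + φ n))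
    + (Z j s y - Z j t (y + φ j)) := by abel
  rw [e] at h1
  have h2 := norm_add_le ((Z n s x - Z j s y) - (Z n s x - Z n t (x + φ n))) (Z j s y - Z j t (y + φ j))
  have h3 := norm_sub_le (Z n s x - Z j s y) (Z n s x - Z n t (x + φ n))
  linarith [hφ n x, hφ j y]

lemma low_bwd (S : Sol α γ T cα M θ Ω Z) {t : ℝ} (ht : t ∈ Ico 0 T) {ρ δ : ℝ} (hδ : 0 < δ) :
    ∀ᶠ s in 𝓝[Ico 0 T] t, ∀ b, Low Z ρ s b → Low Z ρ t (b - δ) := by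
  filter_upwards [S.conv_all ht (half_pos hδ)] with s hs
  obtain ⟨φ, hφ⟩ := hs
  intro b hb n j x y hf
  have h1 := hb n j _ _ (far_shift (fun n => -φ n) hf)
  have e1 := hφ n (x + -φ n)
  have e2 := hφ j (y + -φ j)
  rw [neg_add_cancel_right] at e1 e2
  have e : Z n s (x + -φ n) - Z j s (y + -φ j) = (Z n t x - Z j t y) + (Z n s (x + -φ n) - Z n t x)
    - (Z j s (y + -φ j) - Z j t y) := by abel
  rw [e] at h1
  have h2 := norm_sub_le ((Z n t x - Z j t y) + (Z n s (x + -φ n) - Z n t x)) (Z j s (y + -φ j) - Z j t y)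
  have h3 := norm_add_le (Z n t x - Z j t y) (Z n s (x + -φ n) - Z n t x)
  linarith

lemma low_pos (S : Sol α γ T cα M θ Ω Z) {t : ℝ} (ht : t ∈ Ico 0 T) {ρ : ℝ} (hρ : 0 < ρ) :
    ∃ b > 0, Low Z ρ t b := by
  obtain ⟨σ, hσ, hsep⟩ := S.sep ht
  have h1 : ∀ n, ∃ κ > 0, ∀ x y, ‖Z n t x - Z n t y‖ < κ → distT x y < ρ := by
    intro n
    obtain ⟨c, hc⟩ := S.cv n t ht
    exact hc.unif_inj hρ
  choose κ hκ h2 using h1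
  rcases isEmpty_or_nonempty (Fin N) with he | he
  · exact ⟨1, one_pos, fun n => (he.false n).elim⟩
  obtain ⟨p, hp⟩ := Finite.exists_min κ
  refine ⟨min σ (κ p), lt_min hσ (hκ p), ?_⟩
  intro n j x y hf
  by_cases hnj : n = j
  · subst hnj
    have h3 := hf.resolve_left (by simp)
    by_contra hcon
    push Not at hcon
    have := h2 n x y (hcon.trans_le ((min_le_right _ _).trans (hp n)))
    linarith
  · exact (min_le_left _ _).trans (hsep n j hnj x y)

lemma low_init (S : Sol α γ T cα M θ Ω Z) {ρ : ℝ} (hρ : 0 < ρ) :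
    ∃ b > 0, ∀ t ∈ Icc 0 (T / 2), Low Z ρ t b := by
  have hT := S.T0
  refine isCompact_Icc.induction_on (p := fun A => ∃ b > 0, ∀ t ∈ A, Low Z ρ t b) ⟨1, one_pos, by simp⟩ ?_ ?_ ?_
  · rintro s t hst ⟨b, hb, h⟩
    exact ⟨b, hb, fun x hx => h x (hst hx)⟩
  · rintro s t ⟨b, hb, h⟩ ⟨b', hb', h'⟩
    refine ⟨min b b', lt_min hb hb', ?_⟩
    rintro x (hx | hx) n j y y' hf
    · exact (min_le_left _ _).trans (h x hx n j y y' hf)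
    · exact (min_le_right _ _).trans (h' x hx n j y y' hf)
  · intro t ht
    have ht' : t ∈ Ico 0 T := ⟨ht.1, by linarith [ht.2]⟩
    obtain ⟨b, hb, hl⟩ := S.low_pos ht' hρ
    have h1 := S.low_fwd ht' (half_pos hb) hl
    have h2 : 𝓝[Icc 0 (T / 2)] t ≤ 𝓝[Ico 0 T] t :=
      nhdsWithin_mono _ fun x hx => ⟨hx.1, by linarith [hx.2]⟩
    exact ⟨_, h2 h1, b - b / 2, by linarith, fun x hx => hx⟩

/-- perpendicularity at a minimum -/
lemma perp_min {z : ℝ → R2} {Q : R2} {x b : ℝ} (hz : HasDerivAt z (deriv z x) x) (hb : ‖z x - Q‖ = b) (hb0 : 0 ≤ b)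
    (hloc : ∀ᶠ y in 𝓝 x, b ≤ ‖z y - Q‖) : inner ℝ (deriv z x) (z x - Q) = 0 := by
  have h1 := (hz.sub_const Q).norm_sq
  have h2 : IsLocalMin (fun y => ‖z y - Q‖ ^ 2) x := by
    filter_upwards [hloc] with y hy
    rw [hb]
    exact pow_le_pow_left₀ hb0 hy 2
  have h3 := h2.hasDerivAt_eq_zero h1
  rw [real_inner_comm]
  linarith

variable {c0 ρ0 : ℝ}

lemma far2 (S : Sol α γ T cα M θ Ω Z) (hc0 : 0 < c0) (hcl : ∀ n, ∀ t ∈ Ico 0 T, ∀ c, Cv M γ c (Z n t) → c0 ≤ c)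
    (hρ0 : 0 < ρ0) (hMρ : M * (2 * ρ0) ^ γ ≤ c0 / 2) {t : ℝ} (ht : t ∈ Ico 0 T) {n : Fin N} {x y : ℝ}
    (h1 : ρ0 ≤ distT x y) (h2 : ‖Z n t x - Z n t y‖ < c0 * ρ0 / 2) : 2 * ρ0 < distT x y := by
  obtain ⟨c, hc⟩ := S.cv n t ht
  have hcc := hcl n t ht c hc
  by_contra hcon
  push Not at hcon
  have h3 := hc.chordT S.g0.le (hMρ.trans (by linarith)) hcon
  have h4 := mul_le_mul (show c0 / 2 ≤ c / 2 by linarith) h1 hρ0.le (by linarith [hc.cpos])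
  linarith

set_option maxHeartbeats 400000 in
lemma cmp (S : Sol α γ T cα M θ Ω Z) (hc0 : 0 < c0) (hcl : ∀ n, ∀ t ∈ Ico 0 T, ∀ c, Cv M γ c (Z n t) → c0 ≤ c)
    (hρ0 : 0 < ρ0) (hMρ : M * (2 * ρ0) ^ γ ≤ c0 / 2) {C : ℝ} {t : ℝ} (ht : t ∈ Ico 0 T)
    (hC : ∀ m j ξ η,
      inner ℝ (deriv (Z m t) ξ) (Z m t ξ - Z j t η) = 0 → inner ℝ (deriv (Z j t) η) (Z m t ξ - Z j t η) = 0 →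
      |inner ℝ (gSQGvel α cα θ (fun n => Ω n t) (Z m t ξ) - gSQGvel α cα θ (fun n => Ω n t) (Z j t η)) (Z m t ξ - Z j t η)|
        ≤ C * ‖Z m t ξ - Z j t η‖ ^ 2) {b ε : ℝ} (hb : 0 < b) (hbD : b < c0 * ρ0 / 2) (hlow : Low Z ρ0 t b) (hε : 0 < ε) :
    ∃ τ > 0, ∀ n j x y, (n ≠ j ∨ ρ0 ≤ distT x y) → ‖Z n t x - Z j t y‖ < b + τ →
      -(C * b ^ 2 + ε) ≤ inner ℝ (gSQGvel α cα θ (fun n => Ω n t) (Z n t x) - gSQGvel α cα θ (fun n => Ω n t) (Z j t y)) (Z n t x - Z j t y) := by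
  set u := gSQGvel α cα θ (fun n => Ω n t) with hu
  have huc : Continuous u := vel_cont S.a0 S.a1 θ (S.op t ht) (S.bdd t ht)
  choose c hc using fun n => S.cv n t ht
  clear_value u
  have h1 : ∀ n j, ∃ τ > 0, ∀ x y, (n ≠ j ∨ ρ0 ≤ distT x y) → ‖Z n t x - Z j t y‖ < b + τ →
      -(C * b ^ 2 + ε) ≤ inner ℝ (u (Z n t x) - u (Z j t y)) (Z n t x - Z j t y) := by
    intro n j
    have c1 : Continuous (fun p : ℝ × ℝ => Z n t p.1) := (hc n).cont.comp continuous_fst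
    have c2 : Continuous (fun p : ℝ × ℝ => Z j t p.2) := (hc j).cont.comp continuous_snd
    have c3 : Continuous (fun p : ℝ × ℝ => inner ℝ (u (Z n t p.1) - u (Z j t p.2)) (Z n t p.1 - Z j t p.2)) :=
      ((huc.comp c1).sub (huc.comp c2)).inner (c1.sub c2)
    have c4 : Continuous (fun p : ℝ × ℝ => ‖Z n t p.1 - Z j t p.2‖) := (c1.sub c2).norm
    set K : Set (ℝ × ℝ) := (Icc (0:ℝ) (2 * π) ×ˢ Icc (0:ℝ) (2 * π)) ∩
      ({p | n ≠ j ∨ ρ0 ≤ distT p.1 p.2} ∩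
       {p | inner ℝ (u (Z n t p.1) - u (Z j t p.2)) (Z n t p.1 - Z j t p.2) ≤ -(C * b ^ 2 + ε)}) with hK
    have cfar : IsClosed {p : ℝ × ℝ | n ≠ j ∨ ρ0 ≤ distT p.1 p.2} := by
      by_cases hnj : n = j
      · simp only [hnj, ne_eq, not_true_eq_false, false_or]
        exact isClosed_le continuous_const continuous_distT
      · simp [hnj]
    have hKc : IsCompact K := (isCompact_Icc.prod isCompact_Icc).inter_right
      (cfar.inter (isClosed_le c3 continuous_const))
    have hKb : ∀ p ∈ K, b < ‖Z n t p.1 - Z j t p.2‖ := by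
      rintro ⟨x, y⟩ ⟨-, hf, hk⟩
      have hf : n ≠ j ∨ ρ0 ≤ distT x y := hf
      have hk : inner ℝ (u (Z n t x) - u (Z j t y)) (Z n t x - Z j t y) ≤ -(C * b ^ 2 + ε) := hk
      refine lt_of_le_of_ne (hlow n j x y hf) fun heq => ?_
      have heq : b = ‖Z n t x - Z j t y‖ := heq
      have hf2 : n ≠ j ∨ ρ0 < distT x y := by
        by_cases hnj : n = j
        · subst hnj
          have := S.far2 hc0 hcl hρ0 hMρ ht (hf.resolve_left (by simp)) (n := n) (by rw [← heq]; exact hbD)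
          right; linarith
        · exact Or.inl hnj
      have hl1 : ∀ᶠ x' in 𝓝 x, b ≤ ‖Z n t x' - Z j t y‖ := by
        rcases hf2 with h | h
        · exact Eventually.of_forall fun x' => hlow n j x' y (Or.inl h)
        · have : Continuous (fun x' => distT x' y) := continuous_distT.comp (continuous_id.prodMk continuous_const)
          filter_upwards [this.continuousAt.eventually (lt_mem_nhds h)] with x' hx'
          exact hlow n j x' y (Or.inr (le_of_lt hx'))
      have hl2 : ∀ᶠ y' in 𝓝 y, b ≤ ‖Z j t y' - Z n t x‖ := by
        rcases hf2 with h | h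
        · exact Eventually.of_forall fun y' => by rw [norm_sub_rev]; exact hlow n j x y' (Or.inl h)
        · have : Continuous (fun y' => distT x y') := continuous_distT.comp (continuous_const.prodMk continuous_id)
          filter_upwards [this.continuousAt.eventually (lt_mem_nhds h)] with y' hy'
          rw [norm_sub_rev]
          exact hlow n j x y' (Or.inr (le_of_lt hy'))
      have p1 := perp_min ((hc n).hd x) heq.symm hb.le hl1
      have p2 := perp_min ((hc j).hd y) (by rw [norm_sub_rev]; exact heq.symm) hb.le hl2
      have p3 : inner ℝ (deriv (Z j t) y) (Z n t x - Z j t y) = 0 := by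
        rw [← neg_sub, inner_neg_right, p2, neg_zero]
      have := (abs_le.1 (hC n j x y p1 p3)).1
      rw [← heq] at this
      linarith
    have hred : ∀ τ, (∀ p ∈ K, b + τ ≤ ‖Z n t p.1 - Z j t p.2‖) → ∀ x y, (n ≠ j ∨ ρ0 ≤ distT x y) →
        ‖Z n t x - Z j t y‖ < b + τ →
        -(C * b ^ 2 + ε) ≤ inner ℝ (u (Z n t x) - u (Z j t y)) (Z n t x - Z j t y) := by
      intro τ hτ x y hf hlt
      by_contra hcon
      push Not at hcon
      obtain ⟨k, hk⟩ := exists_rep x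
      obtain ⟨l, hl⟩ := exists_rep y
      have hm : (x + 2 * π * k, y + 2 * π * l) ∈ K := by
        refine ⟨⟨Ico_subset_Icc_self hk, Ico_subset_Icc_self hl⟩, ?_, ?_⟩
        · show n ≠ j ∨ ρ0 ≤ distT (x + 2 * π * k) (y + 2 * π * l)
          rwa [distT_per, distT_per']
        · have e : inner ℝ (u (Z n t (x + 2 * π * k)) - u (Z j t (y + 2 * π * l)))
              (Z n t (x + 2 * π * k) - Z j t (y + 2 * π * l)) ≤ -(C * b ^ 2 + ε) := by
            rw [(hc n).perk, (hc j).perk]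
            exact hcon.le
          exact e
      have h2 : b + τ ≤ ‖Z n t (x + 2 * π * k) - Z j t (y + 2 * π * l)‖ := hτ (x + 2 * π * k, y + 2 * π * l) hm
      rw [(hc n).perk, (hc j).perk] at h2
      linarith
    rcases K.eq_empty_or_nonempty with hKe | hKn
    · exact ⟨1, one_pos, hred 1 (by rw [hKe]; simp)⟩
    · obtain ⟨p, hp, hmin⟩ := hKc.exists_isMinOn hKn c4.continuousOn
      have h2 := hKb p hp
      exact ⟨‖Z n t p.1 - Z j t p.2‖ - b, by linarith, hred _ fun q hq => by
        rw [add_sub_cancel]; exact hmin hq⟩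
  choose τ hτ h using h1
  rcases isEmpty_or_nonempty (Fin N) with he | he
  · exact ⟨1, one_pos, fun n => (he.false n).elim⟩
  obtain ⟨p, hp⟩ := Finite.exists_min (fun p : Fin N × Fin N => τ p.1 p.2)
  exact ⟨τ p.1 p.2, hτ _ _, fun n j x y hf hl => h n j x y hf (hl.trans_le (by linarith [hp (n, j)]))⟩

end Sol

lemma final_ineq {e U r V : R2} {b h C ε ε' : ℝ} (hb : 0 < b) (hh : 0 < h) (he : b ≤ ‖e‖) (hC : 0 ≤ C) (hε' : 0 ≤ ε')
    (hV : V = e + h • U + r) (hr : ‖r‖ ≤ 2 * (ε * h)) (hU : -(C * b ^ 2 + ε') ≤ inner ℝ U e) :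
    b - h * (C * b) - h * (ε' / b) - 2 * (ε * h) ≤ ‖V‖ := by
  have h1 : ‖e + h • U‖ - ‖r‖ ≤ ‖V‖ := by
    rw [hV]
    have := norm_sub_le (e + h • U + r) r
    rw [add_sub_cancel_right] at this
    linarith
  have h2 := real_inner_le_norm (e + h • U) e
  rw [inner_add_left, real_inner_self_eq_norm_sq, inner_smul_left] at h2
  simp only [conj_trivial] at h2
  have h3 := mul_le_mul_of_nonneg_left hU hh.le
  have he0 : 0 < ‖e‖ := hb.trans_le he
  have h4 : ‖e‖ - h * (C * b ^ 2 + ε') / ‖e‖ ≤ ‖e + h • U‖ := by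
    have : (‖e‖ - h * (C * b ^ 2 + ε') / ‖e‖) * ‖e‖ ≤ ‖e + h • U‖ * ‖e‖ := by
      rw [sub_mul, div_mul_cancel₀ _ he0.ne']; linarith
    exact le_of_mul_le_mul_right this he0
  have h5 : h * (C * b ^ 2 + ε') / ‖e‖ ≤ h * (C * b ^ 2 + ε') / b :=
    div_le_div_of_nonneg_left (by positivity) hb he
  have h6 : h * (C * b ^ 2 + ε') / b = h * (C * b) + h * (ε' / b) := by field_simp
  linarith

namespace Sol
variable {α γ T cα M : ℝ} {N : ℕ} {θ : Fin N → ℝ} {Ω : Fin N → ℝ → Set R2} {Z : Fin N → ℝ → ℝ → R2}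
variable {c0 ρ0 : ℝ}

set_option maxHeartbeats 800000 in
lemma dstep (S : Sol α γ T cα M θ Ω Z) (hc0 : 0 < c0) (hcl : ∀ n, ∀ t ∈ Ico 0 T, ∀ c, Cv M γ c (Z n t) → c0 ≤ c)
    (hρ0 : 0 < ρ0) (hMρ : M * (2 * ρ0) ^ γ ≤ c0 / 2) {C : ℝ} (hC0 : 0 < C) {t : ℝ} (ht : t ∈ Ioo 0 T)
    (hC : ∀ m j ξ η,
      inner ℝ (deriv (Z m t) ξ) (Z m t ξ - Z j t η) = 0 → inner ℝ (deriv (Z j t) η) (Z m t ξ - Z j t η) = 0 →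
      |inner ℝ (gSQGvel α cα θ (fun n => Ω n t) (Z m t ξ) - gSQGvel α cα θ (fun n => Ω n t) (Z j t η)) (Z m t ξ - Z j t η)|
        ≤ C * ‖Z m t ξ - Z j t η‖ ^ 2) {b : ℝ} (hb : 0 < b) (hbD : b < c0 * ρ0 / 2) (hlow : Low Z ρ0 t b) :
    ∀ᶠ h in 𝓝[>] (0:ℝ), Low Z ρ0 (t + h) (b * (1 - (C + 1 / 2) * h)) := by
  have ht' : t ∈ Ico 0 T := Ioo_subset_Ico_self ht
  have hM := S.M0
  have hε' : 0 < b ^ 2 / 4 := by positivity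
  obtain ⟨τ, hτ, hcmp⟩ := S.cmp hc0 hcl hρ0 hMρ ht' hC hb hbD hlow hε'
  obtain ⟨σ, hσ, hsep⟩ := S.sep ht'
  have huc : Continuous (gSQGvel α cα θ (fun n => Ω n t)) := vel_cont S.a0 S.a1 θ (S.op t ht') (S.bdd t ht')
  have hpatch := S.patch t ht (b / 8) (by positivity)
  clear hC
  generalize gSQGvel α cα θ (fun n => Ω n t) = u at huc hcmp hpatch
  choose c hc using fun n => S.cv n t ht'
  obtain ⟨κ, hκ, hinj⟩ : ∃ κ > 0, ∀ n x y, ‖Z n t x - Z n t y‖ < κ → distT x y < ρ0 / 2 := by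
    choose κ hκ h2 using fun n => (hc n).unif_inj (half_pos hρ0)
    rcases isEmpty_or_nonempty (Fin N) with he | he
    · exact ⟨1, one_pos, fun n => (he.false n).elim⟩
    obtain ⟨p, hp⟩ := Finite.exists_min κ
    exact ⟨κ p, hκ p, fun n x y h => h2 n x y (h.trans_le (hp n))⟩
  obtain ⟨B, hB0, hB⟩ := vbound huc M
  have hδ1 : 0 < min (κ / 4) (σ / 4) := by positivity
  have hq : 0 < min (min (κ / 4) (σ / 4)) (τ / 4) := by positivity
  filter_upwards [(S.tends ht').eventually (S.conv_all ht' hδ1), (S.tends ht').eventually self_mem_nhdsWithin,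
    hpatch, small (c := min (min (κ / 4) (σ / 4)) (τ / 4) / (b / 8 + B)) (by positivity)] with h hφ hT hp h1
  obtain ⟨φ, hφ⟩ := hφ
  have hh0 := h1.1
  have g1 : h * (b / 8 + B) ≤ min (min (κ / 4) (σ / 4)) (τ / 4) := by
    have := h1.2; rwa [le_div_iff₀ (by positivity)] at this
  have g2 : h * (b / 8 + B) ≤ κ / 4 := g1.trans ((min_le_left _ _).trans (min_le_left _ _))
  have g3 : h * (b / 8 + B) ≤ σ / 4 := g1.trans ((min_le_left _ _).trans (min_le_right _ _))
  have g4 : h * (b / 8 + B) ≤ τ / 4 := g1.trans (min_le_right _ _)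
  -- pullback of a single point
  have pull : ∀ n x, ∃ ξ, ‖Z n (t + h) x - (Z n t ξ + h • u (Z n t ξ))‖ ≤ b / 8 * h ∧
      ‖Z n (t + h) x - Z n t ξ‖ ≤ h * (b / 8 + B) ∧ distT ξ (x + φ n) < ρ0 / 2 := by
    intro n x
    obtain ⟨m, ξ, hm⟩ := hp n x
    have hWP : ‖Z n (t + h) x - Z m t ξ‖ ≤ h * (b / 8 + B) := by
      have e1 : Z n (t + h) x - Z m t ξ = (Z n (t + h) x - (Z m t ξ + h • u (Z m t ξ))) + h • u (Z m t ξ) := by abel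
      rw [e1]
      refine (norm_add_le _ _).trans ?_
      rw [norm_smul, Real.norm_of_nonneg hh0.le]
      have e2 := mul_le_mul_of_nonneg_left (hB _ ((hc m).bd ξ)) hh0.le
      linarith
    have e2 : Z m t ξ - Z n t (x + φ n) = (Z n (t + h) x - Z n t (x + φ n)) - (Z n (t + h) x - Z m t ξ) := by abel
    have e3 := norm_sub_le (Z n (t + h) x - Z n t (x + φ n)) (Z n (t + h) x - Z m t ξ)
    rw [← e2] at e3
    have e4 := (hφ n x).trans (min_le_right _ _)
    have e5 := (hφ n x).trans (min_le_left _ _)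
    have hmn : m = n := by
      by_contra hne
      have e1 := hsep m n hne ξ (x + φ n)
      linarith
    subst hmn
    exact ⟨ξ, hm, hWP, hinj m _ _ (by linarith)⟩
  intro n j x y hf
  by_contra hcon
  push Not at hcon
  have hbb : ‖Z n (t + h) x - Z j (t + h) y‖ < b := by
    have : 0 < b * ((C + 1 / 2) * h) := by positivity
    linarith
  obtain ⟨ξ, x1, x2, x3⟩ := pull n x
  obtain ⟨ζ, y1, y2, y3⟩ := pull j y
  have hfar : n ≠ j ∨ ρ0 ≤ distT ξ ζ := by
    by_cases hnj : n = j
    · subst hnj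
      right
      have e1 := S.far2 hc0 hcl hρ0 hMρ hT (hf.resolve_left (by simp)) (hbb.trans hbD)
      have e2 := distT_tri3 (x + φ n) (y + φ n) ξ ζ
      rw [distT_shift, distT_comm (x + φ n), distT_comm (y + φ n)] at e2
      linarith
    · exact Or.inl hnj
  have e1 := hlow n j ξ ζ hfar
  have e2 : ‖Z n t ξ - Z j t ζ‖ < b + τ := by
    have e3 : Z n t ξ - Z j t ζ = (Z n (t + h) x - Z j (t + h) y) - (Z n (t + h) x - Z n t ξ) + (Z j (t + h) y - Z j t ζ) := by abel
    rw [e3]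
    have e4 := norm_add_le ((Z n (t + h) x - Z j (t + h) y) - (Z n (t + h) x - Z n t ξ)) (Z j (t + h) y - Z j t ζ)
    have e5 := norm_sub_le (Z n (t + h) x - Z j (t + h) y) (Z n (t + h) x - Z n t ξ)
    linarith
  have e3 := hcmp n j ξ ζ hfar e2
  have e4 := final_ineq (V := Z n (t + h) x - Z j (t + h) y) (ε := b / 8)
    (r := (Z n (t + h) x - (Z n t ξ + h • u (Z n t ξ))) - (Z j (t + h) y - (Z j t ζ + h • u (Z j t ζ))))
    hb hh0 e1 hC0.le hε'.le (by rw [smul_sub]; abel) ((norm_sub_le _ _).trans (by linarith)) e3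
  have e5 : h * (b ^ 2 / 4 / b) = h * b / 4 := by field_simp
  rw [e5] at e4
  linarith

lemma exp_small {C : ℝ} (hC : 0 < C) : ∀ᶠ h in 𝓝[>] (0:ℝ), Real.exp (-((C + 1) * h)) ≤ 1 - (C + 1 / 2) * h := by
  filter_upwards [small (c := 1 / (2 * ((C + 1) * (C + 1 / 2)))) (by positivity)] with h hh
  have h1 := hh.2
  rw [le_div_iff₀ (by positivity)] at h1
  have h0 := hh.1
  rw [Real.exp_neg, inv_le_comm₀ (Real.exp_pos _) (by
    have : h * (2 * (C + 1 / 2)) ≤ h * (2 * ((C + 1) * (C + 1 / 2))) := by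
      apply mul_le_mul_of_nonneg_left _ h0.le
      nlinarith
    linarith)]
  have hpos : 0 < 1 - (C + 1 / 2) * h := by
    have : h * (2 * (C + 1 / 2)) ≤ h * (2 * ((C + 1) * (C + 1 / 2))) := by
      apply mul_le_mul_of_nonneg_left _ h0.le
      nlinarith
    linarith
  have h2 := Real.add_one_le_exp ((C + 1) * h)
  refine le_trans ?_ h2
  rw [inv_le_iff_one_le_mul₀ hpos]
  have h3 := mul_le_mul_of_nonneg_left h1 h0.le
  nlinarith

lemma low_unif (S : Sol α γ T cα M θ Ω Z) (hc0 : 0 < c0) (hcl : ∀ n, ∀ t ∈ Ico 0 T, ∀ c, Cv M γ c (Z n t) → c0 ≤ c)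
    (hρ0 : 0 < ρ0) (hMρ : M * (2 * ρ0) ^ γ ≤ c0 / 2) : ∃ b > 0, ∀ t ∈ Ico 0 T, Low Z ρ0 t b := by
  have hT := S.T0
  have hMρ' : M * ρ0 ^ γ ≤ c0 / 2 := le_trans (mul_le_mul_of_nonneg_left
    (Real.rpow_le_rpow hρ0.le (by linarith) S.g0.le) S.M0.le) hMρ
  obtain ⟨C, hC0, hV⟩ := V_est S.a0 S.a1 S.g S.M0 hc0 hρ0 hMρ' cα θ
  obtain ⟨b0, hb0, hinit⟩ := S.low_init hρ0
  set b1 : ℝ := min b0 (c0 * ρ0 / 4) with hb1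
  have hb1p : 0 < b1 := by positivity
  set E : ℝ → ℝ := fun t => b1 * Real.exp (-((C + 1) * (t - T / 2))) with hE
  have hEc : Continuous E := by rw [hE]; fun_prop
  have hEp : ∀ t, 0 < E t := fun t => mul_pos hb1p (Real.exp_pos _)
  have hEl : ∀ t, T / 2 ≤ t → E t ≤ b1 := fun t ht => by
    have : Real.exp (-((C + 1) * (t - T / 2))) ≤ 1 := Real.exp_le_one_iff.2 (by
      have : 0 ≤ (C + 1) * (t - T / 2) := mul_nonneg (by linarith) (by linarith)
      linarith)
    have := mul_le_mul_of_nonneg_left this hb1p.le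
    simp only [hE]; linarith
  have hEm : ∀ t, t ≤ T → E T ≤ E t := fun t ht => by
    simp only [hE]
    apply mul_le_mul_of_nonneg_left _ hb1p.le
    apply Real.exp_le_exp.2
    have : (C + 1) * (t - T / 2) ≤ (C + 1) * (T - T / 2) := mul_le_mul_of_nonneg_left (by linarith) (by linarith)
    linarith
  have mono : ∀ {t b b'}, b' ≤ b → Low Z ρ0 t b → Low Z ρ0 t b' := fun h hl n j x y hf => h.trans (hl n j x y hf)
  have main : ∀ t2, T / 2 ≤ t2 → t2 < T → ∀ t ∈ Icc (T / 2) t2, Low Z ρ0 t (E t) := by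
    intro t2 h2 h2T
    have hcl' : IsClosed ({t | Low Z ρ0 t (E t)} ∩ Icc (T / 2) t2) := by
      rw [isClosed_iff_frequently]
      intro t hfr
      have htI : t ∈ Icc (T / 2) t2 := by
        have := isClosed_iff_frequently.1 (isClosed_Icc (a := T / 2) (b := t2)) t (hfr.mono fun x hx => hx.2)
        exact this
      have htT : t ∈ Ico 0 T := ⟨by linarith [htI.1], by linarith [htI.2]⟩
      refine ⟨?_, htI⟩
      have key : ∀ δ > 0, Low Z ρ0 t (E t - 2 * δ) := by
        intro δ hδ
        have e1 := S.low_bwd (ρ := ρ0) htT hδ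
        rw [eventually_nhdsWithin_iff] at e1
        have e2 : ∀ᶠ s in 𝓝 t, E t - δ < E s := hEc.continuousAt.eventually (lt_mem_nhds (by linarith))
        obtain ⟨s, ⟨hs1, hs2⟩, hs3, hs4⟩ := (hfr.and_eventually (e1.and e2)).exists
        have hs5 : Low Z ρ0 s (E s) := hs1
        exact mono (by linarith) (hs3 ⟨by linarith [hs2.1], by linarith [hs2.2]⟩ _ hs5)
      show Low Z ρ0 t (E t)
      intro n j x y hf
      refine le_of_forall_pos_le_add fun δ hδ => ?_
      have := key (δ / 2) (half_pos hδ) n j x y hf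
      linarith
    refine hcl'.Icc_subset_of_forall_mem_nhdsWithin ?_ ?_
    · show Low Z ρ0 (T / 2) (E (T / 2))
      exact mono ((hEl _ le_rfl).trans (min_le_left _ _)) (hinit _ ⟨by linarith, le_rfl⟩)
    · rintro t ⟨hlow, htI⟩
      have hlow' : Low Z ρ0 t (E t) := hlow
      have htT : t ∈ Ioo 0 T := ⟨by linarith [htI.1], by linarith [htI.2]⟩
      have htT' := Ioo_subset_Ico_self htT
      choose c hc using fun n => S.cv n t htT'
      have hVt := hV (fun n => Z n t) c (fun n => Ω n t) hc (fun m => hcl m t htT' _ (hc m)) (S.op t htT')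
        (S.bdd t htT') (S.fr t htT') (S.disj t htT')
      have hbD : E t < c0 * ρ0 / 2 := by
        have e1 := (hEl t htI.1).trans (min_le_right _ _)
        have e2 : 0 < c0 * ρ0 := by positivity
        linarith
      have hst := S.dstep hc0 hcl hρ0 hMρ hC0 htT hVt (hEp t) hbD hlow'
      have hmap : Tendsto (fun y => y - t) (𝓝[>] t) (𝓝[>] 0) := by
        rw [tendsto_nhdsWithin_iff]
        constructor
        · have : Tendsto (fun y : ℝ => y - t) (𝓝 t) (𝓝 (t - t)) := (continuous_id.sub continuous_const).tendsto t
          rw [sub_self] at this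
          exact this.mono_left nhdsWithin_le_nhds
        · filter_upwards [self_mem_nhdsWithin] with y hy
          have hy1 : t < y := hy
          exact sub_pos.2 hy1
      filter_upwards [hmap.eventually hst, hmap.eventually (exp_small hC0)] with s hs hs2
      rw [add_sub_cancel] at hs
      show Low Z ρ0 s (E s)
      refine mono ?_ hs
      have e3 := mul_le_mul_of_nonneg_left hs2 (hEp t).le
      refine le_trans (le_of_eq ?_) e3
      simp only [hE]
      rw [mul_assoc, ← Real.exp_add]
      congr 2; ring
  refine ⟨min b0 (E T), lt_min hb0 (hEp T), fun t ht => ?_⟩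
  rcases le_total t (T / 2) with h | h
  · exact mono (min_le_left _ _) (hinit t ⟨ht.1, h⟩)
  · exact mono ((min_le_right _ _).trans (hEm t ht.2.le)) (main t h ht.2 t ⟨h, le_rfl⟩)

lemma final (S : Sol α γ T cα M θ Ω Z) : ∃ C : ℝ, ∀ t ∈ Ico 0 T, ∀ n j : Fin N, ∀ ξ η : ℝ, (n ≠ j ∨ distT ξ η ≠ 0) →
      (|((n : ℕ) : ℤ) - ((j : ℕ) : ℤ)| : ℝ) + distT ξ η ≤ C * ‖Z n t ξ - Z j t η‖ := by
  have hM := S.M0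
  have hγ := S.g0
  obtain ⟨c0, hc0, hcl⟩ := S.c_low
  set ρ0 : ℝ := (c0 / (2 * M)) ^ (1 / γ) / 2 with hρ
  have hρ0 : 0 < ρ0 := by positivity
  have hMρ : M * (2 * ρ0) ^ γ ≤ c0 / 2 := by
    rw [hρ, mul_div_cancel₀ _ (two_ne_zero), ← Real.rpow_mul (by positivity), one_div_mul_cancel hγ.ne', Real.rpow_one]
    apply le_of_eq; field_simp
  have hMρ' : M * ρ0 ^ γ ≤ c0 / 2 := le_trans (mul_le_mul_of_nonneg_left
    (Real.rpow_le_rpow hρ0.le (by linarith) hγ.le) hM.le) hMρ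
  obtain ⟨b, hb, hlow⟩ := S.low_unif hc0 hcl hρ0 hMρ
  have hpi := Real.pi_pos
  refine ⟨2 / c0 + (N + π) / b, fun t ht n j ξ η hne => ?_⟩
  have hnn := norm_nonneg (Z n t ξ - Z j t η)
  by_cases hf : n ≠ j ∨ ρ0 ≤ distT ξ η
  · have h1 := hlow t ht n j ξ η hf
    have h2 : (|((n : ℕ) : ℤ) - ((j : ℕ) : ℤ)| : ℝ) ≤ N := by
      have a1 : ((n : ℕ) : ℝ) < N := by exact_mod_cast n.2
      have a2 : ((j : ℕ) : ℝ) < N := by exact_mod_cast j.2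
      have a3 : (0:ℝ) ≤ ((n : ℕ) : ℝ) := by positivity
      have a4 : (0:ℝ) ≤ ((j : ℕ) : ℝ) := by positivity
      push_cast
      rw [abs_le]; constructor <;> linarith
    have h3 := distT_le_pi ξ η
    have h4 : (N + π) ≤ (N + π) / b * ‖Z n t ξ - Z j t η‖ := by
      rw [div_mul_eq_mul_div, le_div_iff₀ hb]
      exact mul_le_mul_of_nonneg_left h1 (by positivity)
    have h5 : 0 ≤ 2 / c0 * ‖Z n t ξ - Z j t η‖ := by positivity
    linarith
  · push Not at hf
    obtain ⟨rfl, h1⟩ := hf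
    obtain ⟨c, hc⟩ := S.cv n t ht
    have hcc := hcl n t ht c hc
    have h2 := hc.chordT hγ.le (hMρ'.trans (by linarith)) h1.le
    have h3 := mul_le_mul_of_nonneg_right (show c0 / 2 ≤ c / 2 by linarith) (distT_nonneg ξ η)
    have h4 : distT ξ η ≤ 2 / c0 * ‖Z n t ξ - Z n t η‖ := by
      rw [div_mul_eq_mul_div, le_div_iff₀ hc0]; linarith
    have h5 : 0 ≤ (N + π) / b * ‖Z n t ξ - Z n t η‖ := by positivity
    simp only [sub_self, abs_zero, zero_add]
    linarith

end Sol

/-- (Theorem 1.3, absence of splash-like singularities) Let `α ∈ (0,1/4]`,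
`γ = 2α/(1−2α)`, and let `ω = Σ_{n} θₙ χ_{Ωₙ(t)}` be a patch solution to the g-SQG equation
on `ℝ²` on `[0,T)`, `T < ∞`, whose patch boundaries are parameterized by constant-speed
counterclockwise parameterizations `zₙ(·,t)`, with
`sup_{t∈[0,T)} ‖Ω(t)‖_{C^{1,γ}} < ∞`.  Then
`sup_{t∈[0,T)} sup_{(n,ξ)≠(j,η)} (|n−j| + |ξ−η|)/|zₙ(ξ,t) − z_j(η,t)| < ∞`:
no splash-like singularity can occur at time `T`. -/
theorem no_splash_singularity
    (α γ T cα : ℝ) (N : ℕ) (θ : Fin N → ℝ)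
    (Ω : Fin N → ℝ → Set R2) (z : Fin N → ℝ → ℝ → R2)
    (hα0 : 0 < α) (hα : α ≤ 1 / 4) (hγ : γ = 2 * α / (1 - 2 * α))
    (hT : 0 < T) (hcα : 0 < cα) (hθ : ∀ n, θ n ≠ 0)
    -- each `Ωₙ(t)` is a bounded open set
    (hopen : ∀ n, ∀ t ∈ Ico 0 T, IsOpen (Ω n t))
    (hbdd : ∀ n, ∀ t ∈ Ico 0 T, Bornology.IsBounded (Ω n t))
    -- the boundaries are pairwise disjoint
    (hdisj : ∀ t ∈ Ico 0 T, ∀ n j : Fin N, n ≠ j →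
      frontier (Ω n t) ∩ frontier (Ω j t) = ∅)
    -- `zₙ(·,t)` is a simple closed `C¹` curve parameterizing `∂Ωₙ(t)`
    (hzper : ∀ n, ∀ t ∈ Ico 0 T, ∀ ξ : ℝ, z n (ξ + 2 * π) t = z n ξ t)
    (hzinj : ∀ n, ∀ t ∈ Ico 0 T, InjOn (fun ξ => z n ξ t) (Ico 0 (2 * π)))
    (hzC1 : ∀ n, ∀ t ∈ Ico 0 T, ContDiff ℝ 1 (fun ξ => z n ξ t))
    (hzim : ∀ n, ∀ t ∈ Ico 0 T, (fun ξ => z n ξ t) '' Ico 0 (2 * π) = frontier (Ω n t))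
    -- with constant speed
    (hspeed : ∀ n, ∀ t ∈ Ico 0 T, ∃ c : ℝ, 0 < c ∧
      ∀ ξ : ℝ, ‖deriv (fun ζ => z n ζ t) ξ‖ = c)
    -- counterclockwise (positive signed area)
    (hccw : ∀ n, ∀ t ∈ Ico 0 T,
      0 < ∫ ξ in (0:ℝ)..(2 * π),
        (z n ξ t 0 * (deriv (fun ζ => z n ζ t) ξ) 1
          - z n ξ t 1 * (deriv (fun ζ => z n ζ t) ξ) 0))
    -- each boundary is continuous in time w.r.t. Hausdorff distance
    (hHaus : ∀ n, ∀ t₀ ∈ Ico 0 T,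
      Tendsto (fun t => Metric.hausdorffDist (frontier (Ω n t)) (frontier (Ω n t₀)))
        (nhdsWithin t₀ (Ico 0 T)) (nhds 0))
    -- patch solution: `lim_{h→0} d_H(∂Ω(t+h), X^h_{u(·,t)}[∂Ω(t)])/h = 0`
    (hpatch : ∀ t ∈ Ioo 0 T,
      Tendsto (fun h =>
          Metric.hausdorffDist (⋃ n, frontier (Ω n (t + h)))
            ((fun x => x + h • gSQGvel α cα θ (fun n => Ω n t) x) ''
              ⋃ n, frontier (Ω n t)) / |h|)
        (nhdsWithin 0 {h : ℝ | t + h ∈ Ico 0 T ∧ h ≠ 0}) (nhds 0))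
    -- uniform `C^{1,γ}` bound on the patch boundaries
    (hC1γ : ∃ M : ℝ, ∀ n, ∀ t ∈ Ico 0 T, ∀ ξ η : ℝ,
      ‖z n ξ t‖ ≤ M ∧ ‖deriv (fun ζ => z n ζ t) ξ‖ ≤ M ∧
        ‖deriv (fun ζ => z n ζ t) ξ - deriv (fun ζ => z n ζ t) η‖ ≤ M * |ξ - η| ^ γ) :
    -- conclusion: the arc-chord ratio stays uniformly bounded up to time `T`
    ∃ C : ℝ, ∀ t ∈ Ico 0 T, ∀ n j : Fin N, ∀ ξ η : ℝ, (n ≠ j ∨ distT ξ η ≠ 0) →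
      (|((n : ℕ) : ℤ) - ((j : ℕ) : ℤ)| : ℝ) + distT ξ η ≤ C * ‖z n ξ t - z j η t‖ := by
  have hper : ∀ n, ∀ t ∈ Ico 0 T, ∀ (x : ℝ) (k : ℤ), z n (x + 2 * π * k) t = z n x t := by
    intro n t ht x k
    have : Function.Periodic (fun x => z n x t) (2 * π) := hzper n t ht
    have h2 := this.int_mul k x
    rw [mul_comm]; exact h2
  have him : ∀ n, ∀ t ∈ Ico 0 T, ∀ x : ℝ, z n x t ∈ frontier (Ω n t) := by
    intro n t ht x
    obtain ⟨k, hk⟩ := exists_rep x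
    rw [← hzim n t ht]
    exact ⟨x + 2 * π * k, hk, hper n t ht x k⟩
  have him' : ∀ n, ∀ t ∈ Ico 0 T, ∀ p ∈ frontier (Ω n t), ∃ x, z n x t = p := by
    intro n t ht p hp
    rw [← hzim n t ht] at hp
    obtain ⟨x, -, hx⟩ := hp
    exact ⟨x, hx⟩
  have hcpt : ∀ n, ∀ t ∈ Ico 0 T, IsCompact (frontier (Ω n t)) := fun n t ht =>
    Metric.isCompact_of_isClosed_isBounded isClosed_frontier
      ((hbdd n t ht).closure.subset frontier_subset_closure)
  have hne : ∀ n, ∀ t ∈ Ico 0 T, (frontier (Ω n t)).Nonempty := fun n t ht => ⟨_, him n t ht 0⟩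
  obtain ⟨M, hM⟩ := hC1γ
  have hM0 : 0 < max M 1 := by positivity
  have S : Sol α γ T cα (max M 1) θ Ω (fun n t ξ => z n ξ t) := by
    refine ⟨hα0, hα, hγ, hM0, hT, ?_, ?_, fun t ht n => hopen n t ht, fun t ht n => hbdd n t ht, ?_, ?_, ?_, ?_⟩
    · intro n t ht
      obtain ⟨c, hc, hsp⟩ := hspeed n t ht
      refine ⟨c, ⟨hzper n t ht, ?_, hzC1 n t ht, hsp, hc, fun x => ((hM n t ht x x).1).trans (le_max_left _ _), ?_, ?_⟩⟩
      · intro x y hxy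
        obtain ⟨k, hk⟩ := exists_rep x
        obtain ⟨l, hl⟩ := exists_rep y
        have h1 : x + 2 * π * k = y + 2 * π * l := hzinj n t ht hk hl (by
          show z n (x + 2 * π * k) t = z n (y + 2 * π * l) t
          rw [hper n t ht, hper n t ht]; exact hxy)
        rw [← distT_per x y k, ← distT_per' _ y l, h1]
        exact le_antisymm (by simpa using distT_le_abs (y + 2 * π * l) (y + 2 * π * l)) (distT_nonneg _ _)
      · intro x y
        exact ((hM n t ht x y).2.2).trans (mul_le_mul_of_nonneg_right (le_max_left _ _) (by positivity))
      · rw [← hsp 0]; exact ((hM n t ht 0 0).2.1).trans (le_max_left _ _)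
    · intro n t ht
      exact hccw n t ht
    · intro t ht n p hp
      rw [← hzim n t ht] at hp
      exact image_mono Ico_subset_Icc_self hp
    · intro t ht n j hnj x y hxy
      have h1 : z n x t ∈ frontier (Ω n t) ∩ frontier (Ω j t) := ⟨him n t ht x, by
        have h2 : z n x t = z j y t := hxy
        rw [h2]; exact him j t ht y⟩
      rw [hdisj t ht n j hnj] at h1
      exact h1
    · intro n t₀ ht₀ ε hε
      filter_upwards [(hHaus n t₀ ht₀).eventually (gt_mem_nhds hε), self_mem_nhdsWithin] with t hd ht
      have hfin := Metric.hausdorffEDist_ne_top_of_nonempty_of_bounded (hne n t ht) (hne n t₀ ht₀)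
        (hcpt n t ht).isBounded (hcpt n t₀ ht₀).isBounded
      constructor
      · intro η
        obtain ⟨p, hp, hp1⟩ := Metric.exists_dist_lt_of_hausdorffDist_lt (him n t ht η) hd hfin
        obtain ⟨x, rfl⟩ := him' n t₀ ht₀ p hp
        exact ⟨x, by rw [← dist_eq_norm]; exact hp1.le⟩
      · intro ξ
        obtain ⟨p, hp, hp1⟩ := Metric.exists_dist_lt_of_hausdorffDist_lt' (him n t₀ ht₀ ξ) hd hfin
        obtain ⟨x, rfl⟩ := him' n t ht p hp
        exact ⟨x, by rw [← dist_eq_norm, dist_comm]; exact hp1.le⟩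
    · intro t ht ε hε
      have ht' : t ∈ Ico 0 T := Ioo_subset_Ico_self ht
      have hle : 𝓝[>] (0:ℝ) ≤ nhdsWithin 0 {h : ℝ | t + h ∈ Ico 0 T ∧ h ≠ 0} := by
        rw [nhdsWithin]
        refine le_inf nhdsWithin_le_nhds (le_principal_iff.2 ?_)
        have : Ioo 0 (T - t) ∈ 𝓝[>] (0:ℝ) := Ioo_mem_nhdsGT (by linarith [ht.2])
        filter_upwards [this] with h hh
        exact ⟨⟨by linarith [ht.1, hh.1], by linarith [hh.2]⟩, hh.1.ne'⟩
      have huc : Continuous (gSQGvel α cα θ (fun n => Ω n t)) :=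
        vel_cont hα0 hα θ (fun n => hopen n t ht') (fun n => hbdd n t ht')
      have hev := (hpatch t ht).eventually (gt_mem_nhds hε)
      have hin : ∀ᶠ h in nhdsWithin 0 {h : ℝ | t + h ∈ Ico 0 T ∧ h ≠ 0}, t + h ∈ Ico 0 T := by
        filter_upwards [self_mem_nhdsWithin] with h hh
        exact hh.1
      filter_upwards [hle hev, hle hin, self_mem_nhdsWithin] with h hd hTh hpos n ξ
      have hpos' : 0 < h := hpos
      have hd' : Metric.hausdorffDist (⋃ n, frontier (Ω n (t + h)))
            ((fun x => x + h • gSQGvel α cα θ (fun n => Ω n t) x) ''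
              ⋃ n, frontier (Ω n t)) / |h| < ε := hd
      rw [abs_of_pos hpos', div_lt_iff₀ hpos'] at hd'
      have k1 : IsCompact (⋃ n, frontier (Ω n (t + h))) := isCompact_iUnion fun n => hcpt n _ hTh
      have k2 : IsCompact ((fun x => x + h • gSQGvel α cα θ (fun n => Ω n t) x) '' ⋃ n, frontier (Ω n t)) :=
        (isCompact_iUnion fun n => hcpt n _ ht').image (continuous_id.add (huc.const_smul h))
      have m1 : z n ξ (t + h) ∈ ⋃ n, frontier (Ω n (t + h)) := mem_iUnion.2 ⟨n, him n _ hTh ξ⟩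
      have m2 : z n ξ t ∈ ⋃ n, frontier (Ω n t) := mem_iUnion.2 ⟨n, him n _ ht' ξ⟩
      have hfin := Metric.hausdorffEDist_ne_top_of_nonempty_of_bounded ⟨_, m1⟩ ⟨_, mem_image_of_mem _ m2⟩
        k1.isBounded k2.isBounded
      obtain ⟨p, ⟨q, hq, rfl⟩, hp1⟩ := Metric.exists_dist_lt_of_hausdorffDist_lt m1 hd' hfin
      obtain ⟨m, hm⟩ := mem_iUnion.1 hq
      obtain ⟨x, rfl⟩ := him' m t ht' q hm
      exact ⟨m, x, by rw [← dist_eq_norm]; exact hp1.le⟩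
  exact S.final

end
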